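/- Let p be a polynomial with complex coefficients having at least 3 distinct roots, and let ξ be a root of p with immediate basin U_ξ. Then every connected component of the frontier of U_ξ in ℂ contains at least one pole of the Newton map: for every w in the frontier of U_ξ, the connected component of the frontier of U_ξ containing w contains a point z with p′(z) = 0 and p(z) ≠ 0. -/

import Mathlib

/-- The Newton map of a polynomial `p`: `N_p(z) = z - p(z)/p'(z)`
(with the convention that division by zero yields 0, so `N_p(z) = z` when `p'(z) = 0`). -/
noncomputable def NewtonMap (p : Polynomial ℂ) (z : ℂ) : ℂ :=
  z - Polynomial.eval z p / Polynomial.eval z (Polynomial.derivative p)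

/-- The basin of attraction of `ξ` under the Newton map of `p`:
all points whose orbit under iteration of `N_p` converges to `ξ`. -/
noncomputable def NewtonBasin (p : Polynomial ℂ) (ξ : ℂ) : Set ℂ :=
  {z : ℂ | Filter.Tendsto (fun n => (NewtonMap p)^[n] z) Filter.atTop (nhds ξ)}

/-- The immediate basin of a root `ξ`: the connected component of the basin `B_ξ`
containing `ξ`. -/
noncomputable def NewtonImmediateBasin (p : Polynomial ℂ) (ξ : ℂ) : Set ℂ :=
  connectedComponentIn (NewtonBasin p ξ) ξ

section
open Complex Metric Set Filter Topology

namespace NewtonPf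

/-- log of `z - a` on a compact set with preconnected complement. -/
lemma exists_log_sub {L : Set ℂ} (hL : IsCompact L) (hT : IsPreconnected Lᶜ) :
    ∀ a ∈ Lᶜ, ∃ h : ℂ → ℂ, ContinuousOn h L ∧ ∀ z ∈ L, exp (h z) = z - a := by
  rcases L.eq_empty_or_nonempty with rfl | hne
  · intro a _; exact ⟨fun _ => 0, by simp, by simp⟩
  set A : Set ℂ := {a | a ∈ Lᶜ ∧ ∃ h : ℂ → ℂ, ContinuousOn h L ∧ ∀ z ∈ L, exp (h z) = z - a}
  have key : ∀ a b, (∀ z ∈ L, ‖a - b‖ < ‖z - a‖) → a ∈ A → b ∈ Lᶜ → b ∈ A := by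
    rintro a b hab ⟨ha, h, hc, he⟩ hb
    have hne : ∀ z ∈ L, z - a ≠ 0 := fun z hz h0 => ha (by rw [sub_eq_zero] at h0; exact h0 ▸ hz)
    have hs : ∀ z ∈ L, (z - b) / (z - a) ∈ slitPlane := by
      intro z hz
      apply ball_one_subset_slitPlane
      rw [mem_ball, dist_eq_norm, div_sub_one (hne z hz), norm_div, div_lt_one]
      · rw [show z - b - (z - a) = a - b by ring]; exact hab z hz
      · exact norm_pos_iff.2 (hne z hz)
    refine ⟨hb, fun z => h z + log ((z - b) / (z - a)), ?_, ?_⟩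
    · refine hc.add (ContinuousOn.clog ?_ hs)
      exact ContinuousOn.div (by fun_prop) (by fun_prop) hne
    · intro z hz
      have := slitPlane_ne_zero (hs z hz)
      rw [exp_add, he z hz, exp_log this, mul_div_cancel₀ _ (hne z hz)]
  have hpos : ∀ a ∈ Lᶜ, 0 < infDist a L := fun a ha =>
    (hL.isClosed.notMem_iff_infDist_pos hne).1 ha
  have hball : ∀ a ∈ Lᶜ, ∀ b, dist b a < infDist a L / 2 → b ∈ Lᶜ ∧
      (∀ z ∈ L, ‖a - b‖ < ‖z - a‖) ∧ (∀ z ∈ L, ‖b - a‖ < ‖z - b‖) := by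
    intro a ha b hb
    have h1 : ∀ z ∈ L, infDist a L ≤ dist a z := fun z hz => infDist_le_dist_of_mem hz
    have hp := hpos a ha
    have h3 : ∀ z ∈ L, ‖b - a‖ < ‖z - b‖ := by
      intro z hz
      have := h1 z hz
      have t := dist_triangle a b z
      rw [dist_comm a b] at t
      rw [← dist_eq_norm, ← dist_eq_norm, dist_comm z b]; linarith
    refine ⟨fun hbL => ?_, ?_, h3⟩
    · have := h3 b hbL; simp at this
      linarith [norm_nonneg (b - a)]
    · intro z hz
      have := h1 z hz
      rw [← dist_eq_norm, ← dist_eq_norm, dist_comm z a, dist_comm a b]; linarith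
  have hAo : IsOpen A := by
    rw [Metric.isOpen_iff]
    intro a ha
    refine ⟨infDist a L / 2, by have := hpos a ha.1; positivity, fun b hb => ?_⟩
    obtain ⟨h1, h2, h3⟩ := hball a ha.1 b hb
    exact key a b h2 ha h1
  have hBo : IsOpen (Lᶜ \ A) := by
    rw [Metric.isOpen_iff]
    intro a ha
    refine ⟨infDist a L / 2, by have := hpos a ha.1; positivity, fun b hb => ?_⟩
    obtain ⟨h1, h2, h3⟩ := hball a ha.1 b hb
    exact ⟨h1, fun hbA => ha.2 (key b a h3 hbA ha.1)⟩
  obtain ⟨R, hR⟩ := hL.isBounded.subset_ball 0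
  have hRA : (((|R| + 1 : ℝ) : ℂ)) ∈ A := by
    have hs : ∀ z ∈ L, ‖z‖ < R := fun z hz => by simpa using hR hz
    have hs2 : ∀ z ∈ L, ((|R| + 1 : ℝ) : ℂ) - z ∈ slitPlane := by
      intro z hz
      left
      have := (abs_re_le_norm z).trans_lt (hs z hz)
      have := le_abs_self z.re
      have := le_abs_self R
      simp; linarith
    refine ⟨fun h => ?_, fun z => log (((|R| + 1 : ℝ) : ℂ) - z) + Real.pi * I, ?_, ?_⟩
    · have := slitPlane_ne_zero (hs2 _ h); simp at this
    · exact (ContinuousOn.clog (by fun_prop) hs2).add continuousOn_const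
    · intro z hz
      rw [exp_add, exp_log (slitPlane_ne_zero (hs2 z hz)), exp_pi_mul_I]; ring
  have hsub : Lᶜ ⊆ A := by
    refine IsPreconnected.subset_left_of_subset_union hAo hBo ?_ ?_ ⟨_, hRA.1, hRA⟩ hT
    · exact disjoint_sdiff_right
    · intro x hx; by_cases h : x ∈ A
      · exact Or.inl h
      · exact Or.inr ⟨hx, h⟩
  exact fun a ha => (hsub ha).2

/-- Square roots on one-ended planar domains. -/
lemma exists_sqrt {U : Set ℂ} (hUo : IsOpen U) (K : ℕ → Set ℂ) (hK : ∀ n, IsCompact (K n))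
    (hKU : ∀ n, K n ⊆ U) (hKe : ∀ z ∈ U, ∃ V ∈ 𝓝 z, ∀ᶠ n in atTop, V ⊆ K n)
    (hKc : ∀ n, IsPreconnected (U \ K n)) {f : ℂ → ℂ} (hf : DifferentiableOn ℂ f U)
    (hfi : InjOn f U) (hfo : IsOpen (f '' U)) (hne : U.Nonempty) {a : ℂ} (ha : a ∉ f '' U) :
    ∃ g : ℂ → ℂ, DifferentiableOn ℂ g U ∧ ∀ z ∈ U, g z ^ 2 = f z - a := by
  have h1 : ∀ n, ∃ g : ℂ → ℂ, ContinuousOn g (K n) ∧ ∀ z ∈ K n, g z ^ 2 = f z - a := by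
    intro n
    have hLc : IsCompact (f '' K n) := (hK n).image_of_continuousOn (hf.continuousOn.mono (hKU n))
    have hsub : f '' K n ⊆ f '' U := image_mono (hKU n)
    have hM : IsPreconnected (f '' (U \ K n)) :=
      (hKc n).image f (hf.continuousOn.mono sdiff_subset)
    have hMsub : f '' (U \ K n) ⊆ (f '' K n)ᶜ := by
      rintro _ ⟨z, hz, rfl⟩ ⟨w, hw, hwz⟩
      exact hz.2 (hfi (hKU n hw) hz.1 hwz ▸ hw)
    have hpre : IsPreconnected (f '' K n)ᶜ := by
      -- every component meets M
      have hmeet : ∀ x ∈ (f '' K n)ᶜ,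
          ∃ y ∈ f '' (U \ K n), y ∈ connectedComponentIn (f '' K n)ᶜ x := by
        intro x hx
        by_contra hcon
        push Not at hcon
        set C := connectedComponentIn (f '' K n)ᶜ x
        have hCo : IsOpen C := hLc.isClosed.isOpen_compl.connectedComponentIn
        have hCU : Disjoint C (f '' U) := by
          rw [Set.disjoint_left]
          rintro y hy ⟨z, hz, rfl⟩
          by_cases hzK : z ∈ K n
          · exact connectedComponentIn_subset _ _ hy ⟨z, hzK, rfl⟩
          · exact hcon _ ⟨z, ⟨hz, hzK⟩, rfl⟩ hy
        have hCU' : Disjoint (closure C) (f '' U) := hCU.closure_left hfo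
        have hclosed : IsClosed C := by
          rw [← closure_eq_iff_isClosed]
          refine Subset.antisymm ?_ subset_closure
          have hpc : IsPreconnected (closure C) := isPreconnected_connectedComponentIn.closure
          refine hpc.subset_connectedComponentIn (subset_closure (mem_connectedComponentIn hx)) ?_
          intro y hy hy'
          exact Set.disjoint_left.1 hCU' hy (hsub hy')
        have : C = univ := IsClopen.eq_univ ⟨hclosed, hCo⟩ ⟨x, mem_connectedComponentIn hx⟩
        obtain ⟨z, hz⟩ := hne
        exact Set.disjoint_left.1 hCU (this ▸ mem_univ (f z)) ⟨z, hz, rfl⟩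
      rcases (f '' (U \ K n)).eq_empty_or_nonempty with he | ⟨m, hm⟩
      · intro u v _ _ _ hu _
        obtain ⟨x, hx, _⟩ := hu
        obtain ⟨y, hy, _⟩ := hmeet x hx
        rw [he] at hy; exact hy.elim
      have : ∀ x ∈ (f '' K n)ᶜ, x ∈ connectedComponentIn (f '' K n)ᶜ m := by
        intro x hx
        obtain ⟨y, hy, hyx⟩ := hmeet x hx
        have h2 : y ∈ connectedComponentIn (f '' K n)ᶜ m :=
          hM.subset_connectedComponentIn hm hMsub hy
        rw [connectedComponentIn_eq h2, ← connectedComponentIn_eq hyx]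
        exact mem_connectedComponentIn hx
      have heq : (f '' K n)ᶜ = connectedComponentIn (f '' K n)ᶜ m :=
        Subset.antisymm this (connectedComponentIn_subset _ _)
      rw [heq]; exact isPreconnected_connectedComponentIn
    obtain ⟨h, hc, he⟩ := exists_log_sub hLc hpre a (fun h => ha (hsub h))
    refine ⟨fun z => exp (h (f z) / 2), ?_, ?_⟩
    · exact (((hc.comp (hf.continuousOn.mono (hKU n)) (mapsTo_image _ _)).div_const 2)).cexp
    · intro z hz
      rw [← exp_nat_mul, ← he _ (mem_image_of_mem f hz)]
      congr 1; push_cast; ring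
  choose g hgc hg using h1
  set 𝒰 := hyperfilter ℕ
  have h𝒰 : (𝒰 : Filter ℕ) ≤ atTop := Nat.hyperfilter_le_atTop
  set G : ℂ → ℂ := fun z => limUnder (𝒰 : Filter ℕ) (fun n => g n z)
  have hloc : ∀ z₀ ∈ U, ∃ s : ℂ → ℂ, ∃ ε > 0, ball z₀ ε ⊆ U ∧ DifferentiableOn ℂ s (ball z₀ ε) ∧
      (∀ z ∈ ball z₀ ε, s z ^ 2 = f z - a) ∧ ∀ z ∈ ball z₀ ε, G z = s z := by
    intro z₀ hz₀
    have hFne : ∀ z ∈ U, f z - a ≠ 0 := fun z hz h => ha ⟨z, hz, by linear_combination h⟩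
    have hcont : ContinuousAt (fun z => (f z - a) / (f z₀ - a)) z₀ :=
      ((hf.continuousOn.continuousAt (hUo.mem_nhds hz₀)).sub continuousAt_const).div_const _
    have hev : ∀ᶠ z in 𝓝 z₀, (f z - a) / (f z₀ - a) ∈ slitPlane := by
      apply hcont
      apply isOpen_slitPlane.mem_nhds
      simp [div_self (hFne z₀ hz₀)]
    obtain ⟨V, hV, hVK⟩ := hKe z₀ hz₀
    obtain ⟨ε, hε, hεs⟩ := Metric.eventually_nhds_iff_ball.1 ((hev.and (hUo.eventually_mem hz₀)).and hV)
    obtain ⟨c, hc⟩ : ∃ c : ℂ, c ^ 2 = f z₀ - a := IsAlgClosed.exists_pow_nat_eq _ two_pos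
    set s : ℂ → ℂ := fun z => c * exp (log ((f z - a) / (f z₀ - a)) / 2)
    have hs2 : ∀ z ∈ ball z₀ ε, s z ^ 2 = f z - a := by
      intro z hz
      have hz' := hεs z hz
      simp only [s]
      rw [mul_pow, hc, ← exp_nat_mul]
      rw [show ((2 : ℕ) : ℂ) * (log ((f z - a) / (f z₀ - a)) / 2) = log ((f z - a) / (f z₀ - a)) by
        push_cast; ring, exp_log (slitPlane_ne_zero hz'.1.1), mul_div_cancel₀ _ (hFne z₀ hz₀)]
    have hsd : DifferentiableOn ℂ s (ball z₀ ε) := by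
      refine DifferentiableOn.const_mul (DifferentiableOn.cexp (DifferentiableOn.div_const
        (DifferentiableOn.clog ?_ fun z hz => (hεs z hz).1.1) _)) _
      exact ((hf.mono fun z hz => (hεs z hz).1.2).sub_const _).div_const _
    have hsne : ∀ z ∈ ball z₀ ε, s z ≠ 0 := fun z hz h => hFne z (hεs z hz).1.2 (by
      rw [← hs2 z hz, h]; ring)
    have hsgn : ∀ᶠ n in (𝒰 : Filter ℕ), EqOn (g n) s (ball z₀ ε) ∨ EqOn (g n) (-s) (ball z₀ ε) := by
      refine h𝒰 (hVK.mono fun n hn => ?_)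
      have hb : ball z₀ ε ⊆ K n := fun z hz => hn (hεs z hz).2
      refine IsPreconnected.eq_or_eq_neg_of_sq_eq (convex_ball z₀ ε).isPreconnected
        ((hgc n).mono hb) hsd.continuousOn (fun z hz => ?_) (fun hz => hsne _ hz)
      simp only [Pi.pow_apply]
      rw [hs2 z hz, hg n z (hb hz)]
    have hbU : ball z₀ ε ⊆ U := fun z hz => (hεs z hz).1.2
    rcases Ultrafilter.eventually_or.1 hsgn with h | h
    · refine ⟨s, ε, hε, hbU, hsd, hs2, fun z hz => ?_⟩
      exact (tendsto_const_nhds.congr' (h.mono fun n hn => (hn hz).symm)).limUnder_eq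
    · refine ⟨-s, ε, hε, hbU, hsd.neg, fun z hz => ?_, fun z hz => ?_⟩
      · simpa using hs2 z hz
      · exact (tendsto_const_nhds.congr' (h.mono fun n hn => (hn hz).symm)).limUnder_eq
  refine ⟨G, fun z hz => ?_, fun z hz => ?_⟩
  · obtain ⟨s, ε, hε, hb, hd, h2, hG⟩ := hloc z hz
    have hn := ball_mem_nhds z hε
    have : DifferentiableAt ℂ s z := hd.differentiableAt hn
    exact (this.congr_of_eventuallyEq (by filter_upwards [hn] with y hy using hG y hy)).differentiableWithinAt
  · obtain ⟨s, ε, hε, hb, hd, h2, hG⟩ := hloc z hz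
    rw [hG z (mem_ball_self hε), h2 z (mem_ball_self hε)]

end NewtonPf
end

section
open Complex Metric Set Filter Topology

namespace NewtonPf

lemma eventually_const_zero_or {f : ℂ → ℂ} {U : Set ℂ} (hUo : IsOpen U) (hUc : IsPreconnected U)
    (hf : DifferentiableOn ℂ f U) {z₀ : ℂ} (hz₀ : z₀ ∈ U) {c : ℂ} (h : ∀ᶠ z in 𝓝 z₀, f z = c) :
    ∀ z ∈ U, f z = c :=
  (hf.analyticOnNhd hUo).eqOn_of_preconnected_of_eventuallyEq analyticOnNhd_const hUc hz₀ h

lemma hurwitz {U : Set ℂ} (hUo : IsOpen U) {ι : Type*} {l : Filter ι} {F : ι → ℂ → ℂ} {f : ℂ → ℂ}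
    (hF : ∀ n, DifferentiableOn ℂ (F n) U) (hf : DifferentiableOn ℂ f U)
    (hlim : TendstoLocallyUniformlyOn F f l U) {z₀ : ℂ} (hz₀ : z₀ ∈ U) (h0 : f z₀ = 0)
    (hnc : ¬ ∀ᶠ z in 𝓝 z₀, f z = 0) {V : Set ℂ} (hV : V ∈ 𝓝 z₀) :
    ∀ᶠ n in l, ∃ z ∈ V, F n z = 0 := by
  have han : AnalyticAt ℂ f z₀ := hf.analyticAt (hUo.mem_nhds hz₀)
  have hpun : ∀ᶠ z in 𝓝[≠] z₀, f z ≠ 0 := han.eventually_eq_zero_or_eventually_ne_zero.resolve_left hnc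
  rw [eventually_nhdsWithin_iff] at hpun
  obtain ⟨r, hr, hrs⟩ := Metric.eventually_nhds_iff_ball.1
    ((hpun.and (hUo.eventually_mem hz₀)).and hV)
  set ρ := r / 2
  have hρ : 0 < ρ := half_pos hr
  have hcb : closedBall z₀ ρ ⊆ ball z₀ r := closedBall_subset_ball (half_lt_self hr)
  have hcbU : closedBall z₀ ρ ⊆ U := fun z hz => (hrs z (hcb hz)).1.2
  have hsne : ∀ z ∈ sphere z₀ ρ, f z ≠ 0 := fun z hz =>
    (hrs z (hcb (sphere_subset_closedBall hz))).1.1 (ne_of_mem_sphere hz hρ.ne')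
  obtain ⟨w, hw, hwmin⟩ := (isCompact_sphere z₀ ρ).exists_isMinOn
    (NormedSpace.sphere_nonempty.2 hρ.le) ((hf.continuousOn.mono
      (sphere_subset_closedBall.trans hcbU)).norm)
  set m := ‖f w‖
  have hm : 0 < m := norm_pos_iff.2 (hsne w hw)
  have hunif := (tendstoLocallyUniformlyOn_iff_tendstoUniformlyOn_of_compact
    (isCompact_closedBall z₀ ρ)).1 (hlim.mono hcbU)
  rw [Metric.tendstoUniformlyOn_iff] at hunif
  filter_upwards [hunif (m / 4) (by positivity)] with n hn
  have hd : DiffContOnCl ℂ (F n) (ball z₀ ρ) :=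
    ((hF n).mono hcbU).diffContOnCl_ball le_rfl
  have hn0 : ‖F n z₀‖ < m / 4 := by
    have := hn z₀ (mem_closedBall_self hρ.le)
    rwa [h0, dist_zero_left] at this
  have hlow : ∀ z ∈ sphere z₀ ρ, m / 2 ≤ ‖F n z - F n z₀‖ := by
    intro z hz
    have h1 := hn z (sphere_subset_closedBall hz)
    have h2 : m ≤ ‖f z‖ := hwmin hz
    rw [dist_eq_norm] at h1
    have h3 : ‖f z‖ ≤ ‖f z - F n z‖ + ‖F n z - F n z₀‖ + ‖F n z₀‖ := by
      calc ‖f z‖ = ‖(f z - F n z) + (F n z - F n z₀) + F n z₀‖ := by ring_nf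
        _ ≤ _ := norm_add₃_le
    linarith
  have hfr : ∃ᶠ z in 𝓝 z₀, F n z ≠ F n z₀ := by
    intro hcon
    simp only [not_not] at hcon
    have hall := eventually_const_zero_or isOpen_ball (convex_ball z₀ r).isPreconnected
      ((hF n).mono fun z hz => (hrs z hz).1.2) (mem_ball_self hr) hcon
    have := hlow w hw
    rw [hall w (hcb (sphere_subset_closedBall hw))] at this
    simp at this; linarith
  have := hd.ball_subset_image_closedBall hρ hlow hfr
  obtain ⟨z, hz, hz0⟩ := this (show (0 : ℂ) ∈ ball (F n z₀) (m / 2 / 2) by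
    rw [mem_ball, dist_zero_left]; linarith)
  exact ⟨z, (hrs z (hcb hz)).2, hz0⟩

/-- Ultrafilter Montel. -/
lemma montel {U : Set ℂ} (hUo : IsOpen U) {ι : Type*} (𝒰 : Ultrafilter ι) {F : ι → ℂ → ℂ}
    (hF : ∀ n, DifferentiableOn ℂ (F n) U) (hb : ∀ n, ∀ z ∈ U, ‖F n z‖ ≤ 1) :
    ∃ f : ℂ → ℂ, TendstoLocallyUniformlyOn F f 𝒰 U := by
  set f : ℂ → ℂ := fun z => limUnder (𝒰 : Filter ι) (fun n => F n z)
  have hpt : ∀ z ∈ U, Tendsto (fun n => F n z) 𝒰 (𝓝 (f z)) := by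
    intro z hz
    obtain ⟨x, -, hx⟩ := (isCompact_closedBall (0 : ℂ) 1).ultrafilter_le_nhds
      (𝒰.map fun n => F n z) (by
        rw [le_principal_iff, Ultrafilter.coe_map, Filter.mem_map]
        exact Filter.univ_mem' fun n => by simpa using hb n z hz)
    exact tendsto_nhds_limUnder ⟨x, hx⟩
  refine ⟨f, ?_⟩
  rw [Metric.tendstoLocallyUniformlyOn_iff]
  intro ε hε z₀ hz₀
  obtain ⟨R, hR, hRs⟩ := Metric.isOpen_iff.1 hUo z₀ hz₀
  set r := R / 2
  have hr : 0 < r := half_pos hR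
  have hlip : ∀ n, ∀ z ∈ ball z₀ r, ‖F n z - F n z₀‖ ≤ 1 / (r / 2) * ‖z - z₀‖ := by
    intro n z hz
    refine (convex_ball z₀ r).norm_image_sub_le_of_norm_deriv_le (𝕜 := ℂ) (f := F n) ?_ ?_
      (mem_ball_self hr) hz
    · intro y hy
      exact (hF n).differentiableAt (hUo.mem_nhds (hRs (ball_subset_ball (by simp [r]; linarith) hy)))
    · intro y hy
      have hsub : closedBall y (r / 2) ⊆ U := by
        intro x hx
        apply hRs
        rw [mem_ball] at hy ⊢; rw [mem_closedBall] at hx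
        have := dist_triangle x y z₀
        simp only [r] at *; linarith
      refine Complex.norm_deriv_le_of_forall_mem_sphere_norm_le (by positivity)
        (((hF n).mono hsub).diffContOnCl_ball le_rfl) fun x hx => hb n x (hsub (sphere_subset_closedBall hx))
  have hlip' : ∀ z ∈ ball z₀ r, ‖f z - f z₀‖ ≤ 1 / (r / 2) * ‖z - z₀‖ := by
    intro z hz
    have hzU : z ∈ U := hRs (ball_subset_ball (by simp [r]; linarith) hz)
    exact le_of_tendsto ((hpt z hzU).sub (hpt z₀ hz₀)).norm (Filter.Eventually.of_forall fun n => hlip n z hz)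
  set δ := min r (ε * (r / 2) / 4)
  have hδ : 0 < δ := by positivity
  refine ⟨ball z₀ δ, mem_nhdsWithin_of_mem_nhds (ball_mem_nhds _ hδ), ?_⟩
  have := Metric.tendsto_nhds.1 (hpt z₀ hz₀) (ε / 4) (by positivity)
  filter_upwards [this] with n hn z hz
  have hzr : z ∈ ball z₀ r := ball_subset_ball (min_le_left _ _) hz
  have hzd : ‖z - z₀‖ < ε * (r / 2) / 4 := by
    rw [← dist_eq_norm]; exact lt_of_lt_of_le hz (min_le_right _ _)
  have h4 : 1 / (r / 2) * ‖z - z₀‖ ≤ ε / 4 := by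
    rw [one_div_mul_eq_div, div_le_iff₀ (by positivity)]; linarith
  have h1 := hlip n z hzr
  have h2 := hlip' z hzr
  rw [dist_eq_norm] at hn ⊢
  calc ‖f z - F n z‖ = ‖(f z - f z₀) + (-(F n z - F n z₀)) + (-(F n z₀ - f z₀))‖ := by ring_nf
    _ ≤ ‖f z - f z₀‖ + ‖F n z - F n z₀‖ + ‖F n z₀ - f z₀‖ := by
      refine norm_add₃_le.trans ?_; rw [norm_neg, norm_neg]
    _ < ε := by linarith

lemma moebius_key (a w : ℂ) : ‖1 - (starRingEnd ℂ) a * w‖ ^ 2 - ‖w - a‖ ^ 2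
    = (1 - ‖a‖ ^ 2) * (1 - ‖w‖ ^ 2) := by
  simp only [← normSq_eq_norm_sq, normSq_apply, sub_re, sub_im, mul_re, mul_im, conj_re, conj_im,
    one_re, one_im]
  ring

lemma moebius_den {a w : ℂ} (ha : ‖a‖ < 1) (hw : ‖w‖ < 1) : 1 - (starRingEnd ℂ) a * w ≠ 0 := by
  intro h
  have : (starRingEnd ℂ) a * w = 1 := by linear_combination -h
  have h2 : ‖a‖ * ‖w‖ = 1 := by rw [← norm_conj a, ← norm_mul, this, norm_one]
  nlinarith [norm_nonneg a, norm_nonneg w]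

lemma moebius_lt {a w : ℂ} (ha : ‖a‖ < 1) (hw : ‖w‖ < 1) :
    ‖(w - a) / (1 - (starRingEnd ℂ) a * w)‖ < 1 := by
  rw [norm_div, div_lt_one (norm_pos_iff.2 (moebius_den ha hw))]
  have := moebius_key a w
  have h1 : 0 < (1 - ‖a‖ ^ 2) * (1 - ‖w‖ ^ 2) := by
    have := norm_nonneg a
    have := norm_nonneg w
    apply mul_pos <;> nlinarith
  exact lt_of_pow_lt_pow_left₀ 2 (norm_nonneg _) (by linarith)

lemma moebius_inj {a w v : ℂ} (ha : ‖a‖ < 1) (hw : ‖w‖ < 1) (hv : ‖v‖ < 1)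
    (h : (w - a) / (1 - (starRingEnd ℂ) a * w) = (v - a) / (1 - (starRingEnd ℂ) a * v)) : w = v := by
  rw [div_eq_div_iff (moebius_den ha hw) (moebius_den ha hv)] at h
  have h2 : (1 - (starRingEnd ℂ) a * a) * (w - v) = 0 := by linear_combination h
  rcases mul_eq_zero.1 h2 with h3 | h3
  · exact absurd h3 (moebius_den ha ha)
  · linear_combination h3

lemma moebius_hasDerivAt {a w : ℂ} (ha : ‖a‖ < 1) (hw : ‖w‖ < 1) :
    HasDerivAt (fun w => (w - a) / (1 - (starRingEnd ℂ) a * w))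
      ((1 - (starRingEnd ℂ) a * a) / (1 - (starRingEnd ℂ) a * w) ^ 2) w := by
  have h1 : HasDerivAt (fun w : ℂ => w - a) 1 w := (hasDerivAt_id w).sub_const a
  have h2 : HasDerivAt (fun w : ℂ => 1 - (starRingEnd ℂ) a * w) (-((starRingEnd ℂ) a * 1)) w :=
    ((hasDerivAt_id w).const_mul _).const_sub 1
  have h3 := h1.div h2 (moebius_den ha hw)
  have e : (1 * (1 - (starRingEnd ℂ) a * w) - (w - a) * (-((starRingEnd ℂ) a * 1)))
      = 1 - (starRingEnd ℂ) a * a := by ring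
  rw [e] at h3
  exact h3

lemma isOpen_image_of_injOn {U : Set ℂ} (hUo : IsOpen U) {f : ℂ → ℂ}
    (hf : DifferentiableOn ℂ f U) (hi : InjOn f U) : IsOpen (f '' U) := by
  rw [isOpen_iff_mem_nhds]
  rintro _ ⟨z, hz, rfl⟩
  rcases (hf.analyticAt (hUo.mem_nhds hz)).eventually_constant_or_nhds_le_map_nhds with h | h
  · exfalso
    have h2 : ∀ᶠ y in 𝓝 z, y = z := by
      filter_upwards [h, hUo.mem_nhds hz] with y hy hyU using hi hyU hz hy
    have : ∃ᶠ y in 𝓝[≠] z, y = z := (h2.filter_mono nhdsWithin_le_nhds).frequently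
    obtain ⟨y, hy, hne⟩ := (this.and_eventually self_mem_nhdsWithin).exists
    exact hne hy
  · exact h (image_mem_map (hUo.mem_nhds hz))

end NewtonPf
end

section
open Complex Metric Set Filter Topology

namespace NewtonPf

/-- normalized univalent maps into the disc -/
structure Univ (U : Set ℂ) (ξ : ℂ) (f : ℂ → ℂ) : Prop where
  diff : DifferentiableOn ℂ f U
  inj : InjOn f U
  maps : ∀ z ∈ U, ‖f z‖ < 1
  zero : f ξ = 0
  der : ∀ z ∈ U, deriv f z ≠ 0

lemma univ_moebius {U : Set ℂ} (hUo : IsOpen U) {ξ : ℂ} (hξ : ξ ∈ U) {q : ℂ → ℂ}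
    (hd : DifferentiableOn ℂ q U) (hi : InjOn q U) (hm : ∀ z ∈ U, ‖q z‖ < 1)
    (hder : ∀ z ∈ U, deriv q z ≠ 0) {a : ℂ} (ha : ‖a‖ < 1) :
    let g := fun z => (q z - a) / (1 - (starRingEnd ℂ) a * q z)
    DifferentiableOn ℂ g U ∧ InjOn g U ∧ (∀ z ∈ U, ‖g z‖ < 1) ∧ (∀ z ∈ U, deriv g z ≠ 0) ∧
    ∀ z ∈ U, deriv g z =
      (1 - (starRingEnd ℂ) a * a) / (1 - (starRingEnd ℂ) a * q z) ^ 2 * deriv q z := by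
  intro g
  have hg : ∀ z ∈ U, HasDerivAt g
      ((1 - (starRingEnd ℂ) a * a) / (1 - (starRingEnd ℂ) a * q z) ^ 2 * deriv q z) z := by
    intro z hz
    exact (moebius_hasDerivAt ha (hm z hz)).comp z
      (hd.differentiableAt (hUo.mem_nhds hz)).hasDerivAt
  refine ⟨fun z hz => (hg z hz).differentiableAt.differentiableWithinAt, ?_, ?_, ?_, ?_⟩
  · intro z hz w hw h
    exact hi hz hw (moebius_inj ha (hm z hz) (hm w hw) h)
  · intro z hz; exact moebius_lt ha (hm z hz)
  · intro z hz
    rw [(hg z hz).deriv]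
    exact mul_ne_zero (div_ne_zero (moebius_den ha ha) (pow_ne_zero _ (moebius_den ha (hm z hz))))
      (hder z hz)
  · intro z hz; exact (hg z hz).deriv

lemma univ_improve {U : Set ℂ} (hUo : IsOpen U) {ξ : ℂ} (hξ : ξ ∈ U)
    (K : ℕ → Set ℂ) (hK : ∀ n, IsCompact (K n))
    (hKU : ∀ n, K n ⊆ U) (hKe : ∀ z ∈ U, ∃ V ∈ 𝓝 z, ∀ᶠ n in atTop, V ⊆ K n)
    (hKc : ∀ n, IsPreconnected (U \ K n)) {f : ℂ → ℂ} (hf : Univ U ξ f) {a : ℂ} (ha : ‖a‖ < 1)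
    (haf : a ∉ f '' U) : ∃ g, Univ U ξ g ∧ ‖deriv f ξ‖ < ‖deriv g ξ‖ := by
  obtain ⟨h1, h2, h3, h4, h5⟩ := univ_moebius hUo hξ hf.diff hf.inj hf.maps hf.der ha
  set h := fun z => (f z - a) / (1 - (starRingEnd ℂ) a * f z) with hh
  have h0 : ∀ z ∈ U, h z ≠ 0 := by
    intro z hz h0
    rw [hh] at h0
    rcases div_eq_zero_iff.1 h0 with h | h
    · exact haf ⟨z, hz, by linear_combination h⟩
    · exact moebius_den ha (hf.maps z hz) h
  obtain ⟨q, hqd, hq⟩ := exists_sqrt hUo K hK hKU hKe hKc h1 h2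
    (isOpen_image_of_injOn hUo h1 h2) ⟨ξ, hξ⟩ (a := 0) (by rintro ⟨z, hz, hz0⟩; exact h0 z hz hz0)
  simp only [sub_zero] at hq
  have hqi : InjOn q U := fun z hz w hw hzw => h2 hz hw (by rw [← hq z hz, ← hq w hw, hzw])
  have hqm : ∀ z ∈ U, ‖q z‖ < 1 := by
    intro z hz
    have := h3 z hz
    rw [← hq z hz, norm_pow] at this
    exact (sq_lt_one_iff₀ (norm_nonneg _)).1 this
  have hqder : ∀ z ∈ U, deriv h z = 2 * q z * deriv q z := by
    intro z hz
    have e : (fun z => q z ^ 2) =ᶠ[𝓝 z] h := by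
      filter_upwards [hUo.mem_nhds hz] with y hy using hq y hy
    rw [← e.deriv_eq]
    have := ((hqd.differentiableAt (hUo.mem_nhds hz)).hasDerivAt.pow 2).deriv
    change deriv (q ^ 2) z = _
    simpa using this
  have hqd0 : ∀ z ∈ U, deriv q z ≠ 0 := by
    intro z hz h0'
    apply h4 z hz
    rw [hqder z hz, h0', mul_zero]
  have hb := hqm ξ hξ
  obtain ⟨k1, k2, k3, k4, k5⟩ := univ_moebius hUo hξ hqd hqi hqm hqd0 hb
  set b := q ξ
  refine ⟨_, ⟨k1, k2, k3, by simp [b], k4⟩, ?_⟩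
  rw [k5 ξ hξ]
  have e1 : deriv h ξ = (1 - (starRingEnd ℂ) a * a) * deriv f ξ := by
    rw [h5 ξ hξ, hf.zero]; simp
  have e2 := hqder ξ hξ
  rw [e1] at e2
  have e3 : b ^ 2 = -a := by
    rw [hq ξ hξ, hh]; simp [hf.zero]
  have hA : ∀ c : ℂ, ‖c‖ < 1 → ‖1 - (starRingEnd ℂ) c * c‖ = 1 - ‖c‖ ^ 2 := by
    intro c hc
    have : (1 : ℂ) - (starRingEnd ℂ) c * c = ((1 - ‖c‖ ^ 2 : ℝ) : ℂ) := by
      rw [mul_comm, mul_conj, normSq_eq_norm_sq]; push_cast; ring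
    rw [this, norm_real, Real.norm_of_nonneg]
    nlinarith [norm_nonneg c]
  have hbn : ‖b‖ ^ 2 = ‖a‖ := by rw [← norm_pow, e3, norm_neg]
  have hb0 : 0 < ‖b‖ := by
    rw [norm_pos_iff]; intro hb0
    apply h0 ξ hξ
    rw [← hq ξ hξ]; change b ^ 2 = 0; rw [hb0]; ring
  have e4 := congrArg norm e2
  rw [norm_mul, norm_mul, norm_mul, hA a ha, Complex.norm_two] at e4
  rw [norm_mul, norm_div, norm_pow, hA b hb]
  have hM : 0 < ‖deriv f ξ‖ := norm_pos_iff.2 (hf.der ξ hξ)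
  have hbb : 0 < 1 - ‖b‖ ^ 2 := by nlinarith
  rw [← hbn] at e4
  set t := ‖b‖
  change _ = 2 * t * _ at e4
  set M := ‖deriv f ξ‖
  set Q := ‖deriv q ξ‖
  have e5 : (1 + t ^ 2) * (1 - t ^ 2) * M = 2 * t * Q := by rw [← e4]; ring
  have e6 : (1 - t ^ 2) / (1 - t ^ 2) ^ 2 * Q = Q / (1 - t ^ 2) := by field_simp
  rw [e6, lt_div_iff₀ hbb]
  have e7 : 2 * t * ((1 - t ^ 2) * M) < 2 * t * Q := by
    rw [← e5]
    have : 0 < (1 - t) ^ 2 * ((1 - t ^ 2) * M) := by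
      have : 0 < 1 - t := by linarith
      positivity
    nlinarith
  have := lt_of_mul_lt_mul_left e7 (by positivity)
  linarith

theorem rmt {U : Set ℂ} (hUo : IsOpen U) (hUc : IsPreconnected U) {ξ : ℂ} (hξ : ξ ∈ U)
    (K : ℕ → Set ℂ) (hK : ∀ n, IsCompact (K n))
    (hKU : ∀ n, K n ⊆ U) (hKe : ∀ z ∈ U, ∃ V ∈ 𝓝 z, ∀ᶠ n in atTop, V ⊆ K n)
    (hKc : ∀ n, IsPreconnected (U \ K n)) {a₀ : ℂ} {δ : ℝ} (hδ : 0 < δ)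
    (hδU : ∀ z ∈ U, δ < ‖z - a₀‖) :
    ∃ f, Univ U ξ f ∧ f '' U = ball 0 1 := by
  set S : Set ℝ := {x | ∃ f, Univ U ξ f ∧ ‖deriv f ξ‖ = x}
  obtain ⟨R, hR, hRs⟩ := Metric.isOpen_iff.1 hUo ξ hξ
  have hbdd : BddAbove S := by
    refine ⟨1 / (R / 2), ?_⟩
    rintro _ ⟨f, hf, rfl⟩
    have hsub : closedBall ξ (R / 2) ⊆ U := (closedBall_subset_ball (half_lt_self hR)).trans hRs
    exact Complex.norm_deriv_le_of_forall_mem_sphere_norm_le (by positivity)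
      ((hf.diff.mono hsub).diffContOnCl_ball le_rfl)
      fun x hx => (hf.maps x (hsub (sphere_subset_closedBall hx))).le
  have hne : S.Nonempty := by
    have hz : ∀ z ∈ U, z - a₀ ≠ 0 := fun z hz => norm_pos_iff.1 (hδ.trans (hδU z hz))
    set q : ℂ → ℂ := fun z => δ / (z - a₀)
    have hq : ∀ z ∈ U, HasDerivAt q (-(δ : ℂ) / (z - a₀) ^ 2) z := by
      intro z hzU
      have h1 : HasDerivAt (fun w : ℂ => w - a₀) 1 z := (hasDerivAt_id z).sub_const a₀
      have := (hasDerivAt_const z (δ : ℂ)).div h1 (hz z hzU)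
      change HasDerivAt ((fun _ : ℂ => (δ : ℂ)) / fun w : ℂ => w - a₀) _ z
      simpa using this
    have hqm : ∀ z ∈ U, ‖q z‖ < 1 := by
      intro z hzU
      simp only [q]
      rw [norm_div, norm_real, Real.norm_of_nonneg hδ.le, div_lt_one (hδ.trans (hδU z hzU))]
      exact hδU z hzU
    have hδ' : (δ : ℂ) ≠ 0 := ofReal_ne_zero.2 hδ.ne'
    obtain ⟨k1, k2, k3, k4, k5⟩ := univ_moebius hUo hξ (q := q)
      (fun z hzU => (hq z hzU).differentiableAt.differentiableWithinAt)
      (by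
        intro z hzU w hwU hzw
        simp only [q] at hzw
        rw [div_eq_div_iff (hz z hzU) (hz w hwU)] at hzw
        have := mul_left_cancel₀ hδ' hzw
        linear_combination -this)
      hqm (fun z hzU => by
        rw [(hq z hzU).deriv]
        exact div_ne_zero (neg_ne_zero.2 hδ') (pow_ne_zero _ (hz z hzU))) (hqm ξ hξ)
    exact ⟨_, _, ⟨k1, k2, k3, by simp, k4⟩, rfl⟩
  obtain ⟨u, -, hu, huS⟩ := exists_seq_tendsto_sSup hne hbdd
  choose F hF hFu using huS
  obtain ⟨f, hlim⟩ := montel hUo (hyperfilter ℕ) (fun n => (hF n).diff)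
    (fun n z hz => ((hF n).maps z hz).le)
  set M := sSup S
  have hfd : DifferentiableOn ℂ f U :=
    hlim.differentiableOn (Filter.Eventually.of_forall fun n => (hF n).diff) hUo
  have hlim' := hlim.deriv (Filter.Eventually.of_forall fun n => (hF n).diff) hUo
  have hpt : ∀ z ∈ U, Tendsto (fun n => F n z) (hyperfilter ℕ) (𝓝 (f z)) :=
    fun z hz => hlim.tendsto_at hz
  have hMf : ‖deriv f ξ‖ = M := by
    have h1 := (hlim'.tendsto_at hξ).norm
    have h2 : Tendsto (fun n => ‖(deriv ∘ F) n ξ‖) (hyperfilter ℕ : Filter ℕ) (𝓝 M) := by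
      simp only [Function.comp, hFu]
      exact hu.mono_left Nat.hyperfilter_le_atTop
    exact tendsto_nhds_unique h1 h2
  have hM0 : 0 < M := by
    obtain ⟨x, g, hg, rfl⟩ := hne
    exact (norm_pos_iff.2 (hg.der ξ hξ)).trans_le (le_csSup hbdd ⟨g, hg, rfl⟩)
  have hder0 : deriv f ξ ≠ 0 := by rw [← norm_pos_iff, hMf]; exact hM0
  have hnc : ∀ z ∈ U, ∀ c, ¬ ∀ᶠ w in 𝓝 z, f w = c := by
    intro z hz c hcon
    have := eventually_const_zero_or hUo hUc hfd hz hcon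
    apply hder0
    have e : f =ᶠ[𝓝 ξ] fun _ => c := by
      filter_upwards [hUo.mem_nhds hξ] with y hy using this y hy
    rw [e.deriv_eq]; simp
  have hinj : InjOn f U := by
    intro z hz w hw hzw
    by_contra hne'
    have hF' : TendstoLocallyUniformlyOn (fun n x => F n x - F n w) (fun x => f x - f w)
        (hyperfilter ℕ : Filter ℕ) U := by
      have hconst : TendstoLocallyUniformlyOn (fun n (_ : ℂ) => F n w) (fun _ => f w)
          (hyperfilter ℕ : Filter ℕ) U :=
        (((hpt w hw).tendstoUniformlyOnFilter_const (𝓟 U)).tendstoUniformlyOn).tendstoLocallyUniformlyOn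
      exact hlim.sub hconst
    have hV : ({w}ᶜ : Set ℂ) ∩ U ∈ 𝓝 z :=
      inter_mem (isOpen_compl_singleton.mem_nhds hne') (hUo.mem_nhds hz)
    obtain ⟨n, x, hx, hx0⟩ := (hurwitz hUo (fun n => (hF n).diff.sub_const _) (hfd.sub_const _) hF' hz
      (by rw [hzw, sub_self])
      (fun h => hnc z hz (f w) (h.mono fun y hy => by linear_combination hy)) hV).exists
    exact hx.1 ((hF n).inj hx.2 hw (by linear_combination hx0))
  have hmaps : ∀ z ∈ U, ‖f z‖ < 1 := by
    have ho := isOpen_image_of_injOn hUo hfd hinj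
    have hsub : f '' U ⊆ closedBall 0 1 := by
      rintro _ ⟨z, hz, rfl⟩
      rw [mem_closedBall_zero_iff]
      exact le_of_tendsto (hpt z hz).norm (Filter.Eventually.of_forall fun n => ((hF n).maps z hz).le)
    intro z hz
    have := interior_maximal hsub ho ⟨z, hz, rfl⟩
    rw [interior_closedBall _ one_ne_zero] at this
    simpa using this
  have hder : ∀ z ∈ U, deriv f z ≠ 0 := by
    intro z hz h0
    obtain ⟨n, x, hx, hx0⟩ := (hurwitz hUo (fun n => (hF n).diff.deriv hUo) (hfd.deriv hUo) hlim' hz h0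
      (fun h => hder0 (eventually_const_zero_or hUo hUc (hfd.deriv hUo) hz h ξ hξ))
      (hUo.mem_nhds hz)).exists
    exact (hF n).der x hx hx0
  have hz0 : f ξ = 0 := by
    refine tendsto_nhds_unique (hpt ξ hξ) ?_
    simp only [(hF _).zero]
    exact tendsto_const_nhds
  have hu : Univ U ξ f := ⟨hfd, hinj, hmaps, hz0, hder⟩
  refine ⟨f, hu, Subset.antisymm ?_ ?_⟩
  · rintro _ ⟨z, hz, rfl⟩; simpa using hmaps z hz
  · intro a ha
    by_contra hcon
    obtain ⟨g, hg, hlt⟩ := univ_improve hUo hξ K hK hKU hKe hKc hu (by simpa using ha) hcon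
    rw [hMf] at hlt
    exact absurd (le_csSup hbdd ⟨g, hg, rfl⟩) (not_le.2 hlt)

end NewtonPf
end

section
open Complex Metric Set Filter Topology MeasureTheory

namespace NewtonPf

lemma det_mul_complex (a : ℂ) :
    (((ContinuousLinearMap.toSpanSingleton ℂ a).restrictScalars ℝ : ℂ →L[ℝ] ℂ)).det = ‖a‖ ^ 2 := by
  rw [ContinuousLinearMap.det, ← LinearMap.det_toMatrix Complex.basisOneI, Matrix.det_fin_two]
  simp [LinearMap.toMatrix_apply, ← normSq_eq_norm_sq, normSq_apply]

lemma area_formula {U S : Set ℂ} (hUo : IsOpen U) {f : ℂ → ℂ} (hf : DifferentiableOn ℂ f U)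
    (hSU : S ⊆ U) (hS : MeasurableSet S) (hi : InjOn f S) :
    ∫⁻ z in S, ENNReal.ofReal (‖deriv f z‖ ^ 2) = volume (f '' S) := by
  rw [← lintegral_abs_det_fderiv_eq_addHaar_image volume hS (f' := fun z =>
    ((ContinuousLinearMap.toSpanSingleton ℂ (deriv f z)).restrictScalars ℝ : ℂ →L[ℝ] ℂ)) ?_ hi]
  · refine setLIntegral_congr_fun hS fun z hz => ?_
    simp only [det_mul_complex]
    rw [abs_of_nonneg (by positivity)]
  · intro z hz
    have := (hf.differentiableAt (hUo.mem_nhds (hSU hz))).hasDerivAt.hasFDerivAt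
    exact (this.restrictScalars ℝ).hasFDerivWithinAt

lemma circle_mean {g : ℂ → ℂ} {c : ℂ} {r : ℝ} (hr : 0 < r) (hg : DiffContOnCl ℂ g (ball c r)) :
    ENNReal.ofReal (2 * Real.pi * ‖g c‖) ≤
      ∫⁻ θ in Ioo (-Real.pi) Real.pi, ‖g (c + r * exp (θ * I))‖ₑ := by
  have h1 := DiffContOnCl.circleAverage (f := g) (c := c) (R := r) (by rwa [abs_of_pos hr])
  rw [Real.circleAverage_eq_integral_add (-Real.pi),
    intervalIntegral.integral_comp_add_right (fun θ => g (circleMap c r θ))] at h1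
  rw [show 0 + -Real.pi = -Real.pi by ring, show 2 * Real.pi + -Real.pi = Real.pi by ring,
    intervalIntegral.integral_of_le (by linarith [Real.pi_pos]), integral_Ioc_eq_integral_Ioo] at h1
  have h2 : ∫ θ in Ioo (-Real.pi) Real.pi, g (circleMap c r θ) = (2 * Real.pi : ℝ) • g c := by
    rw [← h1, smul_smul, mul_inv_cancel₀ (by positivity), one_smul]
  have h3 := enorm_integral_le_lintegral_enorm (μ := volume.restrict (Ioo (-Real.pi) Real.pi))
    (fun θ => g (circleMap c r θ))
  rw [h2] at h3
  convert h3 using 1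
  · rw [← ofReal_norm, norm_smul, Real.norm_of_nonneg (by positivity)]
  · simp only [circleMap]

lemma area_mean {f : ℂ → ℂ} {c : ℂ} {ρ : ℝ} (hρ : 0 < ρ) (hf : DifferentiableOn ℂ f (ball c ρ)) :
    ENNReal.ofReal (Real.pi * ρ ^ 2 * ‖deriv f c‖ ^ 2) ≤
      ∫⁻ z in ball c ρ, ENNReal.ofReal (‖deriv f z‖ ^ 2) := by
  set g : ℂ → ℂ := fun z => deriv f z ^ 2
  have hgd : DifferentiableOn ℂ g (ball c ρ) := (hf.deriv isOpen_ball).pow 2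
  have hgm : Measurable g := (measurable_deriv f).pow_const 2
  have e1 : ∀ z, ENNReal.ofReal (‖deriv f z‖ ^ 2) = ‖g z‖ₑ := by
    intro z; rw [← ofReal_norm, norm_pow]
  simp only [e1]
  rw [← lintegral_indicator isOpen_ball.measurableSet,
    ← lintegral_add_left_eq_self _ c, ← Complex.lintegral_comp_polarCoord_symm]
  have e2 : ∀ p ∈ polarCoord.target, Complex.polarCoord.symm p = p.1 * exp (p.2 * I) := by
    intro p hp
    rw [Complex.polarCoord_symm_apply, exp_mul_I]; push_cast; ring
  calc ENNReal.ofReal (Real.pi * ρ ^ 2 * ‖deriv f c‖ ^ 2)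
      = ∫⁻ r in Ioo 0 ρ, ENNReal.ofReal (r * (2 * Real.pi * ‖g c‖)) := by
        rw [← ofReal_integral_eq_lintegral_ofReal]
        · rw [← integral_Ioc_eq_integral_Ioo, ← intervalIntegral.integral_of_le hρ.le,
            intervalIntegral.integral_mul_const, integral_id]
          congr 1
          simp only [g, norm_pow]; ring
        · exact ((continuous_id.mul continuous_const).integrableOn_Icc (a := 0) (b := ρ)).mono_set
            Ioo_subset_Icc_self
        · refine (ae_restrict_iff' measurableSet_Ioo).2 (Filter.Eventually.of_forall fun r hr => ?_)
          have := hr.1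
          simp only [Pi.zero_apply]; positivity
    _ ≤ ∫⁻ r in Ioo 0 ρ, ∫⁻ θ in Ioo (-Real.pi) Real.pi,
          ENNReal.ofReal r * ‖g (c + r * exp (θ * I))‖ₑ := by
        refine setLIntegral_mono' measurableSet_Ioo fun r hr => ?_
        rw [ENNReal.ofReal_mul hr.1.le, lintegral_const_mul _ (by fun_prop)]
        gcongr
        exact circle_mean hr.1 ((hgd.mono (closedBall_subset_ball hr.2)).diffContOnCl_ball le_rfl)
    _ = ∫⁻ p in (Ioo 0 ρ ×ˢ Ioo (-Real.pi) Real.pi),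
          ENNReal.ofReal p.1 * ‖g (c + p.1 * exp (p.2 * I))‖ₑ := by
        rw [Measure.volume_eq_prod, ← Measure.prod_restrict, lintegral_prod _ (by fun_prop)]
    _ ≤ ∫⁻ p in polarCoord.target, ENNReal.ofReal p.1 •
          (ball c ρ).indicator (fun z => ‖g z‖ₑ) (c + Complex.polarCoord.symm p) := by
        have hsub : Ioo 0 ρ ×ˢ Ioo (-Real.pi) Real.pi ⊆ polarCoord.target := by
          rw [polarCoord_target]; exact prod_mono (fun x hx => hx.1) subset_rfl
        refine le_trans (le_of_eq ?_) (lintegral_mono_set hsub)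
        refine setLIntegral_congr_fun (measurableSet_Ioo.prod measurableSet_Ioo) fun p hp => ?_
        rw [e2 p (hsub hp), indicator_of_mem, smul_eq_mul]
        rw [mem_ball, dist_eq_norm, add_sub_cancel_left, norm_mul, norm_exp_ofReal_mul_I, mul_one,
          norm_real, Real.norm_of_nonneg hp.1.1.le]
        exact hp.1.2

/-- L1 -/
lemma area_bound {f : ℂ → ℂ} {c : ℂ} {ρ : ℝ} (hρ : 0 < ρ) (hf : DifferentiableOn ℂ f (ball c ρ))
    (hi : InjOn f (ball c ρ)) :
    ENNReal.ofReal (Real.pi * ρ ^ 2 * ‖deriv f c‖ ^ 2) ≤ volume (f '' ball c ρ) := by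
  rw [← area_formula isOpen_ball hf subset_rfl measurableSet_ball hi]
  exact area_mean hρ hf

end NewtonPf
end

section
open Complex Metric Set Filter Topology

namespace NewtonPf

/-- abstract properties of the Newton map needed for the dynamics -/
structure NMap (N : ℂ → ℂ) (Pl : Set ℂ) : Prop where
  plfin : Pl.Finite
  diff : ∀ z ∉ Pl, DifferentiableAt ℂ N z
  pole : ∀ q ∈ Pl, Tendsto (fun z => ‖N z‖) (𝓝[≠] q) atTop
  plfix : ∀ q ∈ Pl, N q = q
  inf : Tendsto (fun z => ‖N z‖) (Bornology.cobounded ℂ) atTop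
  fix : ∀ z ∉ Pl, N z = z → ‖deriv N z‖ < 1
  crit : {z | z ∉ Pl ∧ deriv N z = 0}.Finite

/-- basin -/
def Bas (N : ℂ → ℂ) (ξ : ℂ) : Set ℂ := {z | Tendsto (fun n => N^[n] z) atTop (𝓝 ξ)}

/-- immediate basin -/
def Imm (N : ℂ → ℂ) (ξ : ℂ) : Set ℂ := connectedComponentIn (Bas N ξ) ξ

lemma bas_iff {N : ℂ → ℂ} {ξ z : ℂ} : N z ∈ Bas N ξ ↔ z ∈ Bas N ξ := by
  simp only [Bas, mem_ofPred_eq]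
  rw [← tendsto_add_atTop_iff_nat (f := fun n => N^[n] z) 1]
  rfl

lemma bas_iter {N : ℂ → ℂ} {ξ z : ℂ} (n : ℕ) : N^[n] z ∈ Bas N ξ ↔ z ∈ Bas N ξ := by
  induction n generalizing z with
  | zero => rfl
  | succ n ih => rw [Function.iterate_succ_apply, ih, bas_iff]

variable {N : ℂ → ℂ} {Pl : Set ℂ} {ξ : ℂ}

lemma NMap.cont (h : NMap N Pl) {z : ℂ} (hz : z ∉ Pl) : ContinuousAt N z :=
  (h.diff z hz).continuousAt

/-- contraction near an attracting fixed point -/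
lemma NMap.attr (h : NMap N Pl) (hξ : ξ ∉ Pl) (hf : N ξ = ξ) :
    ∃ r > 0, ∃ κ, 0 ≤ κ ∧ κ < 1 ∧ ∀ z ∈ closedBall ξ r, z ∉ Pl ∧ ‖N z - ξ‖ ≤ κ * ‖z - ξ‖ := by
  obtain ⟨κ, h1, h2⟩ := exists_between (h.fix ξ hξ hf)
  have h3 : ∀ᶠ z in 𝓝 ξ, ‖N z - ξ‖ ≤ κ * ‖z - ξ‖ := by
    have hd := (h.diff ξ hξ).hasDerivAt.isLittleO
    have := hd.def (show 0 < κ - ‖deriv N ξ‖ by linarith)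
    filter_upwards [this] with z hz
    rw [hf] at hz
    calc ‖N z - ξ‖ = ‖(N z - ξ - (z - ξ) • deriv N ξ) + (z - ξ) • deriv N ξ‖ := by ring_nf
      _ ≤ (κ - ‖deriv N ξ‖) * ‖z - ξ‖ + ‖z - ξ‖ * ‖deriv N ξ‖ := by
        refine (norm_add_le _ _).trans (add_le_add hz (norm_smul _ _).le)
      _ = κ * ‖z - ξ‖ := by ring
  have h4 : ∀ᶠ z in 𝓝 ξ, z ∉ Pl := h.plfin.isClosed.isOpen_compl.mem_nhds hξ
  obtain ⟨r, hr, hrs⟩ := Metric.nhds_basis_closedBall.eventually_iff.1 (h4.and h3)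
  exact ⟨r, hr, κ, (norm_nonneg _).trans h1.le, h2, fun z hz => hrs hz⟩

lemma tendsto_of_contr {r κ : ℝ} (hκ0 : 0 ≤ κ) (hκ : κ < 1)
    (hc : ∀ z ∈ closedBall ξ r, ‖N z - ξ‖ ≤ κ * ‖z - ξ‖) {z : ℂ} (hz : z ∈ closedBall ξ r) :
    z ∈ Bas N ξ := by
  have h1 : ∀ n, ‖N^[n] z - ξ‖ ≤ κ ^ n * ‖z - ξ‖ := by
    intro n
    induction n with
    | zero => simp
    | succ n ih =>
      rw [Function.iterate_succ_apply']
      have : N^[n] z ∈ closedBall ξ r := by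
        rw [mem_closedBall, dist_eq_norm] at hz ⊢
        refine ih.trans (le_trans ?_ hz)
        exact mul_le_of_le_one_left (norm_nonneg _) (pow_le_one₀ hκ0 hκ.le)
      refine (hc _ this).trans ?_
      rw [pow_succ]
      nlinarith
  rw [Bas, mem_ofPred_eq, tendsto_iff_norm_sub_tendsto_zero]
  refine squeeze_zero (fun _ => norm_nonneg _) h1 ?_
  simpa using (tendsto_pow_atTop_nhds_zero_of_lt_one hκ0 hκ).mul_const ‖z - ξ‖

/-- ambient data -/
structure Dyn (N : ℂ → ℂ) (Pl : Set ℂ) (ξ : ℂ) : Prop extends NMap N Pl where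
  ξpl : ξ ∉ Pl
  ξfix : N ξ = ξ

namespace Dyn

lemma root_mem (h : Dyn N Pl ξ) : ξ ∈ Bas N ξ := by
  have : ∀ n, N^[n] ξ = ξ := fun n => Function.iterate_fixed h.ξfix n
  simp only [Bas, mem_ofPred_eq, this]; exact tendsto_const_nhds

lemma fix_bas (_h : Dyn N Pl ξ) {z : ℂ} (hf : N z = z) (hz : z ∈ Bas N ξ) : z = ξ := by
  have : ∀ n, N^[n] z = z := fun n => Function.iterate_fixed hf n
  simp only [Bas, mem_ofPred_eq, this] at hz
  exact tendsto_nhds_unique tendsto_const_nhds hz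

lemma bas_pl (h : Dyn N Pl ξ) {z : ℂ} (hz : z ∈ Bas N ξ) : z ∉ Pl := by
  intro hp
  exact h.ξpl (h.fix_bas (h.plfix z hp) hz ▸ hp)

lemma iter_diff (h : Dyn N Pl ξ) {z : ℂ} (hz : z ∈ Bas N ξ) (n : ℕ) :
    DifferentiableAt ℂ N^[n] z := by
  induction n generalizing z with
  | zero => exact differentiableAt_id
  | succ n ih =>
    rw [Function.iterate_succ]
    exact (ih (bas_iff.2 hz)).comp z (h.diff z (h.bas_pl hz))

lemma isOpen_bas (h : Dyn N Pl ξ) : IsOpen (Bas N ξ) := by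
  obtain ⟨r, hr, κ, h0, h1, hc⟩ := h.attr h.ξpl h.ξfix
  rw [isOpen_iff_mem_nhds]
  intro z hz
  have : ∀ᶠ n in atTop, N^[n] z ∈ ball ξ r := hz (ball_mem_nhds ξ hr)
  obtain ⟨n, hn⟩ := this.exists
  have h2 : ∀ᶠ w in 𝓝 z, N^[n] w ∈ ball ξ r :=
    (h.iter_diff hz n).continuousAt (isOpen_ball.mem_nhds hn)
  filter_upwards [h2] with w hw
  exact (bas_iter n).1 (tendsto_of_contr h0 h1 (fun z hz => (hc z hz).2) (ball_subset_closedBall hw))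

lemma isOpen_imm (h : Dyn N Pl ξ) : IsOpen (Imm N ξ) := h.isOpen_bas.connectedComponentIn

lemma imm_pre (_h : Dyn N Pl ξ) : IsPreconnected (Imm N ξ) := isPreconnected_connectedComponentIn

lemma mem_imm (h : Dyn N Pl ξ) : ξ ∈ Imm N ξ := mem_connectedComponentIn h.root_mem

lemma imm_bas (_h : Dyn N Pl ξ) : Imm N ξ ⊆ Bas N ξ := connectedComponentIn_subset _ _

lemma imm_pl (h : Dyn N Pl ξ) {z : ℂ} (hz : z ∈ Imm N ξ) : z ∉ Pl := h.bas_pl (h.imm_bas hz)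

lemma sub_imm (_h : Dyn N Pl ξ) {V : Set ℂ} (hV : IsPreconnected V) (hVB : V ⊆ Bas N ξ) {x : ℂ}
    (hx : x ∈ V) (hxU : x ∈ Imm N ξ) : V ⊆ Imm N ξ := by
  have := hV.subset_connectedComponentIn hx hVB
  rwa [← connectedComponentIn_eq hxU] at this

lemma contOn (h : Dyn N Pl ξ) : ContinuousOn N (Imm N ξ) := fun z hz =>
  (h.cont (h.imm_pl hz)).continuousWithinAt

lemma iter_contOn (h : Dyn N Pl ξ) (n : ℕ) : ContinuousOn N^[n] (Imm N ξ) := fun z hz =>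
  (h.iter_diff (h.imm_bas hz) n).continuousAt.continuousWithinAt

lemma imm_maps (h : Dyn N Pl ξ) {z : ℂ} (hz : z ∈ Imm N ξ) : N z ∈ Imm N ξ := by
  refine h.sub_imm (h.imm_pre.image N h.contOn) ?_ ⟨ξ, h.mem_imm, h.ξfix⟩ h.mem_imm ⟨z, hz, rfl⟩
  rintro _ ⟨w, hw, rfl⟩
  exact bas_iff.2 (h.imm_bas hw)

lemma imm_iter (h : Dyn N Pl ξ) {z : ℂ} (hz : z ∈ Imm N ξ) (n : ℕ) : N^[n] z ∈ Imm N ξ := by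
  induction n with
  | zero => exact hz
  | succ n ih => rw [Function.iterate_succ_apply']; exact h.imm_maps ih

lemma mem_of_closure (h : Dyn N Pl ξ) {z : ℂ} (hz : z ∈ closure (Imm N ξ)) (hb : z ∈ Bas N ξ) :
    z ∈ Imm N ξ := by
  have ho : IsOpen (connectedComponentIn (Bas N ξ) z) := h.isOpen_bas.connectedComponentIn
  obtain ⟨w, hw, hwU⟩ := mem_closure_iff.1 hz _ ho (mem_connectedComponentIn hb)
  exact h.sub_imm isPreconnected_connectedComponentIn (connectedComponentIn_subset _ _) hw hwU
    (mem_connectedComponentIn hb)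

lemma frontier_nb (h : Dyn N Pl ξ) {z : ℂ} (hz : z ∈ frontier (Imm N ξ)) : z ∉ Bas N ξ := by
  intro hb
  rw [h.isOpen_imm.frontier_eq] at hz
  exact hz.2 (h.mem_of_closure hz.1 hb)

lemma closure_maps (h : Dyn N Pl ξ) {z : ℂ} (hz : z ∈ closure (Imm N ξ)) (hp : z ∉ Pl) :
    N z ∈ closure (Imm N ξ) := by
  have h1 : Tendsto N (𝓝[Imm N ξ] z) (𝓝 (N z)) := (h.cont hp).mono_left nhdsWithin_le_nhds
  haveI := mem_closure_iff_nhdsWithin_neBot.1 hz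
  exact mem_closure_of_tendsto h1 (by filter_upwards [self_mem_nhdsWithin] with w hw using h.imm_maps hw)

lemma frontier_maps (h : Dyn N Pl ξ) {z : ℂ} (hz : z ∈ frontier (Imm N ξ)) (hp : z ∉ Pl) :
    N z ∈ frontier (Imm N ξ) := by
  rw [h.isOpen_imm.frontier_eq]
  refine ⟨h.closure_maps (frontier_subset_closure hz) hp, fun hU => ?_⟩
  exact h.frontier_nb hz (bas_iff.1 (h.imm_bas hU))

end Dyn

end NewtonPf
end

section
open Complex Metric Set Filter Topology

namespace NewtonPf

variable {N : ℂ → ℂ} {Pl : Set ℂ} {ξ : ℂ} {r : ℝ}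

/-- data with a good radius -/
structure DynR (N : ℂ → ℂ) (Pl : Set ℂ) (ξ : ℂ) (r : ℝ) : Prop extends Dyn N Pl ξ where
  rpos : 0 < r
  contr : ∃ κ, 0 ≤ κ ∧ κ < 1 ∧ ∀ z ∈ closedBall ξ r, ‖N z - ξ‖ ≤ κ * ‖z - ξ‖
  gen : ∀ c ∉ Pl, deriv N c = 0 → ∀ n, ‖N^[n] c - ξ‖ ≠ r

lemma Dyn.exists_r (h : Dyn N Pl ξ) : ∃ r, DynR N Pl ξ r := by
  obtain ⟨r, hr, κ, h0, h1, hc⟩ := h.attr h.ξpl h.ξfix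
  set S : Set ℝ := ⋃ n : ℕ, (fun c => ‖N^[n] c - ξ‖) '' {z | z ∉ Pl ∧ deriv N z = 0}
  have hS : S.Countable := countable_iUnion fun n => (h.crit.image _).countable
  have : ¬ (Ioo 0 r ⊆ S) := fun hsub => by
    have := hS.mono hsub
    rw [← Cardinal.le_aleph0_iff_set_countable, Cardinal.mk_Ioo_real hr] at this
    exact absurd this (not_le.2 Cardinal.aleph0_lt_continuum)
  obtain ⟨s, hs, hsS⟩ := not_subset.1 this
  refine ⟨s, h, hs.1, ⟨κ, h0, h1, fun z hz => (hc z (closedBall_subset_closedBall hs.2.le hz)).2⟩, ?_⟩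
  intro c hc1 hc2 n hn
  exact hsS (mem_iUnion.2 ⟨n, c, ⟨hc1, hc2⟩, hn⟩)

/-- truncated immediate basins -/
def Wn (N : ℂ → ℂ) (ξ : ℂ) (r : ℝ) (n : ℕ) : Set ℂ := Imm N ξ ∩ N^[n] ⁻¹' ball ξ r

/-- exhausting domains -/
def Dn (N : ℂ → ℂ) (ξ : ℂ) (r : ℝ) (n : ℕ) : Set ℂ := connectedComponentIn (Wn N ξ r n) ξ

namespace DynR

lemma ball_maps (h : DynR N Pl ξ r) {z : ℂ} (hz : z ∈ closedBall ξ r) : N z ∈ ball ξ r := by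
  obtain ⟨κ, h0, h1, hc⟩ := h.contr
  have h2 := hc z hz
  rw [mem_closedBall, dist_eq_norm] at hz
  rw [mem_ball, dist_eq_norm]
  rcases (norm_nonneg (z - ξ)).eq_or_lt with h3 | h3
  · rw [← h3] at h2; have := h.rpos; linarith
  · nlinarith

lemma ball_bas (h : DynR N Pl ξ r) : closedBall ξ r ⊆ Bas N ξ := by
  obtain ⟨κ, h0, h1, hc⟩ := h.contr
  exact fun z hz => tendsto_of_contr h0 h1 hc hz

lemma ball_imm (h : DynR N Pl ξ r) : closedBall ξ r ⊆ Imm N ξ :=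
  h.sub_imm (convex_closedBall ξ r).isPreconnected h.ball_bas (mem_closedBall_self h.rpos.le) h.mem_imm

lemma iter_ball (h : DynR N Pl ξ r) {z : ℂ} {m n : ℕ} (hmn : m ≤ n) (hz : N^[m] z ∈ ball ξ r) :
    N^[n] z ∈ ball ξ r := by
  induction n, hmn using Nat.le_induction with
  | base => exact hz
  | succ k _ ih =>
    rw [Function.iterate_succ_apply']; exact h.ball_maps (ball_subset_closedBall ih)

lemma iter_cball (h : DynR N Pl ξ r) {z : ℂ} {m n : ℕ} (hmn : m < n) (hz : N^[m] z ∈ closedBall ξ r) :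
    N^[n] z ∈ ball ξ r := by
  refine h.iter_ball (Nat.succ_le_of_lt hmn) ?_
  rw [Function.iterate_succ_apply']; exact h.ball_maps hz

lemma wn_open (h : DynR N Pl ξ r) (n : ℕ) : IsOpen (Wn N ξ r n) :=
  (h.iter_contOn n).isOpen_inter_preimage h.isOpen_imm isOpen_ball

lemma wn_mono (h : DynR N Pl ξ r) {m n : ℕ} (hmn : m ≤ n) : Wn N ξ r m ⊆ Wn N ξ r n :=
  fun _ hz => ⟨hz.1, h.iter_ball hmn hz.2⟩

lemma wn_mem (h : DynR N Pl ξ r) (n : ℕ) : ξ ∈ Wn N ξ r n :=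
  ⟨h.mem_imm, by
    have : N^[n] ξ = ξ := Function.iterate_fixed h.ξfix n
    simpa [this] using h.rpos⟩

lemma dn_open (h : DynR N Pl ξ r) (n : ℕ) : IsOpen (Dn N ξ r n) := (h.wn_open n).connectedComponentIn

lemma dn_mem (h : DynR N Pl ξ r) (n : ℕ) : ξ ∈ Dn N ξ r n := mem_connectedComponentIn (h.wn_mem n)

lemma dn_pre (_h : DynR N Pl ξ r) (n : ℕ) : IsPreconnected (Dn N ξ r n) :=
  isPreconnected_connectedComponentIn

lemma dn_wn (_h : DynR N Pl ξ r) (n : ℕ) : Dn N ξ r n ⊆ Wn N ξ r n := connectedComponentIn_subset _ _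

lemma dn_imm (h : DynR N Pl ξ r) (n : ℕ) : Dn N ξ r n ⊆ Imm N ξ := fun _ hz => (h.dn_wn n hz).1

lemma dn_mono (h : DynR N Pl ξ r) {m n : ℕ} (hmn : m ≤ n) : Dn N ξ r m ⊆ Dn N ξ r n :=
  (h.dn_pre m).subset_connectedComponentIn (h.dn_mem m) ((h.dn_wn m).trans (h.wn_mono hmn))

lemma sub_dn (_h : DynR N Pl ξ r) {n : ℕ} {V : Set ℂ} (hV : IsPreconnected V) (hVW : V ⊆ Wn N ξ r n)
    {x : ℂ} (hx : x ∈ V) (hxD : x ∈ Dn N ξ r n) : V ⊆ Dn N ξ r n := by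
  have := hV.subset_connectedComponentIn hx hVW
  rwa [← connectedComponentIn_eq hxD] at this

lemma dn_zero (h : DynR N Pl ξ r) : Dn N ξ r 0 = ball ξ r := by
  refine Subset.antisymm (fun z hz => (h.dn_wn 0 hz).2) ?_
  refine h.sub_dn (convex_ball ξ r).isPreconnected (fun z hz => ?_) (mem_ball_self h.rpos) (h.dn_mem 0)
  exact ⟨h.ball_imm (ball_subset_closedBall hz), hz⟩

lemma dn_maps (h : DynR N Pl ξ r) {n : ℕ} {z : ℂ} (hz : z ∈ Dn N ξ r (n + 1)) : N z ∈ Dn N ξ r n := by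
  refine h.sub_dn (((h.dn_pre (n + 1)).image N (h.contOn.mono (h.dn_imm _)))) ?_
    ⟨ξ, h.dn_mem _, h.ξfix⟩ (h.dn_mem n) ⟨z, hz, rfl⟩
  rintro _ ⟨w, hw, rfl⟩
  exact ⟨h.imm_maps (h.dn_imm _ hw), by
    have := (h.dn_wn _ hw).2
    rwa [mem_preimage, Function.iterate_succ_apply] at this⟩

/-- closures are compact subsets of the immediate basin -/
lemma dn_closure (h : DynR N Pl ξ r) (n : ℕ) :
    IsCompact (closure (Dn N ξ r n)) ∧ closure (Dn N ξ r n) ⊆ Imm N ξ := by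
  induction n with
  | zero =>
    rw [h.dn_zero, closure_ball ξ h.rpos.ne']
    exact ⟨isCompact_closedBall _ _, h.ball_imm⟩
  | succ n ih =>
    obtain ⟨R, hR⟩ := (ih.1.isBounded.subset subset_closure).exists_norm_le
    have hNR : ∀ z ∈ Dn N ξ r (n + 1), ‖N z‖ ≤ R := fun z hz => hR _ (h.dn_maps hz)
    have hbd : Bornology.IsBounded (Dn N ξ r (n + 1)) := by
      have h1 := h.inf (Ioi_mem_atTop R)
      rw [mem_map] at h1
      have h2 : Bornology.IsBounded ((fun z => ‖N z‖) ⁻¹' Ioi R)ᶜ := Bornology.isBounded_def.2 (by simpa using h1)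
      exact h2.subset fun z hz hz' => absurd (hNR z hz) (not_le.2 hz')
    refine ⟨hbd.isCompact_closure, fun x hx => ?_⟩
    have hxU : x ∈ closure (Imm N ξ) := closure_mono (h.dn_imm _) hx
    have hxp : x ∉ Pl := by
      intro hp
      have h1 := h.pole x hp (Ioi_mem_atTop R)
      rw [mem_map, mem_nhdsWithin] at h1
      obtain ⟨V, hVo, hxV, hV⟩ := h1
      obtain ⟨w, hwV, hw⟩ := mem_closure_iff.1 hx V hVo hxV
      have : w ≠ x := fun e => h.imm_pl (h.dn_imm _ hw) (e ▸ hp)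
      exact absurd (hNR w hw) (not_le.2 (hV ⟨hwV, this⟩))
    have hNx : N x ∈ closure (Dn N ξ r n) := by
      have h1 : Tendsto N (𝓝[Dn N ξ r (n + 1)] x) (𝓝 (N x)) := (h.cont hxp).mono_left nhdsWithin_le_nhds
      have := mem_closure_iff_nhdsWithin_neBot.1 hx
      exact mem_closure_of_tendsto h1 (by filter_upwards [self_mem_nhdsWithin] with w hw using h.dn_maps hw)
    exact h.mem_of_closure hxU (bas_iff.1 (h.imm_bas (ih.2 hNx)))

lemma closure_dn_maps (h : DynR N Pl ξ r) {n : ℕ} {z : ℂ} (hz : z ∈ closure (Dn N ξ r (n + 1))) :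
    N z ∈ closure (Dn N ξ r n) := by
  have hxp := h.imm_pl ((h.dn_closure _).2 hz)
  have h1 : Tendsto N (𝓝[Dn N ξ r (n + 1)] z) (𝓝 (N z)) := (h.cont hxp).mono_left nhdsWithin_le_nhds
  have := mem_closure_iff_nhdsWithin_neBot.1 hz
  exact mem_closure_of_tendsto h1 (by filter_upwards [self_mem_nhdsWithin] with w hw using h.dn_maps hw)

lemma closure_dn_ball (h : DynR N Pl ξ r) {n : ℕ} {z : ℂ} (hz : z ∈ closure (Dn N ξ r n)) :
    ‖N^[n] z - ξ‖ ≤ r := by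
  have hc := (h.iter_diff (h.imm_bas ((h.dn_closure n).2 hz)) n).continuousAt
  have h1 : Tendsto N^[n] (𝓝[Dn N ξ r n] z) (𝓝 (N^[n] z)) := hc.mono_left nhdsWithin_le_nhds
  have := mem_closure_iff_nhdsWithin_neBot.1 hz
  have h2 : N^[n] z ∈ closure (ball ξ r) :=
    mem_closure_of_tendsto h1 (by
      filter_upwards [self_mem_nhdsWithin] with w hw using (h.dn_wn n hw).2)
  simpa [dist_eq_norm] using closure_ball_subset_closedBall h2

lemma exhaust (h : DynR N Pl ξ r) {z : ℂ} (hz : z ∈ Imm N ξ) : ∃ n, z ∈ Dn N ξ r n := by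
  have hsub : Imm N ξ ⊆ ⋃ n, Dn N ξ r n := by
    refine h.imm_pre.subset_of_closure_inter_subset (isOpen_iUnion fun n => h.dn_open n)
      ⟨ξ, h.mem_imm, mem_iUnion.2 ⟨0, h.dn_mem 0⟩⟩ ?_
    rintro x ⟨hx, hxU⟩
    have h1 : ∀ᶠ n in atTop, N^[n] x ∈ ball ξ r := h.imm_bas hxU (ball_mem_nhds ξ h.rpos)
    obtain ⟨n, hn⟩ := h1.exists
    have hxW : x ∈ Wn N ξ r n := ⟨hxU, hn⟩
    obtain ⟨w, hw, hw2⟩ := mem_closure_iff.1 hx _ (h.wn_open n).connectedComponentIn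
      (mem_connectedComponentIn hxW)
    obtain ⟨k, hk⟩ := mem_iUnion.1 hw2
    refine mem_iUnion.2 ⟨max n k, ?_⟩
    exact h.sub_dn isPreconnected_connectedComponentIn
      ((connectedComponentIn_subset _ _).trans (h.wn_mono (le_max_left n k))) hw
      (h.dn_mono (le_max_right n k) hk) (mem_connectedComponentIn hxW)
  exact mem_iUnion.1 (hsub hz)

lemma frontier_norm (h : DynR N Pl ξ r) {n : ℕ} {c : ℂ} (hc : c ∈ frontier (Dn N ξ r n)) :
    ‖N^[n] c - ξ‖ = r := by
  rw [(h.dn_open n).frontier_eq] at hc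
  refine le_antisymm (h.closure_dn_ball hc.1) (not_lt.1 fun hlt => hc.2 ?_)
  have hcW : c ∈ Wn N ξ r n := ⟨(h.dn_closure n).2 hc.1, by simpa [dist_eq_norm] using hlt⟩
  obtain ⟨w, hw, hw2⟩ := mem_closure_iff.1 hc.1 _ (h.wn_open n).connectedComponentIn
      (mem_connectedComponentIn hcW)
  exact h.sub_dn isPreconnected_connectedComponentIn (connectedComponentIn_subset _ _) hw hw2
    (mem_connectedComponentIn hcW)

lemma frontier_deriv (h : DynR N Pl ξ r) {n : ℕ} {c : ℂ} (hc : c ∈ Imm N ξ)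
    (hcn : ‖N^[n] c - ξ‖ = r) : deriv N^[n] c ≠ 0 := by
  induction n generalizing c with
  | zero =>
    simp
  | succ n ih =>
    rw [Function.iterate_succ, deriv_comp _ (h.iter_diff (bas_iff.2 (h.imm_bas hc)) n)
      (h.diff c (h.imm_pl hc))]
    refine mul_ne_zero (ih (h.imm_maps hc) hcn) fun h0 => h.gen c (h.imm_pl hc) h0 (n + 1) hcn

end DynR
end NewtonPf
end

section
open Complex Metric Set Filter Topology

namespace NewtonPf

variable {N : ℂ → ℂ} {Pl : Set ℂ} {ξ : ℂ} {r : ℝ}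

lemma DynR.local_str (h : DynR N Pl ξ r) {n : ℕ} {c : ℂ} (hc : c ∈ frontier (Dn N ξ r n))
    {O' : Set ℂ} (hO' : O' ∈ 𝓝 c) :
    ∃ O ∈ 𝓝 c, O ⊆ O' ∧ O ⊆ Imm N ξ ∧ IsPreconnected (O \ closure (Dn N ξ r n)) ∧
      (O \ closure (Dn N ξ r n)).Nonempty ∧
      ∀ z ∈ O, z ∈ closure (Dn N ξ r n) ↔ ‖N^[n] z - ξ‖ ≤ r := by
  have hcl : c ∈ closure (Dn N ξ r n) := frontier_subset_closure hc
  have hcU : c ∈ Imm N ξ := (h.dn_closure n).2 hcl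
  have hcn := h.frontier_norm hc
  have hd := h.frontier_deriv hcU hcn
  have hs : HasStrictDerivAt N^[n] (deriv N^[n] c) c := by
    have : AnalyticAt ℂ N^[n] c := DifferentiableOn.analyticAt (s := Imm N ξ)
      (fun z hz => (h.iter_diff (h.imm_bas hz) n).differentiableWithinAt) (h.isOpen_imm.mem_nhds hcU)
    exact this.hasStrictDerivAt
  set g := hs.localInverse _ _ _ hd with hg
  have hgs := hs.to_localInverse hd
  have hri := hs.eventually_right_inverse hd
  have hgc : g (N^[n] c) = c := (hs.eventually_left_inverse hd).self_of_nhds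
  have hne : N^[n] c - ξ ≠ 0 := by
    intro h0; rw [h0, norm_zero] at hcn; exact h.rpos.ne hcn
  set E : ℂ → ℂ := fun w => ξ + exp w with hE
  set w0 := Complex.log (N^[n] c - ξ)
  have hE0 : E w0 = N^[n] c := by simp [hE, w0, exp_log hne]
  have hEs : HasStrictDerivAt E (exp w0) w0 := (hasStrictDerivAt_exp w0).const_add ξ
  have hmap : map (fun w => g (E w)) (𝓝 w0) = 𝓝 c := by
    have h1 : map E (𝓝 w0) = 𝓝 (N^[n] c) := by
      rw [hEs.map_nhds_eq (exp_ne_zero _), hE0]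
    have h2 : map g (𝓝 (N^[n] c)) = 𝓝 c := by
      rw [hgs.map_nhds_eq (inv_ne_zero hd)]
      exact congrArg _ hgc
    rw [show (fun w => g (E w)) = g ∘ E from rfl, ← Filter.map_map, h1, h2]
  have hEt : Tendsto E (𝓝 w0) (𝓝 (N^[n] c)) := hE0 ▸ hEs.hasDerivAt.continuousAt
  have hGt : Tendsto (fun w => g (E w)) (𝓝 w0) (𝓝 c) := hmap.le
  have hgca : ∀ᶠ y in 𝓝 (N^[n] c), ContinuousAt g y := by
    set e := (hs.hasStrictFDerivAt_equiv hd).toOpenPartialHomeomorph with he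
    have h1 : N^[n] c ∈ e.target := (hs.hasStrictFDerivAt_equiv hd).image_mem_toOpenPartialHomeomorph_target
    filter_upwards [e.open_target.mem_nhds h1] with y hy
    exact e.continuousAt_symm hy
  obtain ⟨ε, hε, hball⟩ := Metric.eventually_nhds_iff_ball.1
    ((hGt.eventually (inter_mem hO' (h.isOpen_imm.mem_nhds hcU))).and
      ((hEt.eventually hgca).and (hEt.eventually hri)))
  have hN : ∀ w ∈ ball w0 ε, N^[n] (g (E w)) = E w := fun w hw => (hball w hw).2.2
  have hnorm : ∀ w ∈ ball w0 ε, ‖N^[n] (g (E w)) - ξ‖ = Real.exp w.re := fun w hw => by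
    rw [hN w hw]; simp [hE, norm_exp]
  have hGc : ContinuousOn (fun w => g (E w)) (ball w0 ε) := fun w hw =>
    (ContinuousAt.comp (f := E) (hball w hw).2.1 (by fun_prop)).continuousWithinAt
  set O := (fun w => g (E w)) '' ball w0 ε with hO
  have hOn : O ∈ 𝓝 c := by rw [← hmap]; exact image_mem_map (ball_mem_nhds _ hε)
  have hOU : O ⊆ Imm N ξ := by rintro _ ⟨w, hw, rfl⟩; exact (hball w hw).1.2
  set L := ball w0 ε ∩ {w : ℂ | w.re < Real.log r} with hL
  have hLc : Convex ℝ L := (convex_ball _ _).inter (convex_halfSpace_re_lt _)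
  have hLD : (fun w => g (E w)) '' L ⊆ Dn N ξ r n := by
    obtain ⟨z, hzO, hzD⟩ := mem_closure_iff_nhds.1 hcl O hOn
    obtain ⟨w, hw, rfl⟩ := hzO
    refine h.sub_dn (hLc.isPreconnected.image _ (hGc.mono inter_subset_left)) ?_
      ⟨w, ⟨hw, ?_⟩, rfl⟩ hzD
    · rintro _ ⟨w, hw, rfl⟩
      refine ⟨hOU ⟨w, hw.1, rfl⟩, ?_⟩
      rw [mem_preimage, mem_ball, dist_eq_norm, hnorm w hw.1]
      exact (Real.lt_log_iff_exp_lt h.rpos).1 hw.2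
    · have := (h.dn_wn n hzD).2
      rw [mem_preimage, mem_ball, dist_eq_norm, hnorm w hw] at this
      exact (Real.lt_log_iff_exp_lt h.rpos).2 this
  have hiff : ∀ z ∈ O, z ∈ closure (Dn N ξ r n) ↔ ‖N^[n] z - ξ‖ ≤ r := by
    rintro _ ⟨w, hw, rfl⟩
    refine ⟨fun hz => h.closure_dn_ball hz, fun hz => ?_⟩
    simp only [] at hz
    rw [hnorm w hw] at hz
    have h1 : w ∈ closure L := by
      refine isOpen_ball.inter_closure ⟨hw, ?_⟩
      rw [Complex.closure_setOfPred_re_lt]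
      exact (Real.le_log_iff_exp_le h.rpos).2 hz
    exact closure_mono hLD (((hGc w hw).mono inter_subset_left).mem_closure_image h1)
  have hup : O \ closure (Dn N ξ r n) = (fun w => g (E w)) '' (ball w0 ε ∩ {w : ℂ | Real.log r < w.re}) := by
    ext z; constructor
    · rintro ⟨⟨w, hw, rfl⟩, hz⟩
      rw [hiff _ ⟨w, hw, rfl⟩] at hz
      simp only [] at hz
      rw [hnorm w hw, not_le] at hz
      exact ⟨w, ⟨hw, (Real.log_lt_iff_lt_exp h.rpos).2 hz⟩, rfl⟩
    · rintro ⟨w, ⟨hw, hw2⟩, rfl⟩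
      refine ⟨⟨w, hw, rfl⟩, ?_⟩
      rw [hiff _ ⟨w, hw, rfl⟩]
      simp only []
      rw [hnorm w hw, not_le]
      exact (Real.log_lt_iff_lt_exp h.rpos).1 hw2
  refine ⟨O, hOn, ?_, hOU, ?_, ?_, hiff⟩
  · rintro _ ⟨w, hw, rfl⟩; exact (hball w hw).1.1
  · rw [hup]
    exact (((convex_ball _ _).inter (convex_halfSpace_re_gt _)).isPreconnected.image _
      (hGc.mono inter_subset_left))
  · rw [hup]
    refine Nonempty.image _ ⟨w0 + (ε / 2 : ℝ), ?_, ?_⟩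
    · rw [mem_ball, dist_eq_norm]; simp [abs_of_pos hε]; linarith
    · have : w0.re = Real.log r := by
        rw [← Real.log_exp w0.re, ← hnorm w0 (mem_ball_self hε)]; congr 1
        simp only [hE0, hgc, hcn]
      simp [this, hε]

end NewtonPf
end

section
open Complex Metric Set Filter Topology

namespace NewtonPf

/-- two logarithms differ by a constant -/
lemma exp_const {X : Type*} [TopologicalSpace X] {S : Set X} (hS : IsPreconnected S) {f g : X → ℂ}
    (hf : ContinuousOn f S) (hg : ContinuousOn g S) (he : ∀ x ∈ S, exp (f x) = exp (g x)) {x y : X}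
    (hx : x ∈ S) (hy : y ∈ S) : f x - g x = f y - g y := by
  have h1 : IsPreconnected ((fun x => f x - g x) '' S) := hS.image _ (hf.sub hg)
  have h2 : (fun x => f x - g x) '' S ⊆ range (fun n : ℤ => (n : ℂ) * (2 * Real.pi * I)) := by
    rintro _ ⟨x, hx, rfl⟩
    obtain ⟨n, hn⟩ := exp_eq_exp_iff_exists_int.1 (he x hx)
    exact ⟨n, by simp [hn]⟩
  have h3 := ((countable_range (fun n : ℤ => (n : ℂ) * (2 * Real.pi * I))).mono h2).isTotallyDisconnected
  exact h3 _ Subset.rfl h1 ⟨x, hx, rfl⟩ ⟨y, hy, rfl⟩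

lemma simply_of_convex {E : Type*} [NormedAddCommGroup E] [NormedSpace ℝ E] {S : Set E} (hS : Convex ℝ S)
    (hn : S.Nonempty) : IsSimplyConnected S := by
  have := hS.contractibleSpace hn
  have h2 : SimplyConnectedSpace S := inferInstance
  exact h2

/-- unicoherence of the plane -/
lemma unicoherent {A B : Set ℂ} (hA : IsClosed A) (hB : IsClosed B) (hAp : IsPreconnected A)
    (hBp : IsPreconnected B) (hAB : A ∪ B = univ) : IsPreconnected (A ∩ B) := by
  classical
  rw [isPreconnected_iff_subset_of_disjoint_closed]
  intro u v hu hv huv hd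
  by_contra hcon
  push Not at hcon
  obtain ⟨⟨q, hq, hqu⟩, ⟨p, hp, hpv⟩⟩ := And.intro (not_subset.1 hcon.1) (not_subset.1 hcon.2)
  have hqv : q ∈ v := (huv hq).resolve_left hqu
  have hpu : p ∈ u := (huv hp).resolve_right hpv
  have hdis : Disjoint (A ∩ B ∩ u) (A ∩ B ∩ v) := by
    rw [Set.disjoint_left]
    rintro x ⟨hx, hxu⟩ ⟨_, hxv⟩
    have : x ∈ A ∩ B ∩ (u ∩ v) := ⟨hx, hxu, hxv⟩
    rw [hd] at this; exact this
  obtain ⟨k, hk0, hk1, -⟩ := exists_continuous_zero_one_of_isClosed ((hA.inter hB).inter hu)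
    ((hA.inter hB).inter hv) hdis
  set φ : ℂ → ℂ := fun z => if z ∈ A then exp (I * Real.pi * k z) else exp (-(I * Real.pi * k z)) with hφ
  have hφA : ∀ z ∈ A, φ z = exp (I * Real.pi * k z) := fun z hz => by simp [hφ, hz]
  have hφB : ∀ z ∈ B, φ z = exp (-(I * Real.pi * k z)) := fun z hz => by
    by_cases hzA : z ∈ A
    · rw [hφA z hzA]
      rcases huv ⟨hzA, hz⟩ with h1 | h1
      · have : k z = 0 := hk0 ⟨⟨hzA, hz⟩, h1⟩
        simp [this]
      · have : k z = 1 := hk1 ⟨⟨hzA, hz⟩, h1⟩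
        rw [this, Complex.exp_neg, show I * (Real.pi : ℂ) * ((1 : ℝ) : ℂ) = Real.pi * I by push_cast; ring, exp_pi_mul_I]
        norm_num
    · simp [hφ, hzA]
  have hkc : Continuous fun z => I * (Real.pi : ℂ) * (k z : ℂ) := by fun_prop
  have hφc : Continuous φ := by
    rw [← continuousOn_univ, ← hAB]
    refine ContinuousOn.union_of_isClosed ?_ ?_ hA hB
    · exact (continuous_exp.comp hkc).continuousOn.congr fun z hz => hφA z hz
    · exact (continuous_exp.comp hkc.neg).continuousOn.congr fun z hz => hφB z hz
  obtain ⟨g, hgc, hg⟩ := exists_continuousOn_eqOn_exp_comp (U := (univ : Set ℂ))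
    (simply_of_convex convex_univ univ_nonempty) isOpen_univ hφc.continuousOn (by
      rintro ⟨z, -, hz⟩
      simp only [hφ] at hz
      split_ifs at hz <;> exact exp_ne_zero _ hz)
  have hg' : ∀ z, exp (g z) = φ z := fun z => hg (mem_univ z)
  have h1 := exp_const hAp (hgc.mono (subset_univ A)) hkc.continuousOn
    (fun z hz => (hg' z).trans (hφA z hz)) hp.1 hq.1
  have h2 := exp_const hBp (hgc.mono (subset_univ B)) hkc.neg.continuousOn
    (fun z hz => (hg' z).trans (hφB z hz)) hp.2 hq.2
  have e0 : k p = 0 := hk0 ⟨hp, hpu⟩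
  have e1 : k q = 1 := hk1 ⟨hq, hqv⟩
  simp only [Pi.neg_apply] at h2
  rw [e0, e1] at h1 h2
  have h3 : I * (Real.pi : ℂ) = 0 := by
    push_cast at h1 h2
    linear_combination (h1 - h2) / 2
  simp [Real.pi_ne_zero] at h3

/-- complement of a good domain -/
lemma compl_pre {U D : Set ℂ} (hU : IsOpen U) (hUp : IsPreconnected U) (hD : IsOpen D) (hDn : D.Nonempty)
    (hDU : closure D ⊆ U) (hF : IsPreconnected (frontier D))
    (hFc : frontier D ⊆ closure (closure D)ᶜ)
    (LS : ∀ c ∈ frontier D, ∃ O ∈ 𝓝 c, O ⊆ U ∧ IsPreconnected (O \ closure D) ∧ (O \ closure D).Nonempty) :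
    IsPreconnected (U \ closure D) := by
  rw [isPreconnected_iff_subset_of_disjoint]
  intro u v hu hv huv hd
  have hVo : IsOpen (U \ closure D) := hU.sdiff isClosed_closure
  set V := U \ closure D with hV
  have hdis : ∀ x ∈ V, x ∈ u → x ∈ v → False := fun x h1 h2 h3 => by
    have : x ∈ V ∩ (u ∩ v) := ⟨h1, h2, h3⟩
    rw [hd] at this; exact this
  have key : ∀ a b : Set ℂ, IsOpen a → IsOpen b → V ⊆ a ∪ b → (∀ x ∈ V, x ∈ a → x ∈ b → False) →
      (∀ c ∈ frontier D, c ∉ closure (V ∩ b)) → V ⊆ a := by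
    intro a b ha hb hab hdi hfr x hx
    refine (hab hx).resolve_right fun hxb => ?_
    have hcl : closure (V ∩ b) ∩ U ⊆ V ∩ b := by
      rintro y ⟨hy, hyU⟩
      have hyD : y ∉ closure D := by
        intro hyc
        by_cases hyD : y ∈ D
        · obtain ⟨z, hz, hz2⟩ := mem_closure_iff.1 hy D hD hyD
          exact hz2.1.2 (subset_closure hz)
        · exact hfr y (by rw [hD.frontier_eq]; exact ⟨hyc, hyD⟩) hy
      refine ⟨⟨hyU, hyD⟩, (hab ⟨hyU, hyD⟩).resolve_left fun hya => ?_⟩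
      obtain ⟨z, hz, hz2⟩ := mem_closure_iff.1 hy a ha hya
      exact hdi z hz2.1 hz hz2.2
    have := hUp.subset_of_closure_inter_subset (hVo.inter hb) ⟨x, hx.1, hx, hxb⟩ hcl
    obtain ⟨y, hy⟩ := hDn
    exact (this (hDU (subset_closure hy))).1.2 (subset_closure hy)
  have hloc : ∀ c ∈ frontier D, (c ∈ closure (V ∩ u) ∨ c ∈ closure (V ∩ v)) ∧
      (c ∈ closure (V ∩ u) → c ∈ closure (V ∩ v) → False) := by
    intro c hc
    obtain ⟨O, hO, hOU, hOp, hOn⟩ := LS c hc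
    have hOV : O \ closure D ⊆ V := fun z hz => ⟨hOU hz.1, hz.2⟩
    have h2 := isPreconnected_iff_subset_of_disjoint.1 hOp u v hu hv (hOV.trans huv)
      (by ext z; simp only [mem_inter_iff, mem_empty_iff_false, iff_false]
          exact fun h => hdis z (hOV h.1) h.2.1 h.2.2)
    refine ⟨?_, fun h3 h4 => ?_⟩
    · have : c ∈ closure (V ∩ u ∪ V ∩ v) := by
        rw [← inter_union_distrib_left, inter_eq_left.2 huv]
        rw [mem_closure_iff_nhds]
        intro t ht
        obtain ⟨z, hz, hz2⟩ := mem_closure_iff_nhds.1 (hFc hc) (t ∩ U) (inter_mem ht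
          (hU.mem_nhds (hDU (frontier_subset_closure hc))))
        exact ⟨z, hz.1, hz.2, hz2⟩
      rwa [closure_union] at this
    · obtain ⟨z, hz, hz2⟩ := mem_closure_iff_nhds.1 h3 O hO
      obtain ⟨y, hy, hy2⟩ := mem_closure_iff_nhds.1 h4 O hO
      rcases h2 with h2 | h2
      · exact hdis y hy2.1 (h2 ⟨hy, hy2.1.2⟩) hy2.2
      · exact hdis z hz2.1 hz2.2 (h2 ⟨hz, hz2.1.2⟩)
  rcases isPreconnected_iff_subset_of_disjoint_closed.1 hF _ _ (isClosed_closure (s := V ∩ u))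
    (isClosed_closure (s := V ∩ v)) (fun c hc => (hloc c hc).1) (by
      ext c; simp only [mem_inter_iff, mem_empty_iff_false, iff_false]
      exact fun h => (hloc c h.1).2 h.2.1 h.2.2) with h1 | h1
  · exact Or.inl (key u v hu hv huv hdis fun c hc h2 => (hloc c hc).2 (h1 hc) h2)
  · exact Or.inr (key v u hv hu (by rwa [union_comm]) (fun x a b c => hdis x a c b)
      fun c hc h2 => (hloc c hc).2 h2 (h1 hc))

lemma punct_ball (a : ℂ) (ε : ℝ) : IsPreconnected (ball a ε \ {a}) := by
  rcases le_or_gt ε 0 with h | h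
  · rw [ball_eq_empty.2 h]; simp [isPreconnected_empty]
  have : ball a ε \ {a} = (fun w => a + exp w) '' {w : ℂ | w.re < Real.log ε} := by
    ext z; constructor
    · rintro ⟨h1, h2⟩
      have h3 : z - a ≠ 0 := sub_ne_zero.2 h2
      refine ⟨Complex.log (z - a), ?_, by simp [exp_log h3]⟩
      simp only [mem_ofPred_eq, log_re]
      rw [mem_ball, dist_eq_norm] at h1
      exact Real.log_lt_log (norm_pos_iff.2 h3) h1
    · rintro ⟨w, hw, rfl⟩
      simp only [mem_ofPred_eq] at hw
      simp [norm_exp, (Real.lt_log_iff_exp_lt h).1 hw]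
  rw [this]
  exact (convex_halfSpace_re_lt _).isPreconnected.image _ (by fun_prop)

lemma compl_cball (a : ℂ) {ε : ℝ} (h : 0 < ε) : IsPreconnected (closedBall a ε)ᶜ := by
  have : (closedBall a ε)ᶜ = (fun w => a + exp w) '' {w : ℂ | Real.log ε < w.re} := by
    ext z; constructor
    · intro h1
      rw [mem_compl_iff, mem_closedBall, dist_eq_norm, not_le] at h1
      have h3 : z - a ≠ 0 := norm_pos_iff.1 (h.trans h1)
      refine ⟨Complex.log (z - a), ?_, by simp [exp_log h3]⟩
      simp only [mem_ofPred_eq, log_re]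
      exact Real.log_lt_log h h1
    · rintro ⟨w, hw, rfl⟩
      simp only [mem_ofPred_eq] at hw
      simp [norm_exp, (Real.log_lt_iff_lt_exp h).1 hw]
  rw [this]
  exact (convex_halfSpace_re_gt _).isPreconnected.image _ (by fun_prop)

lemma diff_singleton_pre {V : Set ℂ} (hV : IsOpen V) (hVp : IsPreconnected V) (a : ℂ) :
    IsPreconnected (V \ {a}) := by
  by_cases haV : a ∈ V
  swap
  · rwa [sdiff_singleton_eq_self haV]
  obtain ⟨ε, hε, hB⟩ := Metric.isOpen_iff.1 hV a haV
  rw [isPreconnected_iff_subset_of_disjoint]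
  intro u v hu hv huv hd
  have hdis : ∀ x ∈ V, x ≠ a → x ∈ u → x ∈ v → False := fun x h1 h0 h2 h3 => by
    have : x ∈ (V \ {a}) ∩ (u ∩ v) := ⟨⟨h1, h0⟩, h2, h3⟩
    rw [hd] at this; exact this
  have hBV : ball a ε \ {a} ⊆ V \ {a} := sdiff_subset_sdiff_left hB
  have key : ∀ u v : Set ℂ, IsOpen u → IsOpen v → V \ {a} ⊆ u ∪ v →
      (∀ x ∈ V, x ≠ a → x ∈ u → x ∈ v → False) → ball a ε \ {a} ⊆ u → V \ {a} ⊆ u := by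
    intro u v hu hv huv hdis hBu
    have := isPreconnected_iff_subset_of_disjoint.1 hVp (u ∪ ball a ε) (v \ {a}) (hu.union isOpen_ball)
      (hv.sdiff isClosed_singleton) (fun x hx => by
        by_cases hxa : x = a
        · left; right; rw [hxa]; exact mem_ball_self hε
        · rcases huv ⟨hx, hxa⟩ with h | h
          · exact Or.inl (Or.inl h)
          · exact Or.inr ⟨h, hxa⟩) (by
        ext x; simp only [mem_inter_iff, mem_empty_iff_false, iff_false]
        rintro ⟨hx, h1 | h1, h2, h3⟩
        · exact hdis x hx h3 h1 h2
        · exact hdis x hx h3 (hBu ⟨h1, h3⟩) h2)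
    rcases this with h | h
    · rintro x ⟨hx, hxa⟩
      rcases h hx with h | h
      · exact h
      · exact hBu ⟨h, hxa⟩
    · exact absurd rfl (h haV).2
  rcases isPreconnected_iff_subset_of_disjoint.1 (punct_ball a ε) u v hu hv (hBV.trans huv) (by
    ext x; simp only [mem_inter_iff, mem_empty_iff_false, iff_false]
    exact fun h => hdis x (hB h.1.1) h.1.2 h.2.1 h.2.2) with h | h
  · exact Or.inl (key u v hu hv huv hdis h)
  · exact Or.inr (key v u hv hu (by rwa [union_comm]) (fun x a b c d => hdis x a b d c) h)

lemma diff_finite_pre {V : Set ℂ} (hV : IsOpen V) (hVp : IsPreconnected V) {S : Set ℂ} (hS : S.Finite) :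
    IsPreconnected (V \ S) := by
  induction S, hS using Set.Finite.induction_on with
  | empty => simpa
  | @insert a S _ hS ih =>
    have : V \ insert a S = (V \ S) \ {a} := by ext; simp; tauto
    rw [this]
    exact diff_singleton_pre (hV.sdiff hS.isClosed) ih a

end NewtonPf
end

section
open Complex Metric Set Filter Topology

namespace NewtonPf

variable {N : ℂ → ℂ} {Pl : Set ℂ} {ξ : ℂ} {r : ℝ}

lemma NMap.analyticAt (h : NMap N Pl) {z : ℂ} (hz : z ∉ Pl) : AnalyticAt ℂ N z :=
  DifferentiableOn.analyticAt (s := Plᶜ) (fun w hw => (h.diff w hw).differentiableWithinAt)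
    (h.plfin.isClosed.isOpen_compl.mem_nhds hz)

lemma NMap.covering (h : NMap N Pl) :
    IsCoveringMapOn (fun z : (Plᶜ : Set ℂ) => N z) {y | ∀ c ∉ Pl, deriv N c = 0 → N c ≠ y} := by
  have hcont : Continuous (fun z : (Plᶜ : Set ℂ) => N z) := by
    rw [continuous_iff_continuousAt]
    rintro ⟨z, hz⟩
    exact (h.cont hz).comp continuous_subtype_val.continuousAt
  have hprop : IsProperMap (fun z : (Plᶜ : Set ℂ) => N z) := by
    rw [isProperMap_iff_isCompact_preimage]
    refine ⟨hcont, fun K hK => ?_⟩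
    rw [Subtype.isCompact_iff]
    have : (Subtype.val '' ((fun z : (Plᶜ : Set ℂ) => N z) ⁻¹' K)) = {z | z ∉ Pl ∧ N z ∈ K} := by
      ext z; constructor
      · rintro ⟨⟨z, hz⟩, h1, rfl⟩; exact ⟨hz, h1⟩
      · rintro ⟨hz, h1⟩; exact ⟨⟨z, hz⟩, h1, rfl⟩
    rw [this]
    obtain ⟨R, hR⟩ := hK.isBounded.exists_norm_le
    refine Metric.isCompact_of_isClosed_isBounded ?_ ?_
    · rw [← isSeqClosed_iff_isClosed]
      intro u x hu hux
      have hx : x ∉ Pl := by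
        intro hp
        have h1 := h.pole x hp (Ioi_mem_atTop R)
        rw [mem_map, mem_nhdsWithin] at h1
        obtain ⟨V, hVo, hxV, hV⟩ := h1
        obtain ⟨n, hn⟩ := (hux.eventually (hVo.mem_nhds hxV)).exists
        exact absurd (hR _ (hu n).2) (not_le.2 (hV ⟨hn, fun e => (hu n).1 (by rw [show u n = x from e]; exact hp)⟩))
      exact ⟨hx, hK.isClosed.mem_of_tendsto ((h.cont hx).tendsto.comp hux) (Eventually.of_forall fun n => (hu n).2)⟩
    · have h1 := h.inf (Ioi_mem_atTop R)
      rw [mem_map] at h1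
      have h2 : Bornology.IsBounded ((fun z => ‖N z‖) ⁻¹' Ioi R)ᶜ := Bornology.isBounded_def.2 (by simpa using h1)
      exact h2.subset fun z hz hz' => absurd (hR _ hz.2) (not_le.2 hz')
  have hloc : IsLocalHomeomorphOn (fun z : (Plᶜ : Set ℂ) => N z)
      ((fun z : (Plᶜ : Set ℂ) => N z) ⁻¹' {y | ∀ c ∉ Pl, deriv N c = 0 → N c ≠ y}) := by
    have h1 : IsLocalHomeomorphOn N {z | z ∉ Pl ∧ deriv N z ≠ 0} := by
      intro z hz
      have := (h.analyticAt hz.1).hasStrictDerivAt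
      exact ⟨_, (this.hasStrictFDerivAt_equiv hz.2).mem_toOpenPartialHomeomorph_source, by simp⟩
    have h2 : IsLocalHomeomorph (Subtype.val : (Plᶜ : Set ℂ) → ℂ) :=
      (h.plfin.isClosed.isOpen_compl.isOpenEmbedding_subtypeVal).isLocalHomeomorph
    exact h1.comp h2.isLocalHomeomorphOn fun z hz => ⟨z.2, fun h0 => hz z z.2 h0 rfl⟩
  refine hprop.isClosedMap.isCoveringMapOn_of_isLocalHomeomorphOn (fun y hy => ?_) hloc
  refine (hprop.isCompact_preimage isCompact_singleton).finite
    (.of_openPartialHomeomorph _ subset_rfl fun e he => ?_)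
  obtain ⟨φ, h1, h2⟩ := hloc e (by
    rw [mem_preimage, mem_singleton_iff] at he; rw [mem_preimage, he]; exact hy)
  exact ⟨φ, h1, h2.symm⟩

lemma NMap.lift (h : NMap N Pl) {B : Set ℂ} (hBc : Convex ℝ B) (hBo : IsOpen B) {γ : ℂ → ℂ}
    (hγ : DifferentiableOn ℂ γ B) (hcv : ∀ b ∈ B, ∀ c ∉ Pl, deriv N c = 0 → N c ≠ γ b) {b0 z0 : ℂ}
    (hb0 : b0 ∈ B) (hz : z0 ∉ Pl) (hNz : N z0 = γ b0) :
    ∃ g : ℂ → ℂ, DifferentiableOn ℂ g B ∧ g b0 = z0 ∧ ∀ b ∈ B, g b ∉ Pl ∧ N (g b) = γ b := by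
  have h1 : SimplyConnectedSpace B := simply_of_convex hBc ⟨b0, hb0⟩
  have h2 := hBo.locallyPathConnectedSpace
  obtain ⟨F, ⟨hF0, hF⟩, -⟩ := h.covering.existsUnique_continuousMap_lifts
    ⟨B.domRestrict γ, continuousOn_iff_continuous_domRestrict.mp hγ.continuousOn⟩
    (e₀ := (⟨z0, hz⟩ : (Plᶜ : Set ℂ))) (a₀ := ⟨b0, hb0⟩) hNz
    (fun x => hcv x x.2)
  obtain ⟨g, hg⟩ : ∃ g : ℂ → ℂ, ∀ z : B, g z = F z := by
    classical
    exact ⟨fun z ↦ if hz : z ∈ B then F ⟨z, hz⟩ else 0, by simp⟩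
  have hN : ∀ b ∈ B, g b ∉ Pl ∧ N (g b) = γ b := fun b hb => by
    rw [hg ⟨b, hb⟩]
    exact ⟨(F ⟨b, hb⟩).2, congrFun hF ⟨b, hb⟩⟩
  have hgc : ContinuousOn g B := by
    rw [continuousOn_iff_continuous_domRestrict]
    have : B.domRestrict g = fun b => (F b : ℂ) := by ext z; exact hg z
    rw [this]
    exact continuous_subtype_val.comp F.continuous
  refine ⟨g, fun b hb => ?_, ?_, hN⟩
  · have hgb := hN b hb
    have hd : deriv N (g b) ≠ 0 := fun h0 => hcv b hb _ hgb.1 h0 hgb.2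
    have hs := (h.analyticAt hgb.1).hasStrictDerivAt
    have hli := hs.eventually_left_inverse hd
    have hinv := (hs.to_localInverse hd).hasDerivAt.differentiableAt
    have h3 : ∀ᶠ x in 𝓝 b, hs.localInverse _ _ _ hd (γ x) = g x := by
      have h4 : Tendsto g (𝓝 b) (𝓝 (g b)) := (hgc.continuousAt (hBo.mem_nhds hb))
      filter_upwards [h4.eventually hli, hBo.mem_nhds hb] with x hx hxB
      rw [← (hN x hxB).2, hx]
    rw [hgb.2] at hinv
    exact ((hinv.comp b (hγ.differentiableAt (hBo.mem_nhds hb))).congr_of_eventuallyEq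
      (h3.mono fun x hx => hx.symm)).differentiableWithinAt
  · exact (hg ⟨b0, hb0⟩).trans (congrArg Subtype.val hF0)

lemma DynR.front_pre (h : DynR N Pl ξ r) {n : ℕ} (hC : IsPreconnected (closure (Dn N ξ r n))ᶜ) :
    IsPreconnected (Imm N ξ \ closure (Dn N ξ r n)) := by
  have hFc : frontier (Dn N ξ r n) ⊆ closure (closure (Dn N ξ r n))ᶜ := fun c hc => by
    rw [mem_closure_iff_nhds]
    intro t ht
    obtain ⟨O, -, hOt, -, -, ⟨z, hz⟩, -⟩ := h.local_str hc ht
    exact ⟨z, hOt hz.1, hz.2⟩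
  refine compl_pre h.isOpen_imm h.imm_pre (h.dn_open n) ⟨ξ, h.dn_mem n⟩ (h.dn_closure n).2 ?_ hFc ?_
  · have h1 : frontier (Dn N ξ r n) = closure (Dn N ξ r n) ∩ closure (closure (Dn N ξ r n))ᶜ := by
      refine Subset.antisymm (fun c hc => ⟨frontier_subset_closure hc, hFc hc⟩) fun c hc => ?_
      refine ⟨hc.1, fun h2 => ?_⟩
      have h3 := closure_mono (compl_subset_compl.2 (subset_closure (s := Dn N ξ r n))) hc.2
      rw [closure_compl] at h3
      exact h3 h2
    rw [h1]
    refine unicoherent isClosed_closure isClosed_closure (h.dn_pre n).closure hC.closure ?_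
    ext z; simp only [mem_union, mem_univ, iff_true]
    by_cases hz : z ∈ closure (Dn N ξ r n)
    · exact Or.inl hz
    · exact Or.inr (subset_closure hz)
  · intro c hc
    obtain ⟨O, h1, -, h2, h3, h4, -⟩ := h.local_str hc univ_mem
    exact ⟨O, h1, h2, h3, h4⟩

end NewtonPf
end

section
open Complex Metric Set Filter Topology

namespace NewtonPf

variable {N : ℂ → ℂ} {Pl : Set ℂ} {ξ : ℂ} {r : ℝ}

lemma pre_frontier {s t : Set ℂ} (hs : IsPreconnected s) (h1 : (s ∩ t).Nonempty)
    (h2 : (s ∩ tᶜ).Nonempty) : (s ∩ frontier t).Nonempty := by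
  by_contra hne
  rw [not_nonempty_iff_eq_empty, Set.eq_empty_iff_forall_notMem] at hne
  obtain ⟨x, hx, hxt⟩ := h1
  obtain ⟨y, hy, hyt⟩ := h2
  have key : ∀ z ∈ s, z ∉ interior t → z ∉ closure t := fun z hz h3 h4 => hne z ⟨hz, h4, h3⟩
  obtain ⟨z, _, hz1, hz2⟩ := hs (interior t) (closure t)ᶜ isOpen_interior isClosed_closure.isOpen_compl
    (fun z hz => by
      by_cases h3 : z ∈ interior t
      · exact Or.inl h3
      · exact Or.inr (key z hz h3))
    ⟨x, hx, by_contra fun h3 => key x hx h3 (subset_closure hxt)⟩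
    ⟨y, hy, key y hy fun h3 => hyt (interior_subset h3)⟩
  exact hz2 (subset_closure (interior_subset hz1))

/-- points of the fibre of `N^[j]` whose orbit stays in `H` before time `j` -/
def Fib (N : ℂ → ℂ) (H : Set ℂ) (j : ℕ) (y : ℂ) : Set ℂ := {z | (∀ i < j, N^[i] z ∈ H) ∧ N^[j] z = y}

lemma fib_zero {H : Set ℂ} {y z : ℂ} : z ∈ Fib N H 0 y ↔ z = y := by
  simp [Fib]

lemma fib_succ {H : Set ℂ} {j : ℕ} {y z : ℂ} : z ∈ Fib N H (j + 1) y ↔ z ∈ H ∧ N z ∈ Fib N H j y := by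
  constructor
  · rintro ⟨h1, h2⟩
    exact ⟨h1 0 (by omega), fun i hi => h1 (i + 1) (by omega), h2⟩
  · rintro ⟨h0, h1, h2⟩
    refine ⟨fun i hi => ?_, h2⟩
    cases i with
    | zero => exact h0
    | succ i => exact h1 i (by omega)

/-- transport relation -/
def Tr (N : ℂ → ℂ) (H : Set ℂ) (y y' : ℂ) : Prop := ∃ τ : ℕ → ℂ → ℂ,
  (∀ ε > 0, ∀ᶠ j in atTop, ∀ z ∈ Fib N H j y, ‖τ j z - z‖ ≤ ε) ∧
  (∀ j, ∀ z ∈ Fib N H j y, τ j z ∈ Fib N H j y') ∧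
  (∀ j, ∀ z ∈ Fib N H (j + 1) y, N (τ (j + 1) z) = τ j (N z))

lemma Tr.trans {H : Set ℂ} {x y z : ℂ} (h1 : Tr N H x y) (h2 : Tr N H y z) : Tr N H x z := by
  obtain ⟨τ, a1, a2, a3⟩ := h1
  obtain ⟨σ, b1, b2, b3⟩ := h2
  refine ⟨fun j w => σ j (τ j w), fun ε hε => ?_, fun j w hw => b2 j _ (a2 j w hw), fun j w hw => ?_⟩
  · filter_upwards [a1 (ε / 2) (by positivity), b1 (ε / 2) (by positivity)] with j h1 h2 w hw
    have := norm_add_le (σ j (τ j w) - τ j w) (τ j w - w)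
    rw [sub_add_sub_cancel] at this
    linarith [h1 w hw, h2 _ (a2 j w hw)]
  · rw [b3 j _ (a2 _ w hw), a3 j w hw]

lemma Dyn.branches (h : Dyn N Pl ξ) {H L B : Set ℂ} (hHo : IsOpen H) (hHf : ∀ z ∈ frontier H, N z ∈ L)
    (hHL : ∀ z ∈ H, z ∉ L) (hBc : Convex ℝ B) (hBo : IsOpen B) (hBb : B ⊆ Bas N ξ)
    (hBL : ∀ b ∈ B, b ∉ L) (hPC : ∀ b ∈ B, ∀ c ∉ Pl, deriv N c = 0 → ∀ m, N^[m + 1] c ≠ b) {y : ℂ}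
    (hy : y ∈ B) :
    ∃ G : ℕ → ℂ → ℂ → ℂ, (∀ j, ∀ z ∈ Fib N H j y, DifferentiableOn ℂ (G j z) B ∧ G j z y = z ∧
        ∀ b ∈ B, G j z b ∈ Fib N H j b) ∧
      ∀ j, ∀ z ∈ Fib N H (j + 1) y, ∀ b ∈ B, N (G (j + 1) z b) = G j (N z) b := by
  set P : ℕ → ℂ → (ℂ → ℂ) → Prop := fun j z g => DifferentiableOn ℂ g B ∧ g y = z ∧
        ∀ b ∈ B, g b ∈ Fib N H j b with hP
  have step : ∀ j z g, ∃ g' : ℂ → ℂ, z ∈ Fib N H (j + 1) y → P j (N z) g →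
      P (j + 1) z g' ∧ ∀ b ∈ B, N (g' b) = g b := by
    intro j z g
    by_cases hz : z ∈ Fib N H (j + 1) y
    swap
    · exact ⟨id, fun h => absurd h hz⟩
    by_cases hg : P j (N z) g
    swap
    · exact ⟨id, fun _ h => absurd h hg⟩
    obtain ⟨hgd, hgy, hgb⟩ := hg
    have hzp : z ∉ Pl := h.bas_pl ((bas_iter (j + 1)).1 (by rw [hz.2]; exact hBb hy))
    obtain ⟨g', h1, h2, h3⟩ := h.lift hBc hBo hgd (fun b hb c hc hc0 hcb => hPC b hb c hc hc0 j (by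
      rw [Function.iterate_succ_apply, hcb, (hgb b hb).2])) hy hzp hgy.symm
    refine ⟨g', fun _ _ => ⟨⟨h1, h2, fun b hb => ?_⟩, fun b hb => (h3 b hb).2⟩⟩
    rw [fib_succ, (h3 b hb).2]
    refine ⟨?_, hgb b hb⟩
    have hpre : IsPreconnected (g' '' B) := hBc.isPreconnected.image _ h1.continuousOn
    by_contra hbH
    obtain ⟨w, ⟨b', hb', rfl⟩, hw⟩ := pre_frontier hpre
      ⟨z, ⟨y, hy, h2⟩, (fib_succ.1 hz).1⟩ ⟨_, ⟨b, hb, rfl⟩, hbH⟩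
    have h4 := hHf _ hw
    rw [(h3 b' hb').2] at h4
    have h5 := hgb b' hb'
    cases j with
    | zero => rw [fib_zero.1 h5] at h4; exact hBL b' hb' h4
    | succ j => exact hHL _ (fib_succ.1 h5).1 h4
  choose S hS using step
  refine ⟨fun j => Nat.rec (fun _ => id) (fun j Gj z => S j z (Gj (N z))) j, ?_, ?_⟩
  · intro j
    induction j with
    | zero =>
      intro z hz
      exact ⟨differentiableOn_id, (fib_zero.1 hz).symm, fun b hb => fib_zero.2 rfl⟩
    | succ j ih =>
      intro z hz
      exact (hS j z _ hz (ih (N z) (fib_succ.1 hz).2)).1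
  · intro j z hz b hb
    have : ∀ j, ∀ z ∈ Fib N H j y, P j z ((Nat.rec (fun _ => id) (fun j Gj z => S j z (Gj (N z))) j : ℂ → ℂ → ℂ) z) := by
      intro j
      induction j with
      | zero =>
        intro z hz
        exact ⟨differentiableOn_id, (fib_zero.1 hz).symm, fun b hb => fib_zero.2 rfl⟩
      | succ j ih =>
        intro z hz
        exact (hS j z _ hz (ih (N z) (fib_succ.1 hz).2)).1
    exact (hS j z _ hz (this j (N z) (fib_succ.1 hz).2)).2 b hb

open MeasureTheory in
lemma Dyn.tr_local (h : Dyn N Pl ξ) {H L : Set ℂ} {y0 : ℂ} {ρ : ℝ} (hρ : 0 < ρ) (hHo : IsOpen H)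
    (hHb : Bornology.IsBounded H)
    (hHf : ∀ z ∈ frontier H, N z ∈ L)
    (hHL : ∀ z ∈ H, z ∉ L) (hBb : ball y0 ρ ⊆ Bas N ξ)
    (hBL : ∀ b ∈ ball y0 ρ, b ∉ L)
    (hPC : ∀ b ∈ ball y0 ρ, ∀ c ∉ Pl, deriv N c = 0 → ∀ m, N^[m + 1] c ≠ b)
    (hW : ∀ b ∈ ball y0 ρ, ∀ m, N^[m + 1] b ∉ ball y0 ρ) {y y' : ℂ}
    (hy : y ∈ ball y0 (ρ / 2)) (hy' : y' ∈ ball y0 (ρ / 2)) : Tr N H y y' := by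
  have hsub : ball y0 (ρ / 2) ⊆ ball y0 ρ := ball_subset_ball (by linarith)
  obtain ⟨G, hG1, hG2⟩ := h.branches hHo hHf hHL (convex_ball y0 ρ) isOpen_ball hBb hBL hPC (hsub hy)
  have hinj : ∀ j, ∀ z ∈ Fib N H j y, InjOn (G j z) (ball y0 ρ) := fun j z hz a ha b hb hab => by
    rw [← ((hG1 j z hz).2.2 a ha).2, hab, ((hG1 j z hz).2.2 b hb).2]
  have hfin : ∀ ε > 0, {j | 1 ≤ j ∧ ∃ z ∈ Fib N H j y, ∃ b ∈ ball y0 (ρ / 2), ε < ‖deriv (G j z) b‖}.Finite := by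
    intro ε hε
    set S := {j | 1 ≤ j ∧ ∃ z ∈ Fib N H j y, ∃ b ∈ ball y0 (ρ / 2), ε < ‖deriv (G j z) b‖}
    choose z hz b hb hd using fun j : S => j.2.2
    have hfin := Measure.finite_const_le_meas_of_disjoint_iUnion (volume : Measure ℂ)
      (ε := ENNReal.ofReal (Real.pi * (ρ / 2) ^ 2 * ε ^ 2)) (by
        rw [ENNReal.ofReal_pos]; positivity) (As := fun j : S => G j (z j) '' ball y0 ρ)
      (fun j => (isOpen_image_of_injOn isOpen_ball (hG1 _ _ (hz j)).1 (hinj _ _ (hz j))).measurableSet) (by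
        have hlt : ∀ j k : S, (j : ℕ) < k → Disjoint (G j (z j) '' ball y0 ρ) (G k (z k) '' ball y0 ρ) := by
          intro j k hjk
          rw [Set.disjoint_left]
          rintro _ ⟨a, ha, rfl⟩ ⟨a', ha', he⟩
          have h1 := ((hG1 j _ (hz j)).2.2 a ha).2
          have h2 := ((hG1 k _ (hz k)).2.2 a' ha').2
          obtain ⟨m, hm⟩ := Nat.exists_eq_add_of_lt hjk
          rw [he, show (k : ℕ) = (m + 1) + j by omega, Function.iterate_add_apply, h1] at h2
          exact hW a ha m (h2 ▸ ha')
        intro j k hjk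
        rcases lt_or_gt_of_ne (fun e => hjk (Subtype.ext e) : (j : ℕ) ≠ k) with h1 | h1
        · exact hlt j k h1
        · exact (hlt k j h1).symm)
      (by
        refine ne_top_of_le_ne_top hHb.measure_lt_top.ne (measure_mono (iUnion_subset fun j => ?_))
        rintro _ ⟨a, ha, rfl⟩
        exact ((hG1 j _ (hz j)).2.2 a ha).1 0 j.2.1)
    have huniv : {j : S | ENNReal.ofReal (Real.pi * (ρ / 2) ^ 2 * ε ^ 2) ≤ volume (G j (z j) '' ball y0 ρ)} = univ := by
      ext j; simp only [mem_ofPred_eq, mem_univ, iff_true]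
      have hsb : ball (b j) (ρ / 2) ⊆ ball y0 ρ := by
        refine ball_subset_ball' ?_
        have := hb j; rw [mem_ball] at this; linarith
      have := area_bound (c := b j) (half_pos hρ) ((hG1 _ _ (hz j)).1.mono hsb) ((hinj _ _ (hz j)).mono hsb)
      refine le_trans (ENNReal.ofReal_le_ofReal ?_) (this.trans (measure_mono (image_mono hsb)))
      gcongr
      exact (hd j).le
    rw [huniv] at hfin
    exact Set.finite_coe_iff.1 (Set.finite_univ_iff.1 hfin)
  refine ⟨fun j z => G j z y', fun ε hε => ?_, fun j z hz => (hG1 j z hz).2.2 y' (hsub hy'),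
    fun j z hz => hG2 j z hz y' (hsub hy')⟩
  have h1 := (hfin (ε / ρ) (by positivity)).eventually_cofinite_notMem
  rw [Nat.cofinite_eq_atTop] at h1
  filter_upwards [h1, eventually_ge_atTop 1] with j hj hj1 z hz
  have h2 : ∀ b ∈ ball y0 (ρ / 2), ‖deriv (G j z) b‖ ≤ ε / ρ := fun b hb => by
    by_contra hcon
    exact hj ⟨hj1, z, hz, b, hb, not_le.1 hcon⟩
  have h3 := (convex_ball y0 (ρ / 2)).norm_image_sub_le_of_norm_deriv_le (fun x hx =>
    (hG1 j z hz).1.differentiableAt (isOpen_ball.mem_nhds (hsub hx))) h2 hy hy'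
  rw [(hG1 j z hz).2.1] at h3
  refine h3.trans ?_
  have h4 : ‖y' - y‖ ≤ ρ := by
    have h5 := dist_triangle y' y0 y
    rw [mem_ball] at hy hy'
    rw [dist_comm y0 y, dist_eq_norm] at h5
    linarith
  calc ε / ρ * ‖y' - y‖ ≤ ε / ρ * ρ := by gcongr
    _ = ε := by field_simp

lemma DynR.tr_false (h : DynR N Pl ξ r) {H : Set ℂ} (hHb : Bornology.IsBounded H)
    (hHr : ∀ z ∈ H, z ∉ ball ξ r) {x1 : ℂ} (h1 : x1 ∈ H) (hb : x1 ∈ Bas N ξ) (ht : Tr N H (N x1) x1) : False := by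
  obtain ⟨τ, a1, a2, a3⟩ := ht
  set x : ℕ → ℂ := fun j => Nat.rec (N x1) (fun j w => τ j w) j with hx
  have hs : ∀ j, x (j + 1) = τ j (x j) := fun j => rfl
  have hfib : ∀ j, x j ∈ Fib N H j (N x1) ∧ N (x (j + 1)) = x j := by
    intro j
    induction j with
    | zero =>
      have h0 : x 0 ∈ Fib N H 0 (N x1) := fib_zero.2 rfl
      refine ⟨h0, ?_⟩
      rw [hs, fib_zero.1 (a2 0 _ h0)]
      rfl
    | succ j ih =>
      have h0 : x (j + 1) ∈ Fib N H (j + 1) (N x1) := by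
        have h2 := a2 j _ ih.1
        rw [← hs] at h2
        refine ⟨fun i hi => ?_, ?_⟩
        · rcases Nat.lt_succ_iff_lt_or_eq.1 hi with h3 | h3
          · exact h2.1 i h3
          · rw [h3, h2.2]; exact h1
        · rw [Function.iterate_succ_apply', h2.2]
      refine ⟨h0, ?_⟩
      rw [hs (j + 1), a3 j _ h0, ih.2, ← hs]
  have hH : ∀ j, x (j + 1) ∈ H := fun j => (fib_succ.1 (hfib (j + 1)).1).1
  have hxb : ∀ j, x j ∈ Bas N ξ := fun j => (bas_iter j).1 (by rw [(hfib j).1.2]; exact bas_iff.2 hb)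
  obtain ⟨a, -, φ, hφ, hlim⟩ := tendsto_subseq_of_bounded hHb hH
  have hdiff : Tendsto (fun j => x (j + 1) - x j) atTop (𝓝 0) := by
    rw [Metric.tendsto_nhds]
    intro ε hε
    filter_upwards [a1 (ε / 2) (by positivity)] with j hj
    rw [dist_zero_right]
    have := hj _ (hfib j).1
    rw [← hs] at this
    linarith
  have hφt := hφ.tendsto_atTop
  have hlim2 : Tendsto (fun k => x (φ k + 1 + 1)) atTop (𝓝 a) := by
    have h2 := (hdiff.comp ((tendsto_add_atTop_nat 1).comp hφt)).add hlim
    rw [zero_add] at h2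
    refine h2.congr fun k => ?_
    simp
  have hap : a ∉ Pl := by
    intro hp
    have h2 := h.pole a hp
    have h3 : Tendsto (fun k => x (φ k + 1 + 1)) atTop (𝓝[≠] a) :=
      tendsto_nhdsWithin_iff.2 ⟨hlim2, Eventually.of_forall fun k e => h.bas_pl (hxb (φ k + 1 + 1)) (by
        rw [show x (φ k + 1 + 1) = a from e]; exact hp)⟩
    have h4 := h2.comp h3
    have h5 : Tendsto (fun k => ‖x (φ k + 1)‖) atTop atTop := by
      refine h4.congr fun k => ?_
      simp only [Function.comp, (hfib (φ k + 1)).2]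
    exact not_tendsto_atTop_of_tendsto_nhds hlim.norm h5
  have hfix : N a = a := by
    have h2 := (h.cont hap).tendsto.comp hlim2
    refine tendsto_nhds_unique h2 (hlim.congr fun k => ?_)
    simp only [Function.comp, (hfib (φ k + 1)).2]
  obtain ⟨s, hs0, κ, h0, hκ, hc⟩ := h.attr hap hfix
  obtain ⟨k, hk⟩ := (hlim.eventually (closedBall_mem_nhds a hs0)).exists
  have h2 := tendsto_of_contr h0 hκ (fun z hz => (hc z hz).2) hk
  have h3 : a = ξ := tendsto_nhds_unique h2 (hxb (φ k + 1))
  obtain ⟨k, hk⟩ := (hlim.eventually (ball_mem_nhds a h.rpos)).exists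
  exact hHr _ (hH (φ k)) (h3 ▸ hk)

end NewtonPf
end

section
open Complex Metric Set Filter Topology

namespace NewtonPf

variable {N : ℂ → ℂ} {Pl : Set ℂ} {ξ : ℂ} {r : ℝ}

/-- postcritical points outside the linearization ball -/
def PC (N : ℂ → ℂ) (Pl : Set ℂ) (ξ : ℂ) (r : ℝ) : Set ℂ :=
  {b | (∃ c ∉ Pl, deriv N c = 0 ∧ ∃ m, N^[m + 1] c = b) ∧ b ∈ Bas N ξ ∧ b ∉ ball ξ r}

lemma DynR.pc_fin (h : DynR N Pl ξ r) : (PC N Pl ξ r).Finite := by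
  have h1 : ∀ c, ∃ m0, c ∈ Bas N ξ → N^[m0] c ∈ ball ξ r := by
    intro c
    by_cases hc : c ∈ Bas N ξ
    · obtain ⟨m, hm⟩ := (hc.eventually (isOpen_ball.mem_nhds (mem_ball_self h.rpos))).exists
      exact ⟨m, fun _ => hm⟩
    · exact ⟨0, fun h => absurd h hc⟩
  choose m0 hm0 using h1
  refine (h.crit.biUnion fun c _ => ((finite_Iio (m0 c)).image (fun m => N^[m + 1] c))).subset ?_
  rintro b ⟨⟨c, hc, hc0, m, rfl⟩, hb, hr⟩
  refine mem_biUnion (x := c) ⟨hc, hc0⟩ ⟨m, ?_, rfl⟩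
  by_contra hm
  have hm : m0 c ≤ m + 1 := by simp at hm; omega
  exact hr (h.iter_ball hm (hm0 c ((bas_iter _).1 hb)))

lemma DynR.nonreturn (h : DynR N Pl ξ r) {Y : Set ℂ} (hY : IsOpen Y) (hYb : Y ⊆ Bas N ξ)
    (hYr : ∀ y ∈ Y, y ∉ ball ξ r) {y : ℂ} (hy : y ∈ Y) :
    ∃ ρ > 0, ball y ρ ⊆ Y ∧ ∀ b ∈ ball y ρ, ∀ m, N^[m + 1] b ∉ ball y ρ := by
  obtain ⟨m0, hm0⟩ := ((hYb hy).eventually (isOpen_ball.mem_nhds (mem_ball_self h.rpos))).exists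
  have h1 : ∀ m, ∃ W ∈ 𝓝 y, ∀ b ∈ W, N^[m + 1] b ∉ W := by
    intro m
    have hne : N^[m + 1] y ≠ y := by
      intro he
      have h2 : ∀ k, N^[(m + 1) * k] y = y := by
        intro k
        rw [Function.iterate_mul]
        exact Function.iterate_fixed he k
      have h3 : Tendsto (fun k => N^[(m + 1) * k] y) atTop (𝓝 ξ) :=
        Tendsto.comp (hYb hy) (tendsto_atTop_mono (fun k => Nat.le_mul_of_pos_left k (Nat.succ_pos m)) tendsto_id)
      simp only [h2] at h3
      exact hYr y hy (tendsto_nhds_unique tendsto_const_nhds h3 ▸ mem_ball_self h.rpos)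
    obtain ⟨u, v, hu, hv, hyu, hyv, hd⟩ := t2_separation hne
    refine ⟨v ∩ N^[m + 1] ⁻¹' u, inter_mem (hv.mem_nhds hyv)
      ((h.iter_diff (hYb hy) (m + 1)).continuousAt.preimage_mem_nhds (hu.mem_nhds hyu)), ?_⟩
    intro b hb hb'
    exact disjoint_left.1 hd hb.2 hb'.1
  choose W hW hW' using h1
  have h2 : (⋂ m ∈ Iio m0, W m) ∈ 𝓝 y := (Filter.biInter_mem (finite_Iio m0)).2 fun m _ => hW m
  have h3 : N^[m0] ⁻¹' ball ξ r ∈ 𝓝 y :=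
    (h.iter_diff (hYb hy) m0).continuousAt.preimage_mem_nhds (isOpen_ball.mem_nhds hm0)
  obtain ⟨ρ, hρ, hs⟩ := Metric.mem_nhds_iff.1 (inter_mem (inter_mem h2 h3) (hY.mem_nhds hy))
  refine ⟨ρ, hρ, fun b hb => (hs hb).2, fun b hb m hm => ?_⟩
  by_cases hlt : m < m0
  · exact hW' m b (mem_iInter₂.1 (hs hb).1.1 m hlt) (mem_iInter₂.1 (hs hm).1.1 m hlt)
  · exact hYr _ (hs hm).2 (h.iter_ball (by omega) (hs hb).1.2)

lemma DynR.compl_succ (h : DynR N Pl ξ r) {n : ℕ} (hC : IsPreconnected (closure (Dn N ξ r n))ᶜ) :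
    IsPreconnected (closure (Dn N ξ r (n + 1)))ᶜ := by
  set T := (closure (Dn N ξ r (n + 1)))ᶜ with hT
  have hTo : IsOpen T := isClosed_closure.isOpen_compl
  obtain ⟨R, hR0, hR⟩ := (h.dn_closure (n + 1)).1.isBounded.subset_closedBall_lt 0 0
  have hbig : ((R + 1 : ℝ) : ℂ) ∈ (closedBall (0 : ℂ) R)ᶜ := by
    simp only [mem_compl_iff, mem_closedBall, dist_zero_right, norm_real, Real.norm_eq_abs, not_le]
    rw [abs_of_pos (by linarith)]; linarith
  have hRT : (closedBall (0 : ℂ) R)ᶜ ⊆ T := compl_subset_compl.2 hR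
  set big : ℂ := ((R + 1 : ℝ) : ℂ)
  set Ti := connectedComponentIn T big with hTi
  have hTio : IsOpen Ti := hTo.connectedComponentIn
  have hRTi : (closedBall (0 : ℂ) R)ᶜ ⊆ Ti := (compl_cball 0 hR0).subset_connectedComponentIn hbig hRT
  set H := T \ Ti with hH
  have hHo : IsOpen H := by
    rw [isOpen_iff_mem_nhds]
    intro z hz
    refine mem_of_superset (hTo.connectedComponentIn.mem_nhds (mem_connectedComponentIn hz.1)) ?_
    intro w hw
    refine ⟨connectedComponentIn_subset _ _ hw, fun hw' => hz.2 ?_⟩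
    have e1 := connectedComponentIn_eq hw
    have e2 := connectedComponentIn_eq hw'
    rw [hTi, e2, ← e1]
    exact mem_connectedComponentIn hz.1
  have hHb : Bornology.IsBounded H := isBounded_closedBall.subset (fun z hz => by
    by_contra hz'
    exact hz.2 (hRTi hz') : H ⊆ closedBall (0 : ℂ) R)
  have hHF : frontier H ⊆ closure (Dn N ξ r (n + 1)) := by
    intro z hz
    rw [hHo.frontier_eq] at hz
    by_contra hzT
    have hzi : z ∈ Ti := by
      by_contra h1
      exact hz.2 ⟨hzT, h1⟩
    obtain ⟨w, hw1, hw2⟩ := mem_closure_iff.1 hz.1 _ hTio hzi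
    exact hw2.2 hw1
  have hDc : closure (Dn N ξ r n) ⊆ closure (Dn N ξ r (n + 1)) := closure_mono (h.dn_mono (by omega))
  have hball : ball ξ r ⊆ closure (Dn N ξ r n) := by
    rw [← h.dn_zero]; exact (h.dn_mono (Nat.zero_le n)).trans subset_closure
  by_contra hnp
  have hHne : H.Nonempty := by
    by_contra hne
    refine hnp ?_
    have : T = Ti := Subset.antisymm (fun z hz => by
      by_contra h1; exact hne ⟨z, hz, h1⟩) (connectedComponentIn_subset _ _)
    rw [this]; exact isPreconnected_connectedComponentIn
  obtain ⟨c, hc⟩ := nonempty_frontier_iff.2 ⟨hHne, fun hu => by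
    have : big ∈ H := hu ▸ mem_univ _
    exact this.2 (hRTi hbig)⟩
  have hcD : c ∈ frontier (Dn N ξ r (n + 1)) := by
    rw [(h.dn_open _).frontier_eq]
    refine ⟨hHF hc, fun hcD => ?_⟩
    obtain ⟨w, hw1, hw2⟩ := mem_closure_iff.1 (frontier_subset_closure hc) _ (h.dn_open _) hcD
    exact hw2.1 (subset_closure hw1)
  obtain ⟨O, hO, -, hOU, -, -, hOd⟩ := h.local_str hcD univ_mem
  obtain ⟨w, hwO, hwH⟩ := mem_closure_iff.1 (frontier_subset_closure hc) _ isOpen_interior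
    (mem_interior_iff_mem_nhds.2 hO)
  have hVo : IsOpen (interior O ∩ H) := isOpen_interior.inter hHo
  have hVinf : (interior O ∩ H).Infinite := infinite_of_mem_nhds w (hVo.mem_nhds ⟨hwO, hwH⟩)
  obtain ⟨z, hz, hzc⟩ := hVinf.exists_notMem_finite h.crit
  have hzU : z ∈ Imm N ξ := hOU (interior_subset hz.1)
  have hd : deriv N z ≠ 0 := fun h0 => hzc ⟨h.imm_pl hzU, h0⟩
  have hst : HasStrictDerivAt N (deriv N z) z := (h.analyticAt (h.imm_pl hzU)).hasStrictDerivAt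
  have hnb : N '' (interior O ∩ H) ∈ 𝓝 (N z) := by
    rw [← hst.map_nhds_eq hd]
    exact image_mem_map (hVo.mem_nhds hz)
  obtain ⟨_, ⟨x1, ⟨hx1O, hx1H⟩, rfl⟩, hx1P⟩ := (infinite_of_mem_nhds _ hnb).exists_notMem_finite h.pc_fin
  have hx1U : x1 ∈ Imm N ξ := hOU (interior_subset hx1O)
  have hx1n : r < ‖N^[n] (N x1) - ξ‖ := by
    by_contra hle
    exact hx1H.1 ((hOd x1 (interior_subset hx1O)).2 (not_lt.1 hle))
  have hNx1 : N x1 ∉ closure (Dn N ξ r n) := fun hcl => not_lt.2 (h.closure_dn_ball hcl) hx1n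
  set Y := (Imm N ξ \ closure (Dn N ξ r n)) \ PC N Pl ξ r with hY
  have hY1 : IsOpen (Imm N ξ \ closure (Dn N ξ r n)) := h.isOpen_imm.sdiff isClosed_closure
  have hYo : IsOpen Y := hY1.sdiff h.pc_fin.isClosed
  have hYp : IsPreconnected Y := diff_finite_pre hY1 (h.front_pre hC) h.pc_fin
  have hYr : ∀ y ∈ Y, y ∉ ball ξ r := fun y hy hb => hy.1.2 (hball hb)
  have hYb : Y ⊆ Bas N ξ := fun y hy => h.imm_bas hy.1.1
  have hm0 : N x1 ∈ Y := ⟨⟨h.imm_maps hx1U, hNx1⟩, hx1P⟩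
  have hm1 : x1 ∈ Y := by
    refine ⟨⟨hx1U, fun hcl => hx1H.1 (hDc hcl)⟩, fun hP => hx1P ?_⟩
    obtain ⟨⟨c, hc, hc0, m, hm⟩, -, -⟩ := hP
    refine ⟨⟨c, hc, hc0, m + 1, ?_⟩, hYb hm0, hYr _ hm0⟩
    rw [Function.iterate_succ_apply', hm]
  have hTr : Tr N H (N x1) x1 := by
    refine hYp.induction₂' (Tr N H) (fun y hy => ?_) (fun _ _ _ _ _ _ => Tr.trans) hm0 hm1
    obtain ⟨ρ, hρ, hρY, hρn⟩ := h.nonreturn hYo hYb hYr hy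
    have hloc : ∀ a ∈ ball y (ρ / 2), ∀ b ∈ ball y (ρ / 2), Tr N H a b := fun a ha b hb =>
      h.tr_local hρ hHo hHb (L := closure (Dn N ξ r n)) (fun z hz => h.closure_dn_maps (hHF hz))
        (fun z hz hcl => hz.1 (hDc hcl)) (fun b hb => hYb (hρY hb)) (fun b hb => (hρY hb).1.2)
        (fun b hb c hc hc0 m hm => (hρY hb).2 ⟨⟨c, hc, hc0, m, hm⟩, hYb (hρY hb), hYr _ (hρY hb)⟩)
        hρn ha hb
    filter_upwards [nhdsWithin_le_nhds (ball_mem_nhds y (half_pos hρ))] with b hb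
    exact ⟨hloc y (mem_ball_self (half_pos hρ)) b hb, hloc b hb y (mem_ball_self (half_pos hρ))⟩
  exact h.tr_false hHb (fun z hz hb => hz.1 (hDc (hball hb))) hx1H (h.imm_bas hx1U) hTr

lemma DynR.compl_dn (h : DynR N Pl ξ r) (n : ℕ) : IsPreconnected (closure (Dn N ξ r n))ᶜ := by
  induction n with
  | zero =>
    rw [h.dn_zero, closure_ball _ h.rpos.ne']
    exact compl_cball ξ h.rpos
  | succ n ih => exact h.compl_succ ih

lemma Dyn.riemann (h : Dyn N Pl ξ) {a₀ : ℂ} {δ : ℝ} (hδ : 0 < δ)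
    (hδU : ∀ z ∈ Imm N ξ, δ < ‖z - a₀‖) : ∃ f, Univ (Imm N ξ) ξ f ∧ f '' Imm N ξ = ball 0 1 := by
  obtain ⟨r, hr⟩ := h.exists_r
  refine rmt h.isOpen_imm h.imm_pre h.mem_imm (fun n => closure (Dn N ξ r n))
    (fun n => (hr.dn_closure n).1) (fun n => (hr.dn_closure n).2) (fun z hz => ?_)
    (fun n => hr.front_pre (hr.compl_dn n)) hδ hδU
  obtain ⟨n, hn⟩ := hr.exhaust hz
  refine ⟨Dn N ξ r n, (hr.dn_open n).mem_nhds hn, ?_⟩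
  filter_upwards [eventually_ge_atTop n] with m hm
  exact (hr.dn_mono hm).trans subset_closure

end NewtonPf
end

section
open Complex Metric Set Filter Topology MeasureTheory

namespace NewtonPf

/-- left half plane -/
def HP : Set ℂ := {w | w.re < 0}

lemma hp_open : IsOpen HP := isOpen_lt continuous_re continuous_const

/-- bounded function on the half plane, injective modulo `2 π i` -/
structure Bd (Φ : ℂ → ℂ) : Prop where
  diff : DifferentiableOn ℂ Φ HP
  bound : ∃ M, ∀ w ∈ HP, ‖Φ w‖ ≤ M
  inj : ∀ w ∈ HP, ∀ w' ∈ HP, Φ w = Φ w' → ∃ n : ℤ, w = w' + n * (2 * Real.pi * I)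

namespace Bd

variable {Φ : ℂ → ℂ}

lemma injOn (h : Bd Φ) {S : Set ℂ} (hS : S ⊆ HP) (hd : ∀ w ∈ S, ∀ w' ∈ S, |w.im - w'.im| < 2 * Real.pi) :
    InjOn Φ S := by
  intro w hw w' hw' he
  obtain ⟨n, hn⟩ := h.inj w (hS hw) w' (hS hw') he
  have h1 := hd w hw w' hw'
  rw [hn] at h1
  simp only [add_im, mul_im, intCast_re, intCast_im, I_re, I_im, mul_re, ofReal_re, ofReal_im, re_ofNat, im_ofNat] at h1
  ring_nf at h1
  rw [abs_mul, abs_mul, abs_of_pos Real.pi_pos, abs_two] at h1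
  have h2 : |(n : ℝ)| < 1 := by nlinarith [Real.pi_pos]
  have h3 : n = 0 := by
    rw [← Int.cast_abs] at h2
    exact Int.abs_lt_one_iff.1 (by exact_mod_cast h2)
  rw [hn, h3]; simp

lemma image_open (h : Bd Φ) {S : Set ℂ} (hS : S ⊆ HP) (hSo : IsOpen S) : IsOpen (Φ '' S) := by
  rw [isOpen_iff_mem_nhds]
  rintro _ ⟨w, hw, rfl⟩
  obtain ⟨ρ, hρ, hs⟩ := Metric.isOpen_iff.1 hSo w hw
  set ρ' := min ρ 1
  have hsub : ball w ρ' ⊆ S := (ball_subset_ball (min_le_left _ _)).trans hs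
  have hi : InjOn Φ (ball w ρ') := by
    refine h.injOn (hsub.trans hS) fun a ha b hb => ?_
    have h1 : dist a b < 2 := by
      have := dist_triangle_right a b w
      have h2 : ρ' ≤ 1 := min_le_right _ _
      rw [mem_ball] at ha hb
      linarith
    rw [dist_eq_norm] at h1
    have := abs_im_le_norm (a - b)
    rw [sub_im] at this
    linarith [Real.pi_gt_three]
  exact mem_of_superset ((isOpen_image_of_injOn isOpen_ball (h.diff.mono (hsub.trans hS)) hi).mem_nhds
    ⟨w, mem_ball_self (by positivity), rfl⟩) (image_mono hsub)

lemma vol_small (h : Bd Φ) {ε : ENNReal} (hε : 0 < ε) :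
    ∃ δ > 0, volume (Φ '' {w | -δ < w.re ∧ w.re < 0}) < ε := by
  set S : ℕ → Set ℂ := fun n => {w | -(1 / (n + 1 : ℝ)) < w.re ∧ w.re < 0}
  have hSH : ∀ n, S n ⊆ HP := fun n w hw => hw.2
  have hSo : ∀ n, IsOpen (S n) := fun n =>
    (isOpen_lt continuous_const continuous_re).inter (isOpen_lt continuous_re continuous_const)
  have hmono : Antitone (fun n => Φ '' S n) := fun m n hmn => image_mono fun w hw =>
    ⟨lt_of_le_of_lt (neg_le_neg (one_div_le_one_div_of_le (by positivity) (by gcongr))) hw.1, hw.2⟩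
  obtain ⟨M, hM⟩ := h.bound
  have hfin : volume (Φ '' S 0) ≠ ⊤ := by
    refine ne_top_of_le_ne_top (measure_closedBall_lt_top (x := (0 : ℂ)) (r := M)).ne (measure_mono ?_)
    rintro _ ⟨w, hw, rfl⟩
    simpa using hM w hw.2
  have h1 := tendsto_measure_iInter_atTop (μ := volume) (s := fun n => Φ '' S n)
    (fun n => (h.image_open (hSH n) (hSo n)).measurableSet.nullMeasurableSet) hmono ⟨0, hfin⟩
  have h2 : (⋂ n, Φ '' S n) = ∅ := by
    rw [Set.eq_empty_iff_forall_notMem]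
    intro p hp
    rw [mem_iInter] at hp
    obtain ⟨w, hw, rfl⟩ := hp 0
    obtain ⟨n, hn⟩ := exists_nat_one_div_lt (show 0 < -w.re by linarith [hw.2])
    obtain ⟨w', hw', he⟩ := hp n
    obtain ⟨m, hm⟩ := h.inj w' hw'.2 w hw.2 he
    have : w'.re = w.re := by rw [hm]; simp
    have := hw'.1
    linarith
  rw [h2, measure_empty] at h1
  obtain ⟨n, hn⟩ := (h1.eventually (gt_mem_nhds hε)).exists
  exact ⟨1 / (n + 1 : ℝ), by positivity, hn⟩

lemma deriv_small (h : Bd Φ) {ε : ℝ} (hε : 0 < ε) :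
    ∃ δ > 0, ∀ w : ℂ, -δ < w.re → w.re < 0 → ‖deriv Φ w‖ * (-w.re) ≤ ε := by
  obtain ⟨δ, hδ, hv⟩ := h.vol_small (ε := ENNReal.ofReal (ε ^ 2 / 4)) (by simp; positivity)
  refine ⟨min (δ / 2) 1, by positivity, fun w hw hw0 => ?_⟩
  have hw1 : -w.re < δ / 2 := by linarith [min_le_left (δ / 2) 1]
  have hw2 : -w.re < 1 := by linarith [min_le_right (δ / 2) 1]
  have hsub : ball w (-w.re / 2) ⊆ {w | -δ < w.re ∧ w.re < 0} := by
    intro z hz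
    rw [mem_ball, dist_eq_norm] at hz
    have h1 := abs_re_le_norm (z - w)
    rw [sub_re] at h1
    have h2 := abs_lt.1 (lt_of_le_of_lt h1 hz)
    exact ⟨by linarith, by linarith⟩
  have hi : InjOn Φ (ball w (-w.re / 2)) := by
    refine h.injOn (fun z hz => (hsub hz).2) fun a ha b hb => ?_
    have h1 : dist a b < 1 := by
      have := dist_triangle_right a b w
      rw [mem_ball] at ha hb
      linarith
    rw [dist_eq_norm] at h1
    have := abs_im_le_norm (a - b)
    rw [sub_im] at this
    linarith [Real.pi_gt_three]
  have h1 := area_bound (by linarith) (h.diff.mono fun z hz => (hsub hz).2) hi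
  have h2 := (h1.trans (measure_mono (image_mono hsub))).trans hv.le
  rw [ENNReal.ofReal_le_ofReal_iff (by positivity)] at h2
  have h3 : (‖deriv Φ w‖ * (-w.re)) ^ 2 ≤ ε ^ 2 := by
    have h4 : (0 : ℝ) ≤ (-w.re / 2) ^ 2 * ‖deriv Φ w‖ ^ 2 := by positivity
    nlinarith [Real.pi_gt_three]
  exact le_of_sq_le_sq h3 hε.le

/-- oscillation at comparable points -/
lemma osc (h : Bd Φ) {C ε : ℝ} (hC : 0 < C) (hε : 0 < ε) :
    ∃ δ > 0, ∀ s, 0 < s → s < δ → ∀ w1 w2 : ℂ, w1.re ≤ -s → w2.re ≤ -s → ‖w1 - w2‖ ≤ C * s → w1.re > -δ →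
      w2.re > -δ → ‖Φ w1 - Φ w2‖ ≤ ε := by
  obtain ⟨δ, hδ, hv⟩ := h.deriv_small (ε := ε / C) (by positivity)
  refine ⟨δ, hδ, fun s hs hsδ w1 w2 h1 h2 h12 h3 h4 => ?_⟩
  set S : Set ℂ := {w | -δ < w.re} ∩ {w | w.re ≤ -s}
  have hS : Convex ℝ S := (convex_halfSpace_re_gt _).inter (convex_halfSpace_re_le _)
  have hd : ∀ w ∈ S, DifferentiableAt ℂ Φ w := fun w hw =>
    h.diff.differentiableAt (hp_open.mem_nhds (by have : w.re ≤ -s := hw.2; show w.re < 0; linarith))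
  have hb : ∀ w ∈ S, ‖deriv Φ w‖ ≤ ε / C / s := by
    intro w hw
    have hw2 : w.re ≤ -s := hw.2
    rw [le_div_iff₀ hs]
    refine le_trans ?_ (hv w hw.1 (by linarith))
    gcongr
    linarith
  have := hS.norm_image_sub_le_of_norm_deriv_le hd hb ⟨h4, h2⟩ ⟨h3, h1⟩
  calc _ ≤ ε / C / s * ‖w1 - w2‖ := this
    _ ≤ ε / C / s * (C * s) := by gcongr
    _ = ε := by field_simp

end Bd
end NewtonPf
end

section
open Complex Metric Set Filter Topology MeasureTheory

namespace NewtonPf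
namespace Bd

variable {Φ : ℂ → ℂ}

lemma ftc (h : Bd Φ) (y : ℝ) {a b : ℝ} (hab : a ≤ b) (hb : b < 0) :
    ‖Φ (b + y * I) - Φ (a + y * I)‖ₑ ≤ ∫⁻ t in Ioc a b, ‖deriv Φ (t + y * I)‖ₑ := by
  have hd : ∀ t : ℝ, t < 0 → DifferentiableAt ℂ Φ (t + y * I) := fun t ht =>
    h.diff.differentiableAt (hp_open.mem_nhds (by simpa [HP] using ht))
  have h1 : ∀ t ∈ uIcc a b, HasDerivAt (fun t : ℝ => Φ (t + y * I)) (deriv Φ (t + y * I)) t := by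
    intro t ht
    rw [uIcc_of_le hab] at ht
    have h2 : HasDerivAt (fun t : ℂ => t + y * I) 1 (t : ℂ) := (hasDerivAt_id _).add_const _
    have h3 := (hd t (by linarith [ht.2])).hasDerivAt.comp (t : ℂ) h2
    rw [mul_one] at h3
    exact h3.comp_ofReal
  have hcont : ContinuousOn (fun t : ℝ => deriv Φ (t + y * I)) (uIcc a b) := by
    refine (h.diff.deriv hp_open).continuousOn.comp (by fun_prop) fun t ht => ?_
    rw [uIcc_of_le hab] at ht
    have : t < 0 := by linarith [ht.2]
    simpa [HP] using this
  have h4 := intervalIntegral.integral_eq_sub_of_hasDerivAt h1 hcont.intervalIntegrable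
  rw [← h4, intervalIntegral.integral_of_le hab]
  exact enorm_integral_le_lintegral_enorm _

lemma rect (h : Bd Φ) {ε : ℝ} (hε : 0 < ε) : ∃ δ > 0, ∀ d, 0 < d → d < δ → ∀ x : ℝ,
    ∃ y ∈ Ioo x (x + d), ∫⁻ t in Ioo (-d) 0, ‖deriv Φ ((t : ℝ) + y * I)‖ₑ ≤ ENNReal.ofReal ε := by
  obtain ⟨δ, hδ, hv⟩ := h.vol_small (ε := ENNReal.ofReal ((ε / 2) ^ 2)) (by simp; positivity)
  refine ⟨min δ 1, by positivity, fun d hd hdδ x => ?_⟩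
  have hd1 : d < δ := lt_of_lt_of_le hdδ (min_le_left _ _)
  have hd2 : d < 1 := lt_of_lt_of_le hdδ (min_le_right _ _)
  set R : Set ℂ := {w | (-d < w.re ∧ w.re < 0) ∧ (x < w.im ∧ w.im < x + d)} with hR
  have hRo : IsOpen R :=
    ((isOpen_lt continuous_const continuous_re).inter (isOpen_lt continuous_re continuous_const)).inter
    ((isOpen_lt continuous_const continuous_im).inter (isOpen_lt continuous_im continuous_const))
  have hRH : R ⊆ HP := fun w hw => hw.1.2
  have hi : InjOn Φ R := h.injOn hRH fun a ha b hb => by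
    have h1 := ha.2
    have h2 := hb.2
    rw [abs_lt]
    constructor <;> linarith [Real.pi_gt_three]
  have harea : ∫⁻ z in R, ENNReal.ofReal (‖deriv Φ z‖ ^ 2) ≤ ENNReal.ofReal ((ε / 2) ^ 2) := by
    rw [area_formula hp_open h.diff hRH hRo.measurableSet hi]
    refine (measure_mono (image_mono fun w hw => ?_)).trans hv.le
    exact ⟨by linarith [hw.1.1], hw.1.2⟩
  have hRp : R = measurableEquivRealProd ⁻¹' (Ioo (-d) 0 ×ˢ Ioo x (x + d)) := by
    ext w; simp [hR, measurableEquivRealProd]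
  have hvol : volume R = ENNReal.ofReal (d * d) := by
    rw [hRp, volume_preserving_equiv_real_prod.measure_preimage_equiv, Measure.volume_eq_prod, Measure.prod_prod,
      Real.volume_Ioo, Real.volume_Ioo, ← ENNReal.ofReal_mul (by linarith)]
    congr 1; ring
  have hm : Measurable (fun z => ‖deriv Φ z‖ₑ) := (measurable_deriv Φ).enorm
  have hL : ∫⁻ z in R, ‖deriv Φ z‖ₑ ≤ ENNReal.ofReal (ε / 2 * d) := by
    have hp : ∀ z, ‖deriv Φ z‖ₑ ≤ ENNReal.ofReal (ε / (4 * d)) + ENNReal.ofReal (d / ε) * ENNReal.ofReal (‖deriv Φ z‖ ^ 2) := by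
      intro z
      rw [← ofReal_norm, ← ENNReal.ofReal_mul (by positivity), ← ENNReal.ofReal_add (by positivity) (by positivity)]
      refine ENNReal.ofReal_le_ofReal ?_
      have h1 : ε / (4 * d) + d / ε * ‖deriv Φ z‖ ^ 2 - ‖deriv Φ z‖ = d / ε * (‖deriv Φ z‖ - ε / (2 * d)) ^ 2 := by
        field_simp; ring
      have h2 : 0 ≤ d / ε * (‖deriv Φ z‖ - ε / (2 * d)) ^ 2 := by positivity
      linarith
    calc ∫⁻ z in R, ‖deriv Φ z‖ₑ ≤ ∫⁻ z in R, (ENNReal.ofReal (ε / (4 * d)) + ENNReal.ofReal (d / ε) * ENNReal.ofReal (‖deriv Φ z‖ ^ 2)) :=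
          lintegral_mono hp
      _ = ENNReal.ofReal (ε / (4 * d)) * ENNReal.ofReal (d * d) + ENNReal.ofReal (d / ε) * ∫⁻ z in R, ENNReal.ofReal (‖deriv Φ z‖ ^ 2) := by
        rw [lintegral_add_left measurable_const, lintegral_const, Measure.restrict_apply_univ, hvol,
          lintegral_const_mul' _ _ ENNReal.ofReal_ne_top]
      _ ≤ ENNReal.ofReal (ε / (4 * d)) * ENNReal.ofReal (d * d) + ENNReal.ofReal (d / ε) * ENNReal.ofReal ((ε / 2) ^ 2) := by gcongr
      _ = ENNReal.ofReal (ε / 2 * d) := by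
        rw [← ENNReal.ofReal_mul (by positivity), ← ENNReal.ofReal_mul (by positivity),
          ← ENNReal.ofReal_add (by positivity) (by positivity)]
        congr 1
        field_simp; ring
  have hF : ∫⁻ z in R, ‖deriv Φ z‖ₑ = ∫⁻ y in Ioo x (x + d), ∫⁻ t in Ioo (-d) 0, ‖deriv Φ ((t : ℝ) + y * I)‖ₑ := by
    rw [hRp, ← (volume_preserving_equiv_real_prod.symm _).setLIntegral_comp_preimage_emb
      measurableEquivRealProd.symm.measurableEmbedding, ← preimage_comp]
    have e1 : (measurableEquivRealProd ∘ measurableEquivRealProd.symm) = id := by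
      funext p; simp
    rw [e1, preimage_id, Measure.volume_eq_prod, ← Measure.prod_restrict, lintegral_prod_symm]
    · have e2 : ∀ t y : ℝ, measurableEquivRealProd.symm (t, y) = (t : ℂ) + y * I := fun t y => by
        apply Complex.ext <;> simp [measurableEquivRealProd]
      simp only [e2]
    · exact (hm.comp measurableEquivRealProd.symm.measurable).aemeasurable
  by_contra hcon
  push Not at hcon
  have h5 : ∫⁻ y in Ioo x (x + d), ENNReal.ofReal ε ≤ ENNReal.ofReal (ε / 2 * d) := by
    refine le_trans (setLIntegral_mono' measurableSet_Ioo fun y hy => (hcon y hy).le) ?_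
    rw [← hF]; exact hL
  rw [lintegral_const, Measure.restrict_apply_univ, Real.volume_Ioo, ← ENNReal.ofReal_mul hε.le,
    ENNReal.ofReal_le_ofReal_iff (by positivity)] at h5
  nlinarith

/-- short landing rays -/
lemma ray (h : Bd Φ) {ε : ℝ} (hε : 0 < ε) : ∃ δ > 0, ∀ d, 0 < d → d < δ → ∀ x : ℝ,
    ∃ y ∈ Ioo x (x + d), ∃ L, Tendsto (fun s : ℝ => Φ (-s + y * I)) (𝓝[>] 0) (𝓝 L) ∧
      ∀ s, 0 < s → s < d → ‖Φ (-s + y * I) - L‖ ≤ ε := by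
  obtain ⟨δ, hδ, hv⟩ := h.rect hε
  refine ⟨δ, hδ, fun d hd hdδ x => ?_⟩
  obtain ⟨y, hy, hI⟩ := hv d hd hdδ x
  have key : ∀ s1 s2 : ℝ, 0 < s1 → s1 ≤ s2 → s2 < d →
      ‖Φ (-s1 + y * I) - Φ (-s2 + y * I)‖ₑ ≤ ∫⁻ t in Ioo (-s2) 0 ∩ Ioo (-d) 0, ‖deriv Φ ((t : ℝ) + y * I)‖ₑ := by
    intro s1 s2 h1 h2 h3
    have h4 := h.ftc y (a := -s2) (b := -s1) (by linarith) (by linarith)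
    push_cast at h4
    refine h4.trans ?_
    rw [← restrict_Ioo_eq_restrict_Ioc]
    refine lintegral_mono_set fun t ht => ⟨⟨ht.1, by linarith [ht.2]⟩, by linarith [ht.1], by linarith [ht.2]⟩
  have htail : Tendsto (fun s : ℝ => ∫⁻ t in Ioo (-s) 0 ∩ Ioo (-d) 0, ‖deriv Φ ((t : ℝ) + y * I)‖ₑ) (𝓝[>] 0) (𝓝 0) := by
    have h1 := tendsto_setLIntegral_zero (μ := volume.restrict (Ioo (-d) 0))
      (f := fun t : ℝ => ‖deriv Φ ((t : ℝ) + y * I)‖ₑ) (ne_top_of_le_ne_top ENNReal.ofReal_ne_top hI)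
      (l := 𝓝[>] (0 : ℝ)) (s := fun s : ℝ => Ioo (-s) 0) ?_
    · simpa only [Measure.restrict_restrict measurableSet_Ioo] using h1
    · have h2 : Tendsto (fun s : ℝ => ENNReal.ofReal s) (𝓝[>] 0) (𝓝 0) := by
        have := (ENNReal.continuous_ofReal.tendsto 0).mono_left (nhdsWithin_le_nhds (s := Ioi 0))
        simpa using this
      refine tendsto_of_tendsto_of_tendsto_of_le_of_le tendsto_const_nhds h2 (fun s => zero_le) fun s => ?_
      refine (Measure.restrict_apply_le _ _).trans ?_
      simp [Real.volume_Ioo]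
  have hc : Cauchy (map (fun s : ℝ => Φ (-s + y * I)) (𝓝[>] 0)) := by
    rw [Metric.cauchy_iff]
    refine ⟨inferInstance, fun η hη => ?_⟩
    obtain ⟨s0, hs0, hs⟩ := mem_nhdsGT_iff_exists_Ioo_subset.1
      ((htail.eventually (gt_mem_nhds (show (0 : ENNReal) < ENNReal.ofReal η by simpa))).and
      (Ioo_mem_nhdsGT hd))
    refine ⟨_, image_mem_map (Ioo_mem_nhdsGT (show (0 : ℝ) < s0 from hs0)), ?_⟩
    have key2 : ∀ s1 ∈ Ioo 0 s0, ∀ s2 ∈ Ioo 0 s0, s1 ≤ s2 → dist (Φ (-s1 + y * I)) (Φ (-s2 + y * I)) < η := by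
      intro s1 h1 s2 h2 h12
      have h3 := (key s1 s2 h1.1 h12 (hs h2).2.2).trans_lt (hs h2).1
      rwa [← ofReal_norm, ENNReal.ofReal_lt_ofReal_iff hη, ← dist_eq_norm] at h3
    rintro _ ⟨s1, h1, rfl⟩ _ ⟨s2, h2, rfl⟩
    rcases le_total s1 s2 with h12 | h12
    · exact key2 s1 h1 s2 h2 h12
    · rw [dist_comm]; exact key2 s2 h2 s1 h1 h12
  obtain ⟨L, hL⟩ := CompleteSpace.complete hc
  refine ⟨y, hy, L, hL, fun s hs hsd => ?_⟩
  have hL' : Tendsto (fun s : ℝ => Φ (-s + y * I)) (𝓝[>] 0) (𝓝 L) := hL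
  have h6 : Tendsto (fun s' : ℝ => ‖Φ (-s + y * I) - Φ (-s' + y * I)‖) (𝓝[>] 0) (𝓝 ‖Φ (-s + y * I) - L‖) :=
    (tendsto_const_nhds.sub hL').norm
  refine le_of_tendsto h6 ?_
  filter_upwards [Ioo_mem_nhdsGT hs] with s' hs'
  have h7 := (key s' s hs'.1 hs'.2.le hsd).trans ((lintegral_mono_set inter_subset_right).trans hI)
  rw [← ofReal_norm, ENNReal.ofReal_le_ofReal_iff hε.le, norm_sub_rev] at h7
  exact h7

end Bd
end NewtonPf
end

section
open Complex Metric Set Filter Topology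

namespace NewtonPf

/-- the lifted uniformized dynamics on an immediate basin -/
structure Lf (N : ℂ → ℂ) (Pl : Set ℂ) (ξ : ℂ) (Ψ Z f : ℂ → ℂ) (b β : ℝ → ℝ) (s0 : ℝ) (a0 lam : ℂ) : Prop
    extends Dyn N Pl ξ where
  lam0 : lam ≠ 0
  infl : ∀ ε > 0, ∃ R, ∀ z z', R < ‖z‖ → R < ‖z'‖ → z ≠ z' → ‖(N z - N z') / (z - z') - lam‖ < ε
  infx : Tendsto (fun z => (N z - ξ) / (z - ξ)) (Bornology.cobounded ℂ) (𝓝 lam)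
  away : ∃ δ > 0, ∀ z ∈ Imm N ξ, δ < ‖z - a0‖
  Ψd : DifferentiableOn ℂ Ψ HP
  mem : ∀ w ∈ HP, Ψ w ∈ Imm N ξ
  per : ∀ w, Ψ (w + 2 * Real.pi * I) = Ψ w
  inj : ∀ w ∈ HP, ∀ w' ∈ HP, Ψ w = Ψ w' → ∃ n : ℤ, w = w' + n * (2 * Real.pi * I)
  surj : ∀ z ∈ Imm N ξ, z ≠ ξ → ∃ w ∈ HP, Ψ w = z
  bd : ∀ K ⊆ Imm N ξ, IsCompact K → ∃ δ > 0, ∀ w ∈ HP, -δ < w.re → Ψ w ∉ K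
  Zc : ContinuousOn Z HP
  Zexp : ∀ w ∈ HP, exp (Z w) = Ψ w - ξ
  Zper : ∀ w ∈ HP, Z (w + 2 * Real.pi * I) = Z w + 2 * Real.pi * I
  lim : Tendsto Ψ (comap re atBot) (𝓝 ξ)
  s0pos : 0 < s0
  fb : ∀ x : ℝ, f (x * I) = b x * I
  fd : ∀ x : ℝ, HasStrictDerivAt f (β x : ℂ) (x * I)
  fc : ContinuousOn f {w | -s0 < w.re ∧ w.re < 0}
  β1 : ∀ x, 1 < β x
  fre : ∀ w, -s0 < w.re → w.re < 0 → (f w).re < 0 ∧ N (Ψ w) = Ψ (f w)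
  gmono : StrictMono (fun x => b x - x)
  bcont : Continuous b
  bper : ∃ k : ℕ, 2 ≤ k ∧ ∀ x, b (x + 2 * Real.pi) = b x + 2 * Real.pi * k

namespace Lf

variable {N : ℂ → ℂ} {Pl : Set ℂ} {ξ : ℂ} {Ψ Z f : ℂ → ℂ} {b β : ℝ → ℝ} {s0 : ℝ} {a0 lam : ℂ}

lemma ray_hp {s x : ℝ} (hs : 0 < s) : (-s + x * I : ℂ) ∈ HP := by simpa [HP] using hs

lemma perZ (h : Lf N Pl ξ Ψ Z f b β s0 a0 lam) (w : ℂ) (n : ℤ) : Ψ (w + n * (2 * Real.pi * I)) = Ψ w := by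
  have h1 : Function.Periodic Ψ (2 * Real.pi * I) := h.per
  exact h1.int_mul n w

lemma ne_a0 (h : Lf N Pl ξ Ψ Z f b β s0 a0 lam) {z : ℂ} (hz : z ∈ closure (Imm N ξ)) : z ≠ a0 := by
  rintro rfl
  obtain ⟨δ, hδ, hU⟩ := h.away
  obtain ⟨w, hw, hwU⟩ := mem_closure_iff.1 hz _ isOpen_ball (mem_ball_self hδ)
  rw [mem_ball, dist_eq_norm] at hw
  linarith [hU w hwU]

lemma bdd (h : Lf N Pl ξ Ψ Z f b β s0 a0 lam) : Bd (fun w => (Ψ w - a0)⁻¹) := by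
  have hne : ∀ w ∈ HP, Ψ w - a0 ≠ 0 := fun w hw => sub_ne_zero.2 (h.ne_a0 (subset_closure (h.mem w hw)))
  refine ⟨(h.Ψd.sub_const _).inv hne, ?_, fun w hw w' hw' he => h.inj w hw w' hw' ?_⟩
  · obtain ⟨δ, hδ, hU⟩ := h.away
    refine ⟨δ⁻¹, fun w hw => ?_⟩
    rw [norm_inv]
    exact inv_anti₀ hδ (hU _ (h.mem w hw)).le
  · simpa using inv_injective he

/-- nontangential comparison -/
lemma nt (h : Lf N Pl ξ Ψ Z f b β s0 a0 lam) {u v : ℝ → ℂ} {c C : ℝ} (hc : 0 < c) (hC : 0 < C)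
    (hu : ∀ᶠ s in 𝓝[>] 0, (u s).re ≤ -(c * s)) (hv : ∀ᶠ s in 𝓝[>] 0, (v s).re ≤ -(c * s))
    (huv : ∀ᶠ s in 𝓝[>] 0, ‖u s - v s‖ ≤ C * s) (hu0 : Tendsto (fun s => (u s).re) (𝓝[>] 0) (𝓝 0))
    (hv0 : Tendsto (fun s => (v s).re) (𝓝[>] 0) (𝓝 0)) :
    Tendsto (fun s => (Ψ (u s) - a0)⁻¹ - (Ψ (v s) - a0)⁻¹) (𝓝[>] 0) (𝓝 0) := by
  rw [Metric.tendsto_nhds]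
  intro ε hε
  obtain ⟨δ, hδ, hosc⟩ := h.bdd.osc (C := C / c) (by positivity) (half_pos hε)
  have h1 : ∀ᶠ s : ℝ in 𝓝[>] 0, s ∈ Ioo 0 (δ / c) := Ioo_mem_nhdsGT (by positivity)
  filter_upwards [hu, hv, huv, h1, hu0.eventually (lt_mem_nhds (show -δ < 0 by linarith)),
    hv0.eventually (lt_mem_nhds (show -δ < 0 by linarith))] with s h2 h3 h4 h5 h6 h7
  rw [dist_zero_right]
  refine lt_of_le_of_lt (hosc (c * s) (by have := h5.1; positivity) ?_ _ _ h2 h3 ?_ h6 h7) (by linarith)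
  · have := h5.2; rwa [lt_div_iff₀ hc, mul_comm] at this
  · calc _ ≤ C * s := h4
      _ = C / c * (c * s) := by field_simp

lemma ray_tendsto (x : ℝ) : Tendsto (fun s : ℝ => (-s + x * I : ℂ)) (𝓝[>] 0) (𝓝 (x * I)) := by
  have : Continuous (fun s : ℝ => (-s + x * I : ℂ)) := by fun_prop
  simpa using (this.tendsto 0).mono_left nhdsWithin_le_nhds

lemma fray (h : Lf N Pl ξ Ψ Z f b β s0 a0 lam) (x : ℝ) {ε : ℝ} (hε : 0 < ε) :
    ∀ᶠ s : ℝ in 𝓝[>] 0, ‖f (-s + x * I) - (b x * I - β x * s)‖ ≤ ε * s := by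
  have h1 := ((h.fd x).hasDerivAt.isLittleO.def hε)
  filter_upwards [(ray_tendsto x).eventually h1, self_mem_nhdsWithin] with s hs hs0
  have hs0 : 0 < s := hs0
  rw [h.fb] at hs
  have e1 : ((-s + x * I : ℂ)) - x * I = ((-s : ℝ) : ℂ) := by push_cast; ring
  rw [e1, norm_real, Real.norm_eq_abs, abs_neg, abs_of_pos hs0] at hs
  have e2 : f (-s + x * I) - (b x * I - β x * s) = f (-s + x * I) - b x * I - ((-s : ℝ) : ℂ) • (β x : ℂ) := by
    rw [smul_eq_mul]; push_cast; ring
  rw [e2]; exact hs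

lemma comp (h : Lf N Pl ξ Ψ Z f b β s0 a0 lam) (x : ℝ) :
    Tendsto (fun s : ℝ => (Ψ (f (-s + x * I)) - a0)⁻¹ - (Ψ (-s + b x * I) - a0)⁻¹) (𝓝[>] 0) (𝓝 0) := by
  have hβ := h.β1 x
  have hf := h.fray x (show (0 : ℝ) < 1 / 2 by norm_num)
  have h0 : Tendsto (fun s : ℝ => f (-s + x * I)) (𝓝[>] 0) (𝓝 (b x * I)) := by
    rw [← h.fb]
    exact (h.fd x).hasDerivAt.continuousAt.tendsto.comp (ray_tendsto x)
  refine h.nt (c := 1 / 2) (C := β x + 1) (by norm_num) (by linarith) ?_ ?_ ?_ ?_ ?_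
  · filter_upwards [hf, self_mem_nhdsWithin] with s hs hs0
    have hs0 : 0 < s := hs0
    have := (abs_le.1 ((abs_re_le_norm _).trans hs)).2
    simp at this
    nlinarith
  · filter_upwards [self_mem_nhdsWithin] with s hs0
    have hs0 : 0 < s := hs0
    simp; linarith
  · filter_upwards [hf, self_mem_nhdsWithin] with s hs hs0
    have hs0 : 0 < s := hs0
    have e : f (-s + x * I) - (-s + b x * I) = (f (-s + x * I) - (b x * I - β x * s)) + ((1 - β x) * s : ℝ) := by
      push_cast; ring
    rw [e]
    refine (norm_add_le _ _).trans ?_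
    rw [norm_real, Real.norm_eq_abs, abs_of_nonpos (by nlinarith)]
    nlinarith
  · have := (continuous_re.tendsto _).comp h0
    simpa [Function.comp_def] using this
  · have := (continuous_re.tendsto _).comp (ray_tendsto (b x))
    simpa [Function.comp_def] using this

lemma tends_front (h : Lf N Pl ξ Ψ Z f b β s0 a0 lam) {ι : Type*} {l : Filter ι} [NeBot l] {u : ι → ℂ}
    (hu : ∀ᶠ i in l, u i ∈ HP) (hu0 : Tendsto (fun i => (u i).re) l (𝓝 0)) {z : ℂ}
    (hz : Tendsto (fun i => Ψ (u i)) l (𝓝 z)) : z ∈ frontier (Imm N ξ) := by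
  rw [h.isOpen_imm.frontier_eq]
  refine ⟨mem_closure_of_tendsto hz (hu.mono fun i hi => h.mem _ hi), fun hzU => ?_⟩
  obtain ⟨ρ, hρ, hs⟩ := Metric.nhds_basis_closedBall.mem_iff.1 (h.isOpen_imm.mem_nhds hzU)
  obtain ⟨δ, hδ, hK⟩ := h.bd _ hs (isCompact_closedBall z ρ)
  obtain ⟨i, h1, h2, h3⟩ := (hu.and ((hu0.eventually (lt_mem_nhds (show -δ < 0 by linarith))).and
    (hz.eventually (closedBall_mem_nhds z hρ)))).exists
  exact hK _ h1 h2 h3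

lemma tends_inv {ι : Type*} {l : Filter ι} {g : ι → ℂ} {L : ℂ} (hL : L ≠ 0)
    (hz : Tendsto (fun i => (g i - a0)⁻¹) l (𝓝 L)) : Tendsto g l (𝓝 (L⁻¹ + a0)) := by
  have := (hz.inv₀ hL).add_const a0
  simpa using this

lemma tends_cob (h : Lf N Pl ξ Ψ Z f b β s0 a0 lam) {ι : Type*} {l : Filter ι} {g : ι → ℂ}
    (hg : ∀ᶠ i in l, g i ∈ Imm N ξ) :
    Tendsto (fun i => (g i - a0)⁻¹) l (𝓝 0) ↔ Tendsto g l (Bornology.cobounded ℂ) := by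
  have e : Tendsto g l (Bornology.cobounded ℂ) ↔ Tendsto (fun i => g i - a0) l (Bornology.cobounded ℂ) := by
    constructor
    · intro h1
      simpa [sub_eq_add_neg, Function.comp_def] using (tendsto_add_const_cobounded (-a0)).comp h1
    · intro h1
      simpa [Function.comp_def] using (tendsto_add_const_cobounded a0).comp h1
  rw [e]
  constructor
  · intro h1
    have h2 : Tendsto (fun i => (g i - a0)⁻¹) l (𝓝[≠] 0) := tendsto_nhdsWithin_iff.2 ⟨h1, by
      filter_upwards [hg] with i hi
      exact inv_ne_zero (sub_ne_zero.2 (h.ne_a0 (subset_closure hi)))⟩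
    simpa [Function.comp_def] using tendsto_inv₀_nhdsNE_zero.comp h2
  · intro h1
    exact tendsto_inv₀_cobounded.comp h1

end Lf
end NewtonPf
end

section
open Complex Metric Set Filter Topology

namespace NewtonPf

/-- a continuous path whose limit points lie in a finite set converges -/
lemma path_conv {γ : ℝ → ℂ} (hγ : ContinuousOn γ (Ioi 0)) {S : Set ℂ} (hS : S.Finite)
    (hl : ∀ g : Ultrafilter ℝ, (g : Filter ℝ) ≤ 𝓝[>] 0 → ∃ L ∈ S, Tendsto γ g (𝓝 L)) :
    ∃ L ∈ S, Tendsto γ (𝓝[>] 0) (𝓝 L) := by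
  obtain ⟨L, hLS, hL⟩ := hl (Ultrafilter.of (𝓝[>] 0)) (Ultrafilter.of_le _)
  refine ⟨L, hLS, ?_⟩
  have hT : (S \ {L})ᶜ ∈ 𝓝 L := (hS.subset sdiff_subset).isClosed.isOpen_compl.mem_nhds (by simp)
  obtain ⟨r, hr, hrS⟩ := Metric.mem_nhds_iff.1 hT
  rw [Metric.tendsto_nhds]
  intro ε hε
  by_contra hcon
  set ρ := min ε (r / 2) with hρ
  have hρ0 : 0 < ρ := by positivity
  have hfr : ∃ᶠ s in 𝓝[>] 0, dist (γ s) L = ρ := by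
    rw [Filter.frequently_iff]
    intro U hU
    obtain ⟨δ, hδ, hδU⟩ := mem_nhdsGT_iff_exists_Ioo_subset.1 hU
    have hI : Ioo 0 δ ∈ 𝓝[>] (0 : ℝ) := Ioo_mem_nhdsGT hδ
    obtain ⟨s1, h1, h1'⟩ := ((not_eventually.1 hcon).and_eventually hI).exists
    have h2 : ∃ᶠ s in 𝓝[>] (0:ℝ), dist (γ s) L < ρ := by
      have : ∃ᶠ s in (Ultrafilter.of (𝓝[>] (0:ℝ)) : Filter ℝ), dist (γ s) L < ρ :=
        (hL.eventually (ball_mem_nhds L hρ0)).frequently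
      exact this.filter_mono (Ultrafilter.of_le _)
    obtain ⟨s2, h2, h2'⟩ := (h2.and_eventually hI).exists
    have hc : ContinuousOn (fun s => dist (γ s) L) (Ioo 0 δ) :=
      (continuous_id.dist continuous_const).comp_continuousOn (hγ.mono fun s (hs : s ∈ Ioo 0 δ) => hs.1)
    obtain ⟨s, hs, hse⟩ := isPreconnected_Ioo.intermediate_value h2' h1' hc
      (show ρ ∈ Icc _ _ from ⟨h2.le, (min_le_left _ _).trans (not_lt.1 h1)⟩)
    exact ⟨s, hδU hs, hse⟩
  have hne : NeBot (𝓝[>] (0:ℝ) ⊓ 𝓟 {s | dist (γ s) L = ρ}) := frequently_mem_iff_neBot.1 hfr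
  set g := Ultrafilter.of (𝓝[>] (0:ℝ) ⊓ 𝓟 {s | dist (γ s) L = ρ})
  have hg := Ultrafilter.of_le (𝓝[>] (0:ℝ) ⊓ 𝓟 {s | dist (γ s) L = ρ})
  obtain ⟨L', hL'S, hL'⟩ := hl g (hg.trans inf_le_left)
  have h3 : ∀ᶠ s in (g : Filter ℝ), dist (γ s) L = ρ := le_principal_iff.1 (hg.trans inf_le_right)
  have h4 : dist L' L = ρ := tendsto_nhds_unique (hL'.dist tendsto_const_nhds)
    (tendsto_const_nhds.congr' (h3.mono fun s hs => hs.symm))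
  have h5 : L' ∈ ball L r := by rw [mem_ball, h4]; exact (min_le_right _ _).trans_lt (by linarith)
  apply hrS h5
  refine ⟨hL'S, fun h6 => ?_⟩
  rw [mem_singleton_iff.1 h6, dist_self] at h4
  linarith

namespace Lf

variable {N : ℂ → ℂ} {Pl : Set ℂ} {ξ : ℂ} {Ψ Z f : ℂ → ℂ} {b β : ℝ → ℝ} {s0 : ℝ} {a0 lam : ℂ}

/-- the ray of angle `x` lands at infinity -/
def Th (Ψ : ℂ → ℂ) (x : ℝ) : Prop :=
  Tendsto (fun s : ℝ => Ψ (-s + x * I)) (𝓝[>] 0) (Bornology.cobounded ℂ)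

lemma ev_hp (x : ℝ) : ∀ᶠ s : ℝ in 𝓝[>] 0, (-s + x * I : ℂ) ∈ HP := by
  filter_upwards [self_mem_nhdsWithin] with s hs using ray_hp hs

lemma th_iff (h : Lf N Pl ξ Ψ Z f b β s0 a0 lam) {x : ℝ} :
    Th Ψ x ↔ Tendsto (fun s : ℝ => (Ψ (-s + x * I) - a0)⁻¹) (𝓝[>] 0) (𝓝 0) :=
  (h.tends_cob ((ev_hp x).mono fun s hs => h.mem _ hs)).symm

lemma fN (h : Lf N Pl ξ Ψ Z f b β s0 a0 lam) (x : ℝ) :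
    ∀ᶠ s : ℝ in 𝓝[>] 0, f (-s + x * I) ∈ HP ∧ N (Ψ (-s + x * I)) = Ψ (f (-s + x * I)) := by
  filter_upwards [Ioo_mem_nhdsGT h.s0pos] with s hs
  exact h.fre _ (by simpa using hs.2) (by simpa using hs.1)

lemma ray_shift (h : Lf N Pl ξ Ψ Z f b β s0 a0 lam) (x : ℝ) (n : ℤ) (s : ℝ) :
    Ψ (-s + ((x + 2 * Real.pi * n : ℝ) : ℂ) * I) = Ψ (-s + x * I) := by
  rw [← h.perZ (-s + x * I) n]
  congr 1; push_cast; ring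

lemma th_shift (h : Lf N Pl ξ Ψ Z f b β s0 a0 lam) {x : ℝ} (n : ℤ) :
    Th Ψ (x + 2 * Real.pi * n) ↔ Th Ψ x := by
  unfold Th
  simp only [h.ray_shift]

lemma th_of_f (h : Lf N Pl ξ Ψ Z f b β s0 a0 lam) {x : ℝ} {g : Filter ℝ} (hg : g ≤ 𝓝[>] 0) {L : ℂ}
    (hL : Tendsto (fun s : ℝ => (N (Ψ (-s + x * I)) - a0)⁻¹) g (𝓝 L)) :
    Tendsto (fun s : ℝ => (Ψ (-s + b x * I) - a0)⁻¹) g (𝓝 L) := by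
  have := hL.sub ((h.comp x).mono_left hg)
  rw [sub_zero] at this
  refine this.congr' ?_
  filter_upwards [hg (h.fN x)] with s hs
  rw [hs.2]; ring

lemma th_b (h : Lf N Pl ξ Ψ Z f b β s0 a0 lam) {x : ℝ} (hx : Th Ψ x) : Th Ψ (b x) := by
  rw [h.th_iff]
  refine h.th_of_f le_rfl ((h.tends_cob ?_).2 ?_)
  · filter_upwards [ev_hp x] with s hs using h.imm_maps (h.mem _ hs)
  · rw [← tendsto_norm_atTop_iff_cobounded]
    exact h.inf.comp hx

lemma ult (h : Lf N Pl ξ Ψ Z f b β s0 a0 lam) (x : ℝ) (g : Ultrafilter ℝ) (hg : (g : Filter ℝ) ≤ 𝓝[>] 0) :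
    ∃ L, Tendsto (fun s : ℝ => (Ψ (-s + x * I) - a0)⁻¹) g (𝓝 L) ∧ (L = 0 ∨
      (L⁻¹ + a0 ∈ frontier (Imm N ξ) ∧ Tendsto (fun s : ℝ => Ψ (-s + x * I)) g (𝓝 (L⁻¹ + a0)))) := by
  obtain ⟨M, hM⟩ := h.bdd.bound
  have h1 : ((g.map (fun s : ℝ => (Ψ (-s + x * I) - a0)⁻¹) : Ultrafilter ℂ) : Filter ℂ) ≤ 𝓟 (closedBall 0 M) := by
    rw [le_principal_iff]
    have h0 : ∀ᶠ s : ℝ in (g : Filter ℝ), (Ψ (-s + x * I) - a0)⁻¹ ∈ closedBall (0:ℂ) M := by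
      filter_upwards [hg (ev_hp x)] with s hs
      rw [mem_closedBall_zero_iff]; exact hM _ hs
    exact h0
  obtain ⟨L, -, hL⟩ := (isCompact_closedBall (0:ℂ) M).ultrafilter_le_nhds _ h1
  have hL : Tendsto (fun s : ℝ => (Ψ (-s + x * I) - a0)⁻¹) g (𝓝 L) := hL
  refine ⟨L, hL, ?_⟩
  by_cases h0 : L = 0
  · exact Or.inl h0
  · right
    have h2 := tends_inv h0 hL
    refine ⟨h.tends_front (hg (ev_hp x)) ?_ h2, h2⟩
    have := (continuous_re.tendsto _).comp ((ray_tendsto x).mono_left hg)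
    simpa [Function.comp_def] using this

lemma step (h : Lf N Pl ξ Ψ Z f b β s0 a0 lam) {x : ℝ} {g : Filter ℝ} (hg : g ≤ 𝓝[>] 0) {z : ℂ}
    (hz : Tendsto (fun s : ℝ => Ψ (-s + x * I)) g (𝓝 z)) (hzf : z ∈ frontier (Imm N ξ)) (hp : z ∉ Pl) :
    Tendsto (fun s : ℝ => (Ψ (-s + b x * I) - a0)⁻¹) g (𝓝 ((N z - a0)⁻¹)) ∧ (N z - a0)⁻¹ ≠ 0 := by
  have h1 : N z - a0 ≠ 0 := sub_ne_zero.2 (h.ne_a0 (h.closure_maps (frontier_subset_closure hzf) hp))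
  refine ⟨h.th_of_f hg (Tendsto.inv₀ ?_ h1), inv_ne_zero h1⟩
  exact ((h.cont hp).tendsto.comp hz).sub_const a0

lemma step_pl (h : Lf N Pl ξ Ψ Z f b β s0 a0 lam) {x : ℝ} {g : Filter ℝ} (hg : g ≤ 𝓝[>] 0) {z : ℂ}
    (hz : Tendsto (fun s : ℝ => Ψ (-s + x * I)) g (𝓝 z)) (hp : z ∈ Pl) :
    Tendsto (fun s : ℝ => (Ψ (-s + b x * I) - a0)⁻¹) g (𝓝 0) := by
  refine h.th_of_f hg ((h.tends_cob ?_).2 ?_)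
  · filter_upwards [hg (ev_hp x)] with s hs using h.imm_maps (h.mem _ hs)
  · rw [← tendsto_norm_atTop_iff_cobounded]
    refine (h.pole z hp).comp (tendsto_nhdsWithin_iff.2 ⟨hz, ?_⟩)
    filter_upwards [hg (ev_hp x)] with s hs
    intro he
    exact h.imm_pl (h.mem _ hs) (he ▸ hp)

lemma front_not_fix (h : Lf N Pl ξ Ψ Z f b β s0 a0 lam) {z : ℂ} (hz : z ∈ frontier (Imm N ξ)) (hp : z ∉ Pl) :
    N z ≠ z := by
  intro he
  have hd : Dyn N Pl z := ⟨h.toNMap, hp, he⟩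
  obtain ⟨u, hu, hu'⟩ := mem_closure_iff.1 (frontier_subset_closure hz) _ hd.isOpen_bas hd.root_mem
  have : z = ξ := tendsto_nhds_unique hu (h.imm_bas hu')
  rw [h.isOpen_imm.frontier_eq] at hz
  exact hz.2 (this ▸ h.mem_imm)

lemma th_fix (h : Lf N Pl ξ Ψ Z f b β s0 a0 lam) {x : ℝ} {m : ℤ} (hb : b x = x + 2 * Real.pi * m) : Th Ψ x := by
  rw [h.th_iff, tendsto_iff_ultrafilter]
  intro g hg
  obtain ⟨L, hL, h1⟩ := h.ult x g hg
  by_cases h0 : L = 0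
  · rwa [h0] at hL
  exfalso
  obtain ⟨h1, h2⟩ := h1.resolve_left h0
  by_cases hp : L⁻¹ + a0 ∈ Pl
  · have h3 := h.step_pl hg h2 hp
    rw [hb] at h3
    simp only [h.ray_shift] at h3
    exact h0 (tendsto_nhds_unique hL h3)
  · have h3 := (h.step hg h2 h1 hp).1
    rw [hb] at h3
    simp only [h.ray_shift] at h3
    have h4 := tendsto_nhds_unique hL h3
    apply h.front_not_fix h1 hp
    have h5 : L⁻¹ = N (L⁻¹ + a0) - a0 := by
      conv_lhs => rw [h4, inv_inv]
    linear_combination -h5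

lemma cut (h : Lf N Pl ξ Ψ Z f b β s0 a0 lam) {t : ℝ} (hb : Th Ψ (b t)) :
    Th Ψ t ∨ ∃ q ∈ Pl, q ∈ frontier (Imm N ξ) ∧ Tendsto (fun s : ℝ => Ψ (-s + t * I)) (𝓝[>] 0) (𝓝 q) := by
  have hc : ContinuousOn (fun s : ℝ => (Ψ (-s + t * I) - a0)⁻¹) (Ioi 0) := by
    refine h.bdd.diff.continuousOn.comp (f := fun s : ℝ => (-s + t * I : ℂ)) (by fun_prop) fun s hs => ray_hp hs
  have hS : (insert (0:ℂ) ((fun q => (q - a0)⁻¹) '' Pl)).Finite := (h.plfin.image _).insert _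
  obtain ⟨L, hLS, hL⟩ := path_conv hc hS (fun g hg => by
    obtain ⟨L, hL, h1⟩ := h.ult t g hg
    refine ⟨L, ?_, hL⟩
    rcases h1 with rfl | ⟨h1, h2⟩
    · simp
    right
    by_cases hp : L⁻¹ + a0 ∈ Pl
    · exact ⟨_, hp, by simp⟩
    · exfalso
      have h3 := h.step hg h2 h1 hp
      exact h3.2 (tendsto_nhds_unique h3.1 ((h.th_iff.1 hb).mono_left hg)))
  by_cases h0 : L = 0
  · left; rw [h.th_iff]; rwa [h0] at hL
  right
  rcases hLS with h1 | ⟨q, hq, rfl⟩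
  · exact absurd h1 h0
  have h2 := tends_inv h0 hL
  simp only [inv_inv, sub_add_cancel] at h2
  refine ⟨q, hq, h.tends_front (ev_hp t) ?_ h2, h2⟩
  have := (continuous_re.tendsto _).comp (ray_tendsto t)
  simpa [Function.comp_def] using this

/-- preimage path along the ray of angle `b x` -/
lemma inv_path (h : Lf N Pl ξ Ψ Z f b β s0 a0 lam) (x : ℝ) : ∃ p : ℝ → ℂ,
    Tendsto p (𝓝[>] 0) (𝓝 (x * I)) ∧ (∀ᶠ s in 𝓝[>] 0, p s ∈ HP) ∧
    (∀ᶠ s : ℝ in 𝓝[>] 0, f (p s) = -s + b x * I) ∧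
    (Th Ψ x → Tendsto (fun s => Ψ (p s)) (𝓝[>] 0) (Bornology.cobounded ℂ)) := by
  have hβ := h.β1 x
  have hβ0 : (β x : ℂ) ≠ 0 := by exact_mod_cast (by linarith : β x ≠ 0)
  have hfd := h.fd x
  set g := hfd.localInverse f (β x : ℂ) (x * I) hβ0 with hg
  have h1 : HasStrictDerivAt g (β x : ℂ)⁻¹ (f (x * I)) := hfd.to_localInverse hβ0
  have h2 : ∀ᶠ y in 𝓝 (f (x * I)), f (g y) = y :=
    (hfd.hasStrictFDerivAt_equiv hβ0).eventually_right_inverse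
  have h3 : g (f (x * I)) = x * I := (hfd.hasStrictFDerivAt_equiv hβ0).localInverse_apply_image
  rw [h.fb] at h1 h2 h3
  have hr := ray_tendsto (b x)
  have h4 : Tendsto (fun s : ℝ => g (-s + b x * I)) (𝓝[>] 0) (𝓝 (x * I)) := by
    have := h1.hasDerivAt.continuousAt.tendsto.comp hr
    rwa [h3] at this
  have h5 : ∀ᶠ s : ℝ in 𝓝[>] 0, ‖g (-s + b x * I) - (x * I - (β x)⁻¹ * s)‖ ≤ (β x)⁻¹ / 2 * s := by
    have hh := h1.hasDerivAt.isLittleO.def (c := (β x)⁻¹ / 2) (by have := inv_pos.2 (by linarith : 0 < β x); linarith)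
    filter_upwards [hr.eventually hh, self_mem_nhdsWithin] with s hs hs0
    have hs0 : 0 < s := hs0
    rw [h3] at hs
    have e1 : ((-s + b x * I : ℂ)) - b x * I = ((-s : ℝ) : ℂ) := by push_cast; ring
    rw [e1, norm_real, Real.norm_eq_abs, abs_neg, abs_of_pos hs0] at hs
    have e2 : g (-s + b x * I) - (x * I - (β x)⁻¹ * s) = g (-s + b x * I) - x * I - ((-s : ℝ) : ℂ) • (β x : ℂ)⁻¹ := by
      rw [smul_eq_mul]; push_cast; ring
    rw [e2]; exact hs
  have hi : 0 < (β x)⁻¹ := inv_pos.2 (by linarith)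
  have hi1 : (β x)⁻¹ < 1 := inv_lt_one_of_one_lt₀ hβ
  have h6 : ∀ᶠ s : ℝ in 𝓝[>] 0, (g (-s + b x * I)).re ≤ -((β x)⁻¹ / 2 * s) := by
    filter_upwards [h5] with s hs
    have := (abs_le.1 ((abs_re_le_norm _).trans hs)).2
    simp at this
    linarith
  refine ⟨_, h4, ?_, hr.eventually h2, fun hx => ?_⟩
  · filter_upwards [h6, self_mem_nhdsWithin] with s hs hs0
    have hs0 : 0 < s := hs0
    have : 0 < (β x)⁻¹ / 2 * s := by positivity
    simp only [HP, mem_ofPred_eq]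
    linarith
  · have h7 := h.nt (u := fun s => g (-s + b x * I)) (v := fun s => -s + x * I) (c := (β x)⁻¹ / 2)
      (C := 2) (by positivity) (by norm_num) h6 ?_ ?_ ?_ ?_
    · rw [h.th_iff] at hx
      have h8 := h7.add hx
      simp only [sub_add_cancel, add_zero] at h8
      refine (h.tends_cob ?_).1 h8
      filter_upwards [h6, self_mem_nhdsWithin] with s hs hs0
      have hs0 : 0 < s := hs0
      have : 0 < (β x)⁻¹ / 2 * s := by positivity
      exact h.mem _ (by simp only [HP, mem_ofPred_eq]; linarith)
    · filter_upwards [self_mem_nhdsWithin] with s hs0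
      have hs0 : 0 < s := hs0
      simp; nlinarith
    · filter_upwards [h5, self_mem_nhdsWithin] with s hs hs0
      have hs0 : 0 < s := hs0
      have e : g (-s + b x * I) - (-s + x * I) = (g (-s + b x * I) - (x * I - (β x)⁻¹ * s)) + ((1 - (β x)⁻¹) * s : ℝ) := by
        push_cast; ring
      rw [e]
      refine (norm_add_le _ _).trans ?_
      rw [norm_real, Real.norm_eq_abs, abs_of_nonneg (by nlinarith)]
      nlinarith
    · have := (continuous_re.tendsto _).comp h4
      simpa [Function.comp_def] using this
    · have := (continuous_re.tendsto _).comp (ray_tendsto x)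
      simpa [Function.comp_def] using this

lemma th_inj (h : Lf N Pl ξ Ψ Z f b β s0 a0 lam) {x y : ℝ} (hxy : x < y) (hyx : y < x + 2 * Real.pi)
    (hx : Th Ψ x) (hy : Th Ψ y) (n : ℤ) : b y ≠ b x + 2 * Real.pi * n := by
  intro he
  obtain ⟨p, p1, p2, p3, p4⟩ := h.inv_path x
  obtain ⟨q, q1, q2, q3, q4⟩ := h.inv_path y
  obtain ⟨R, hR⟩ := h.infl ‖lam‖ (norm_pos_iff.2 h.lam0)
  have hpR : ∀ᶠ s in 𝓝[>] 0, R < ‖Ψ (p s)‖ :=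
    (tendsto_norm_atTop_iff_cobounded.2 (p4 hx)).eventually_gt_atTop R
  have hqR : ∀ᶠ s in 𝓝[>] 0, R < ‖Ψ (q s)‖ :=
    (tendsto_norm_atTop_iff_cobounded.2 (q4 hy)).eventually_gt_atTop R
  have him : Tendsto (fun s => (q s).im - (p s).im) (𝓝[>] 0) (𝓝 (y - x)) := by
    have h1 := (continuous_im.tendsto _).comp p1
    have h2 := (continuous_im.tendsto _).comp q1
    have := h2.sub h1
    simpa [Function.comp_def] using this
  have hpr : ∀ᶠ s in 𝓝[>] 0, -s0 < (p s).re := by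
    have h1 := (continuous_re.tendsto _).comp p1
    exact h1.eventually (lt_mem_nhds (by simpa using h.s0pos))
  have hqr : ∀ᶠ s in 𝓝[>] 0, -s0 < (q s).re := by
    have h1 := (continuous_re.tendsto _).comp q1
    exact h1.eventually (lt_mem_nhds (by simpa using h.s0pos))
  obtain ⟨s, a1, a2, a3, a4, a5, a6, a7, a8, a9, a10⟩ := (p2.and (q2.and (p3.and (q3.and (hpR.and (hqR.and (hpr.and (hqr.and
    ((him.eventually (lt_mem_nhds (show 0 < y - x by linarith))).and
      (him.eventually (gt_mem_nhds (show y - x < 2 * Real.pi by linarith)))))))))))).exists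
  have e1 : N (Ψ (p s)) = N (Ψ (q s)) := by
    rw [(h.fre _ a7 a1).2, (h.fre _ a8 a2).2, a3, a4, he, h.ray_shift]
  have e2 : Ψ (p s) = Ψ (q s) := by
    by_contra hne
    have := hR _ _ a5 a6 hne
    rw [e1] at this
    simp at this
  obtain ⟨k, hk⟩ := h.inj _ a2 _ a1 e2.symm
  have e3 : (q s).im - (p s).im = k * (2 * Real.pi) := by rw [hk]; simp
  rw [e3] at a9 a10
  have hpi := Real.pi_pos
  have k1 : (0:ℝ) < k := by by_contra hh; push Not at hh; nlinarith
  have k2 : (k:ℝ) < 1 := by by_contra hh; push Not at hh; nlinarith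
  norm_cast at k1 k2
  omega

end Lf
end NewtonPf
end

section
open Complex Metric Set Filter Topology

namespace NewtonPf

lemma Bd.ray3 {Φ : ℂ → ℂ} (h : Bd Φ) : ∃ Y : ℝ → ℝ → ℝ, ∃ L : ℝ → ℝ → ℂ,
    (∀ x d, 0 < d → Y x d ∈ Ioo x (x + d) ∧
      Tendsto (fun s : ℝ => Φ (-s + Y x d * I)) (𝓝[>] 0) (𝓝 (L x d))) ∧
    ∀ ε > 0, ∃ δ > 0, ∀ x d, 0 < d → d < δ → ∀ s : ℝ, 0 < s → s < d → ‖Φ (-s + Y x d * I) - L x d‖ ≤ ε := by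
  classical
  set A : ℝ → ℝ → ℝ → ℂ → Prop := fun x d y L => y ∈ Ioo x (x + d) ∧
      Tendsto (fun s : ℝ => Φ (-s + y * I)) (𝓝[>] 0) (𝓝 L) with hA
  set B : ℝ → ℝ → ℂ → ℝ → Prop := fun d y L e => ∀ s : ℝ, 0 < s → s < d → ‖Φ (-s + y * I) - L‖ ≤ e with hB
  have key : ∀ x d : ℝ, 0 < d → ∃ y L, A x d y L ∧
      ∀ e > 0, (∃ y' L', A x d y' L' ∧ B d y' L' e) → B d y L (e + d) := by
    intro x d hd
    by_cases hne : ∃ e > 0, ∃ y' L', A x d y' L' ∧ B d y' L' e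
    · set S := {e : ℝ | 0 < e ∧ ∃ y' L', A x d y' L' ∧ B d y' L' e} with hS
      have hSne : S.Nonempty := by obtain ⟨e, he, h1⟩ := hne; exact ⟨e, he, h1⟩
      have hSb : BddBelow S := ⟨0, fun e he => he.1.le⟩
      obtain ⟨e, ⟨he0, y, L, hy, hyB⟩, he⟩ := exists_lt_of_csInf_lt hSne (show sInf S < sInf S + d by linarith)
      refine ⟨y, L, hy, fun e' he' h' s hs hs' => (hyB s hs hs').trans ?_⟩
      have : sInf S ≤ e' := csInf_le hSb ⟨he', h'⟩
      linarith
    · obtain ⟨δ, hδ, h1⟩ := h.ray one_pos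
      obtain ⟨y, hy, L, hL, -⟩ := h1 (min d (δ / 2)) (by positivity) ((min_le_right _ _).trans_lt (by linarith)) x
      refine ⟨y, L, ⟨⟨hy.1, hy.2.trans_le (by linarith [min_le_left d (δ / 2)])⟩, hL⟩, fun e he h' => ?_⟩
      exact absurd ⟨e, he, h'⟩ hne
  have key2 : ∀ x d : ℝ, ∃ y L, 0 < d → (A x d y L ∧
      ∀ e > 0, (∃ y' L', A x d y' L' ∧ B d y' L' e) → B d y L (e + d)) := by
    intro x d
    by_cases hd : 0 < d
    · obtain ⟨y, L, h1⟩ := key x d hd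
      exact ⟨y, L, fun _ => h1⟩
    · exact ⟨0, 0, fun h => absurd h hd⟩
  choose Y L hYL using key2
  refine ⟨Y, L, fun x d hd => (hYL x d hd).1, fun ε hε => ?_⟩
  obtain ⟨δ, hδ, h1⟩ := h.ray (half_pos hε)
  refine ⟨min δ (ε / 2), by positivity, fun x d hd hdδ s hs hsd => ?_⟩
  obtain ⟨y, hy, L', hL', hb⟩ := h1 d hd (hdδ.trans_le (min_le_left _ _)) x
  have := (hYL x d hd).2 (ε / 2) (half_pos hε) ⟨y, L', ⟨hy, hL'⟩, hb⟩ s hs hsd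
  have h2 := hdδ.trans_le (min_le_right _ _)
  linarith

/-- if endpoints shadow `S` then so does the limit -/
lemma Bd.shadow {Φ : ℂ → ℂ} (h : Bd Φ) {S : Set ℂ} {Y : ℝ → ℝ → ℝ} {L : ℝ → ℝ → ℂ}
    (hY : ∀ ε > 0, ∃ δ > 0, ∀ x d, 0 < d → d < δ → ∀ s : ℝ, 0 < s → s < d → ‖Φ (-s + Y x d * I) - L x d‖ ≤ ε)
    {e d : ℕ → ℝ} {c : ℝ} (hd : ∀ n, 0 < d n) (hd1 : ∀ n, d n / 3 ≤ d (n + 1)) (hd2 : ∀ n, d (n + 1) ≤ 2 / 3 * d n)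
    (hec : ∀ n, |c - e n| ≤ d n) (hel : ∀ n, ∃ l ∈ S, Tendsto (fun s : ℝ => Φ (-s + e n * I)) (𝓝[>] 0) (𝓝 l))
    (hst : ∀ n, e (n + 1) = e n ∨ ∃ x, e (n + 1) = Y x (d n / 3) ∧ L x (d n / 3) ∈ S) {ε : ℝ} (hε : 0 < ε) :
    ∀ᶠ s : ℝ in 𝓝[>] 0, ∃ a ∈ S, ‖Φ (-s + c * I) - a‖ ≤ ε := by
  have hε2 := half_pos hε
  obtain ⟨δ, hδ, hYδ⟩ := hY _ hε2
  obtain ⟨δ', hδ', hosc⟩ := h.osc (C := 6) (by norm_num) hε2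
  have hdn : ∀ n, d n ≤ (2 / 3) ^ n * d 0 := by
    intro n
    induction n with
    | zero => simp
    | succ n ih => rw [pow_succ]; nlinarith [hd2 n]
  have hd0 : Tendsto d atTop (𝓝 0) := by
    refine squeeze_zero (fun n => (hd n).le) hdn ?_
    simpa using (tendsto_pow_atTop_nhds_zero_of_lt_one (r := (2 / 3 : ℝ)) (by norm_num) (by norm_num)).mul_const (d 0)
  have hanti : Antitone d := antitone_nat_of_succ_le fun n => by linarith [hd2 n, hd n]
  obtain ⟨m, hm⟩ := (hd0.eventually (gt_mem_nhds hδ)).exists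
  have hind : ∀ n, m ≤ n → (e n = e m ∨ ∃ l ∈ S, ∀ s : ℝ, 0 < s → s < d n / 2 → ‖Φ (-s + e n * I) - l‖ ≤ ε / 2) := by
    intro n hn
    induction n, hn using Nat.le_induction with
    | base => exact Or.inl rfl
    | succ n hn ih =>
      have h1 := hd2 n
      rcases hst n with h2 | ⟨x, h2, h3⟩
      · rw [h2]
        rcases ih with h4 | ⟨l, hl, h4⟩
        · exact Or.inl h4
        · exact Or.inr ⟨l, hl, fun s hs hs' => h4 s hs (by linarith [hd n])⟩
      · right
        rw [h2]
        refine ⟨_, h3, fun s hs hs' => hYδ _ _ (by linarith [hd n]) ?_ s hs (by linarith)⟩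
        have := hanti hn
        linarith [hd n]
  obtain ⟨l, hl, hlt⟩ := hel m
  have h5 : ∀ᶠ s : ℝ in 𝓝[>] 0, ‖Φ (-s + e m * I) - l‖ ≤ ε / 2 := by
    filter_upwards [hlt.eventually (closedBall_mem_nhds l hε2)] with s hs
    rwa [← dist_eq_norm]
  filter_upwards [h5, Ioo_mem_nhdsGT hδ', Ioo_mem_nhdsGT (half_pos (hd m))] with s h6 h7 h8
  have hex : ∃ n, d n / 2 ≤ s := by
    obtain ⟨n, hn⟩ := (hd0.eventually (gt_mem_nhds h7.1)).exists
    exact ⟨n, by linarith [hd n]⟩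
  classical
  obtain ⟨n, hn1, hn2⟩ : ∃ n, d (n + 1) / 2 ≤ s ∧ s < d n / 2 := by
    have hf := Nat.find_spec hex
    have h0 : Nat.find hex ≠ 0 := by
      intro h0; rw [h0] at hf
      have := hanti (Nat.zero_le m)
      linarith [h8.2]
    obtain ⟨n, hn⟩ := Nat.exists_eq_succ_of_ne_zero h0
    refine ⟨n, by rw [hn] at hf; exact hf, ?_⟩
    exact not_le.1 (Nat.find_min hex (by omega))
  have hmn : m ≤ n := by
    by_contra hlt
    have := hanti (show n + 1 ≤ m by omega)
    linarith [h8.2]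
  have h9 : ∃ a ∈ S, ‖Φ (-s + e n * I) - a‖ ≤ ε / 2 := by
    rcases hind n hmn with h10 | ⟨l', hl', h10⟩
    · exact ⟨l, hl, by rwa [h10]⟩
    · exact ⟨l', hl', h10 s h7.1 hn2⟩
  obtain ⟨a, ha, h10⟩ := h9
  refine ⟨a, ha, ?_⟩
  have h11 := hosc s h7.1 h7.2 (-s + c * I) (-s + e n * I) (by simp) (by simp) ?_ (by simpa using h7.2) (by simpa using h7.2)
  · calc _ = ‖(Φ (-s + c * I) - Φ (-s + e n * I)) + (Φ (-s + e n * I) - a)‖ := by congr 1; ring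
      _ ≤ _ := norm_add_le _ _
      _ ≤ ε := by linarith
  · have : (-s + c * I : ℂ) - (-s + e n * I) = ((c - e n : ℝ) : ℂ) * I := by push_cast; ring
    rw [this, norm_mul, norm_real, norm_I, mul_one, Real.norm_eq_abs]
    linarith [hec n, hd1 n]

namespace Lf

variable {N : ℂ → ℂ} {Pl : Set ℂ} {ξ : ℂ} {Ψ Z f : ℂ → ℂ} {b β : ℝ → ℝ} {s0 : ℝ} {a0 lam : ℂ}

/-- the ray of angle `x` lands in `S` -/
def Ld (Ψ : ℂ → ℂ) (S : Set ℂ) (x : ℝ) : Prop :=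
  ∃ z ∈ S, Tendsto (fun s : ℝ => Ψ (-s + x * I)) (𝓝[>] 0) (𝓝 z)

lemma land (h : Lf N Pl ξ Ψ Z f b β s0 a0 lam) {y : ℝ} {L : ℂ}
    (hL : Tendsto (fun s : ℝ => (Ψ (-s + y * I) - a0)⁻¹) (𝓝[>] 0) (𝓝 L)) :
    Th Ψ y ∨ (L ≠ 0 ∧ L⁻¹ + a0 ∈ frontier (Imm N ξ) ∧ Tendsto (fun s : ℝ => Ψ (-s + y * I)) (𝓝[>] 0) (𝓝 (L⁻¹ + a0))) := by
  by_cases h0 : L = 0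
  · left; rw [h.th_iff]; rwa [h0] at hL
  · right
    have h2 := tends_inv h0 hL
    refine ⟨h0, h.tends_front (ev_hp y) ?_ h2, h2⟩
    have := (continuous_re.tendsto _).comp (ray_tendsto y)
    simpa [Function.comp_def] using this

lemma ld_inv (h : Lf N Pl ξ Ψ Z f b β s0 a0 lam) {S : Set ℂ} (hS : S ⊆ frontier (Imm N ξ)) {x : ℝ} (hx : Ld Ψ S x) :
    ∃ l ∈ (fun z => (z - a0)⁻¹) '' S, Tendsto (fun s : ℝ => (Ψ (-s + x * I) - a0)⁻¹) (𝓝[>] 0) (𝓝 l) := by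
  obtain ⟨z, hz, hzt⟩ := hx
  refine ⟨_, ⟨z, hz, rfl⟩, (hzt.sub_const a0).inv₀ (sub_ne_zero.2 (h.ne_a0 (frontier_subset_closure (hS hz))))⟩

lemma mem_of_shadow {S : Set ℂ} (hS : IsClosed S) {g : Filter ℝ} [NeBot g] {γ : ℝ → ℂ} {L : ℂ} (hL : L ≠ 0)
    (hγ : Tendsto γ g (𝓝 L)) (hs : ∀ ε > 0, ∀ᶠ s in g, ∃ a ∈ (fun z => (z - a0)⁻¹) '' S, ‖γ s - a‖ ≤ ε) :
    L⁻¹ + a0 ∈ S := by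
  by_contra hn
  have hc : ContinuousAt (fun l : ℂ => l⁻¹ + a0) L := (continuousAt_inv₀ hL).add continuousAt_const
  have h1 : ∀ᶠ l in 𝓝 L, l⁻¹ + a0 ∈ Sᶜ := hc.eventually (hS.isOpen_compl.mem_nhds hn)
  obtain ⟨r, hr, h2⟩ := Metric.eventually_nhds_iff.1 h1
  obtain ⟨s, ⟨_, ⟨z, hz, rfl⟩, h3⟩, h4⟩ := ((hs (r / 2) (half_pos hr)).and (hγ.eventually (ball_mem_nhds L (half_pos hr)))).exists
  refine h2 (y := (z - a0)⁻¹) ?_ (by simpa using hz)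
  calc dist (z - a0)⁻¹ L ≤ dist (z - a0)⁻¹ (γ s) + dist (γ s) L := dist_triangle _ _ _
    _ < r := by
      rw [dist_comm, dist_eq_norm]
      have : dist (γ s) L < r / 2 := h4
      linarith

lemma bisect (h : Lf N Pl ξ Ψ Z f b β s0 a0 lam) {E1 E2 : Set ℂ} (hs1 : E1 ⊆ frontier (Imm N ξ))
    (hs2 : E2 ⊆ frontier (Imm N ξ)) (hc1 : IsClosed E1) (hc2 : IsClosed E2)
    (hun : ∀ z ∈ frontier (Imm N ξ), z ∈ E1 ∨ z ∈ E2) (hdis : ∀ z, z ∈ E1 → z ∈ E2 → False)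
    {u v : ℝ} (huv : u < v) (hu : Ld Ψ E1 u) (hv : Ld Ψ E2 v) :
    ∃ c ∈ Icc u v, Th Ψ c := by
  classical
  by_contra hcon
  push Not at hcon
  obtain ⟨Y, L, hY1, hY2⟩ := h.bdd.ray3
  set P : ℝ × ℝ → Prop := fun q => u ≤ q.1 ∧ q.1 < q.2 ∧ q.2 ≤ v ∧ Ld Ψ E1 q.1 ∧ Ld Ψ E2 q.2 with hP
  set R : ℝ × ℝ → ℝ × ℝ → Prop := fun q q' => q.1 ≤ q'.1 ∧ q'.2 ≤ q.2 ∧ (q.2 - q.1) / 3 ≤ q'.2 - q'.1 ∧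
    q'.2 - q'.1 ≤ 2 / 3 * (q.2 - q.1) ∧
    (q'.1 = q.1 ∨ ∃ x, q'.1 = Y x ((q.2 - q.1) / 3) ∧ L x ((q.2 - q.1) / 3) ∈ (fun z => (z - a0)⁻¹) '' E1) ∧
    (q'.2 = q.2 ∨ ∃ x, q'.2 = Y x ((q.2 - q.1) / 3) ∧ L x ((q.2 - q.1) / 3) ∈ (fun z => (z - a0)⁻¹) '' E2) with hR
  have hstep : ∀ q : {q // P q}, ∃ q' : {q // P q}, R q q' := by
    rintro ⟨⟨u', v'⟩, h1, h2, h3, h4, h5⟩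
    simp only at h1 h2 h3 h4 h5
    set d := v' - u' with hd
    have hd0 : 0 < d := by linarith
    obtain ⟨hy, hL⟩ := hY1 (u' + d / 3) (d / 3) (by linarith)
    set y := Y (u' + d / 3) (d / 3) with hyd
    have hy1 := hy.1
    have hy2 := hy.2
    rcases h.land hL with h6 | ⟨h6, h7, h8⟩
    · exact absurd h6 (hcon y ⟨by linarith, by linarith⟩)
    rcases hun _ h7 with h9 | h9
    · refine ⟨⟨(y, v'), ?_, ?_, h3, ⟨_, h9, h8⟩, h5⟩, ?_, le_rfl, ?_, ?_, Or.inr ⟨u' + d / 3, rfl, ⟨_, h9, by simp [hd]⟩⟩, Or.inl rfl⟩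
      all_goals simp only; linarith
    · refine ⟨⟨(u', y), h1, ?_, ?_, h4, ⟨_, h9, h8⟩⟩, le_rfl, ?_, ?_, ?_, Or.inl rfl, Or.inr ⟨u' + d / 3, rfl, ⟨_, h9, by simp [hd]⟩⟩⟩
      all_goals simp only; linarith
  choose st hst using hstep
  set q : ℕ → {q // P q} := fun n => st^[n] ⟨(u, v), le_rfl, huv, le_rfl, hu, hv⟩ with hq
  have hqs : ∀ n, R (q n) (q (n + 1)) := by
    intro n
    simp only [hq, Function.iterate_succ_apply']
    exact hst _
  set e1 : ℕ → ℝ := fun n => (q n).1.1 with he1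
  set e2 : ℕ → ℝ := fun n => (q n).1.2 with he2
  have hlt : ∀ n, e1 n < e2 n := fun n => (q n).2.2.1
  have hanti : Antitone (fun n => Icc (e1 n) (e2 n)) :=
    antitone_nat_of_succ_le fun n => Icc_subset_Icc (hqs n).1 (hqs n).2.1
  have hc := ciSup_mem_iInter_Icc_of_antitone_Icc hanti fun n => (hlt n).le
  set c := ⨆ n, e1 n with hcdef
  rw [mem_iInter] at hc
  have hcuv : c ∈ Icc u v := ⟨(q 0).2.1.trans (hc 0).1, (hc 0).2.trans (q 0).2.2.2.1⟩
  apply hcon c hcuv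
  have hd : ∀ n, 0 < e2 n - e1 n := fun n => sub_pos.2 (hlt n)
  have sh1 : ∀ ε > 0, ∀ᶠ s : ℝ in 𝓝[>] 0, ∃ a ∈ (fun z => (z - a0)⁻¹) '' E1, ‖(Ψ (-s + c * I) - a0)⁻¹ - a‖ ≤ ε :=
    fun ε hε => h.bdd.shadow (e := e1) (d := fun n => e2 n - e1 n) hY2 hd (fun n => (hqs n).2.2.1)
      (fun n => (hqs n).2.2.2.1) (fun n => by rw [abs_le]; constructor <;> linarith [(hc n).1, (hc n).2, hd n])
      (fun n => h.ld_inv hs1 (q n).2.2.2.2.1) (fun n => (hqs n).2.2.2.2.1) hε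
  have sh2 : ∀ ε > 0, ∀ᶠ s : ℝ in 𝓝[>] 0, ∃ a ∈ (fun z => (z - a0)⁻¹) '' E2, ‖(Ψ (-s + c * I) - a0)⁻¹ - a‖ ≤ ε :=
    fun ε hε => h.bdd.shadow (e := e2) (d := fun n => e2 n - e1 n) hY2 hd (fun n => (hqs n).2.2.1)
      (fun n => (hqs n).2.2.2.1) (fun n => by rw [abs_le]; constructor <;> linarith [(hc n).1, (hc n).2, hd n])
      (fun n => h.ld_inv hs2 (q n).2.2.2.2.2) (fun n => (hqs n).2.2.2.2.2) hε
  rw [h.th_iff, tendsto_iff_ultrafilter]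
  intro g hg
  obtain ⟨l, hl, -⟩ := h.ult c g hg
  by_cases h0 : l = 0
  · rwa [h0] at hl
  · exfalso
    exact hdis _ (mem_of_shadow hc1 h0 hl fun ε hε => hg (sh1 ε hε)) (mem_of_shadow hc2 h0 hl fun ε hε => hg (sh2 ε hε))

lemma deep (h : Lf N Pl ξ Ψ Z f b β s0 a0 lam) {δ : ℝ} (hδ : 0 < δ) :
    ∃ K ⊆ Imm N ξ, IsCompact K ∧ ∀ w : ℂ, w.re ≤ -δ → Ψ w ∈ K := by
  obtain ⟨ρ, hρ, hs⟩ := Metric.nhds_basis_closedBall.mem_iff.1 (h.isOpen_imm.mem_nhds h.mem_imm)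
  have h1 := h.lim.eventually (closedBall_mem_nhds ξ hρ)
  obtain ⟨T, hT, hT'⟩ := mem_comap.1 h1
  obtain ⟨M, hM⟩ := mem_atBot_sets.1 hT
  have hcpt : IsCompact (Icc M (-δ) ×ℂ Icc 0 (2 * Real.pi)) := isCompact_Icc.reProdIm isCompact_Icc
  have hsub : (Icc M (-δ) ×ℂ Icc 0 (2 * Real.pi)) ⊆ HP := by
    intro w hw
    have := (mem_reProdIm.1 hw).1.2
    simp only [HP, mem_ofPred_eq]; linarith
  refine ⟨closedBall ξ ρ ∪ Ψ '' (Icc M (-δ) ×ℂ Icc 0 (2 * Real.pi)), union_subset hs ?_,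
    (isCompact_closedBall _ _).union (hcpt.image_of_continuousOn (h.Ψd.continuousOn.mono hsub)), fun w hw => ?_⟩
  · rintro _ ⟨w, hw, rfl⟩
    exact h.mem _ (hsub hw)
  · by_cases h2 : w.re ≤ M
    · exact Or.inl (hT' (hM _ h2))
    · right
      have hpi : 0 < 2 * Real.pi := by positivity
      obtain ⟨n, hn⟩ : ∃ n : ℤ, w.im + n * (2 * Real.pi) ∈ Ico 0 (0 + 2 * Real.pi) := by
        obtain ⟨n, hn, -⟩ := existsUnique_add_zsmul_mem_Ico hpi w.im 0
        exact ⟨n, by simpa using hn⟩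
      refine ⟨w + n * (2 * Real.pi * I), ?_, h.perZ w n⟩
      rw [mem_reProdIm]
      push Not at h2
      simp only [zero_add] at hn
      refine ⟨?_, ?_⟩
      · simpa using ⟨h2.le, hw⟩
      · simpa using ⟨hn.1, hn.2.le⟩

lemma exists_land (h : Lf N Pl ξ Ψ Z f b β s0 a0 lam) {E : Set ℂ} (hE : E ⊆ frontier (Imm N ξ))
    (hEc' : IsClosed (frontier (Imm N ξ) \ E)) {e : ℂ} (he : e ∈ E) : ∃ x, Ld Ψ E x := by
  have hecl := frontier_subset_closure (hE he)
  have hne : e - a0 ≠ 0 := sub_ne_zero.2 (h.ne_a0 hecl)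
  have hL0 : (e - a0)⁻¹ ≠ 0 := inv_ne_zero hne
  have hc : ContinuousAt (fun l : ℂ => l⁻¹ + a0) (e - a0)⁻¹ := (continuousAt_inv₀ hL0).add continuousAt_const
  have h1 : ∀ᶠ l in 𝓝 (e - a0)⁻¹, l ≠ 0 ∧ l⁻¹ + a0 ∈ (frontier (Imm N ξ) \ E)ᶜ :=
    (isOpen_ne.eventually_mem hL0).and (hc.eventually (hEc'.isOpen_compl.mem_nhds (by simp [he])))
  obtain ⟨r, hr, h2⟩ := Metric.eventually_nhds_iff.1 h1
  have hr3 : 0 < r / 4 := by linarith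
  obtain ⟨δ1, hδ1, hosc⟩ := h.bdd.osc (C := 2) (by norm_num) hr3
  obtain ⟨δ2, hδ2, hray⟩ := h.bdd.ray hr3
  obtain ⟨K, hKU, hKc, hK⟩ := h.deep (δ := min δ1 (δ2 / 2)) (by positivity)
  have hcont : ContinuousAt (fun z : ℂ => (z - a0)⁻¹) e := (continuousAt_id.sub continuousAt_const).inv₀ hne
  have heK : e ∉ K := fun hk => by
    have := hE he
    rw [h.isOpen_imm.frontier_eq] at this
    exact this.2 (hKU hk)
  have heξ : e ≠ ξ := fun hk => by
    have := hE he
    rw [h.isOpen_imm.frontier_eq] at this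
    exact this.2 (hk ▸ h.mem_imm)
  have h3 : ∀ᶠ z in 𝓝 e, z ∉ K ∧ z ≠ ξ ∧ dist (z - a0)⁻¹ (e - a0)⁻¹ < r / 4 :=
    (hKc.isClosed.isOpen_compl.eventually_mem heK).and ((isOpen_ne.eventually_mem heξ).and (hcont.eventually (ball_mem_nhds _ hr3)))
  obtain ⟨z, ⟨h4, h4', h5⟩, hzU⟩ := mem_closure_iff_nhds.1 hecl _ h3
  obtain ⟨w, hw, rfl⟩ := h.surj z hzU h4'
  have h6 : - min δ1 (δ2 / 2) < w.re := by
    by_contra hh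
    exact h4 (hK w (not_lt.1 hh))
  set s := -w.re with hs
  have hs0 : 0 < s := by have : w.re < 0 := hw; linarith
  have hs1 : s < δ1 := by linarith [min_le_left δ1 (δ2 / 2)]
  have hs2 : s < δ2 / 2 := by linarith [min_le_right δ1 (δ2 / 2)]
  obtain ⟨y, hy, L, hL, hb⟩ := hray (2 * s) (by linarith) (by linarith) w.im
  have h7 := hb s hs0 (by linarith)
  have h8 := hosc s hs0 hs1 w (-s + y * I) (by linarith) (by simp) ?_ (by linarith) (by simpa using hs1)
  · have h9 : dist L (e - a0)⁻¹ < r := by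
      calc dist L (e - a0)⁻¹ ≤ dist L (Ψ (-s + y * I) - a0)⁻¹ + dist (Ψ (-s + y * I) - a0)⁻¹ (Ψ w - a0)⁻¹
            + dist (Ψ w - a0)⁻¹ (e - a0)⁻¹ := dist_triangle4 _ _ _ _
        _ < r := by
          rw [← dist_eq_norm, dist_comm] at h7 h8
          linarith
    obtain ⟨h10, h11⟩ := h2 h9
    rcases h.land hL with h12 | ⟨-, h12, h13⟩
    · rw [h.th_iff] at h12
      exact absurd (tendsto_nhds_unique hL h12) h10
    · refine ⟨y, _, ?_, h13⟩
      by_contra hnE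
      exact h11 ⟨h12, hnE⟩
  · have e1 : w - (-s + y * I) = ((w.im - y : ℝ) : ℂ) * I := by
      apply Complex.ext <;> simp [hs]
    rw [e1, norm_mul, norm_real, norm_I, mul_one, Real.norm_eq_abs, abs_le]
    constructor <;> linarith [hy.1, hy.2]

end Lf
end NewtonPf
end

section
open Complex Metric Set Filter Topology

namespace NewtonPf

lemma log_pre {X : Type*} [TopologicalSpace X] {S : Set X} (hS : IsPreconnected S) {V : X → ℂ}
    (hV : ContinuousOn V S) (h1 : ∀ x ∈ S, ‖exp (V x) - 1‖ ≤ 1 / 2) :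
    ∃ n : ℤ, ∀ x ∈ S, ‖V x - n * (2 * Real.pi * I)‖ ≤ 3 / 2 * ‖exp (V x) - 1‖ := by
  rcases S.eq_empty_or_nonempty with rfl | ⟨x0, hx0⟩
  · exact ⟨0, fun x hx => absurd hx (notMem_empty x)⟩
  have hsl : ∀ x ∈ S, exp (V x) ∈ slitPlane := fun x hx => by
    have := mem_slitPlane_of_norm_lt_one ((h1 x hx).trans_lt (by norm_num))
    rwa [add_sub_cancel] at this
  have hL : ContinuousOn (fun x => log (exp (V x))) S := (continuous_exp.comp_continuousOn hV).clog hsl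
  obtain ⟨n, hn⟩ := exp_eq_exp_iff_exists_int.1 (exp_log (exp_ne_zero (V x0))).symm
  refine ⟨n, fun x hx => ?_⟩
  have h2 := exp_const hS hV hL (fun x _ => (exp_log (exp_ne_zero (V x))).symm) hx hx0
  have h3 : V x - n * (2 * Real.pi * I) = log (1 + (exp (V x) - 1)) := by
    rw [add_sub_cancel]; linear_combination h2 + hn
  rw [h3]
  exact norm_log_one_add_half_le_self (h1 x hx)

lemma log_conv {G : ℝ → ℂ} {l : ℂ} {δ : ℝ} (hδ : 0 < δ) (hG : ContinuousOn G (Ioo 0 δ))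
    (hl : Tendsto (fun s => exp (G s)) (𝓝[>] 0) (𝓝 (exp l))) :
    ∃ n : ℤ, Tendsto (fun s => G s - n * (2 * Real.pi * I)) (𝓝[>] 0) (𝓝 l) := by
  have h1 : Tendsto (fun s => exp (G s - l) - 1) (𝓝[>] 0) (𝓝 0) := by
    have := (hl.div_const (exp l)).sub_const 1
    rw [div_self (exp_ne_zero l), sub_self] at this
    simpa only [exp_sub] using this
  have h2 := h1.eventually (closedBall_mem_nhds 0 (show (0:ℝ) < 1 / 2 by norm_num))
  obtain ⟨δ', hδ', hs⟩ := mem_nhdsGT_iff_exists_Ioo_subset.1 h2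
  obtain ⟨n, hn⟩ := log_pre (S := Ioo 0 (min δ δ')) isPreconnected_Ioo (V := fun s => G s - l)
    ((hG.mono (Ioo_subset_Ioo_right (min_le_left _ _))).sub continuousOn_const)
    (fun s hs' => by
      have := hs (Ioo_subset_Ioo_right (min_le_right _ _) hs')
      simpa using this)
  refine ⟨n, tendsto_iff_norm_sub_tendsto_zero.2 ?_⟩
  have h3 := (tendsto_norm_zero.comp h1).const_mul (3 / 2 : ℝ)
  rw [mul_zero] at h3
  refine squeeze_zero' (Eventually.of_forall fun s => norm_nonneg _) ?_ h3
  have hδδ : 0 < min δ δ' := lt_min hδ hδ'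
  filter_upwards [Ioo_mem_nhdsGT hδδ] with s hs'
  have := hn s hs'
  have e : G s - n * (2 * Real.pi * I) - l = G s - l - n * (2 * Real.pi * I) := by ring
  rw [e]; exact this

lemma int_zero {n : ℤ} {C : ℝ} (hC : C < 6) (h : ‖(n : ℂ) * (2 * Real.pi * I)‖ ≤ C) : n = 0 := by
  have h1 : ‖(n : ℂ) * (2 * Real.pi * I)‖ = |(n : ℝ)| * (2 * Real.pi) := by
    rw [norm_mul, norm_mul, norm_mul, norm_I, norm_real, Real.norm_eq_abs, abs_of_pos Real.pi_pos, norm_intCast]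
    simp
  rw [h1] at h
  by_contra hn
  have h2 : (1 : ℝ) ≤ |(n : ℝ)| := by
    have := Int.one_le_abs hn
    exact_mod_cast this
  nlinarith [Real.pi_gt_three]

namespace Lf

variable {N : ℂ → ℂ} {Pl : Set ℂ} {ξ : ℂ} {Ψ Z f : ℂ → ℂ} {b β : ℝ → ℝ} {s0 : ℝ} {a0 lam : ℂ}

lemma ne_xi (h : Lf N Pl ξ Ψ Z f b β s0 a0 lam) {w : ℂ} (hw : w ∈ HP) : Ψ w - ξ ≠ 0 := by
  rw [← h.Zexp w hw]; exact exp_ne_zero _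

/-- pairs where the first point is deep relative to the second -/
def GG (Ψ : ℂ → ℂ) (ξ : ℂ) (Ω : Set (ℂ × ℂ)) : Set (ℂ × ℂ) :=
  {p | p ∈ Ω ∧ ∀ t : ℝ, 0 ≤ t → 2 * ‖Ψ (p.1 - t) - ξ‖ < ‖Ψ p.2 - ξ‖}

lemma gg_pre (h : Lf N Pl ξ Ψ Z f b β s0 a0 lam) {Ω : Set (ℂ × ℂ)} (hc : Convex ℝ Ω)
    (hH : ∀ p ∈ Ω, p.1 ∈ HP ∧ p.2 ∈ HP) (hd : ∀ p ∈ Ω, ∀ t : ℝ, 0 ≤ t → (p.1 - t, p.2) ∈ Ω) :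
    IsPreconnected (GG Ψ ξ Ω) := by
  have hdG : ∀ p ∈ GG Ψ ξ Ω, ∀ t : ℝ, 0 ≤ t → (p.1 - t, p.2) ∈ GG Ψ ξ Ω := by
    intro p hp t ht
    refine ⟨hd p hp.1 t ht, fun t' ht' => ?_⟩
    have := hp.2 (t + t') (by linarith)
    simpa [sub_sub] using this
  refine isPreconnected_of_forall_pair fun p hp q hq => ?_
  set K := segment ℝ p.2 q.2 with hK
  have hKc : IsCompact K := by rw [hK, segment_eq_image]; exact isCompact_Icc.image (by fun_prop)
  have hHc : Convex ℝ HP := convex_halfSpace_re_lt 0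
  have hKH : K ⊆ HP := hHc.segment_subset (hH p hp.1).2 (hH q hq.1).2
  obtain ⟨k, hk, hkm⟩ := hKc.exists_isMinOn (f := fun w => ‖Ψ w - ξ‖) ⟨_, left_mem_segment ℝ _ _⟩
    (((h.Ψd.continuousOn.mono hKH).sub continuousOn_const).norm)
  have hm : 0 < ‖Ψ k - ξ‖ := norm_pos_iff.2 (h.ne_xi (hKH hk))
  have h1 := h.lim.eventually (ball_mem_nhds ξ (half_pos hm))
  obtain ⟨S, hS, hS'⟩ := mem_comap.1 h1
  obtain ⟨M, hM⟩ := mem_atBot_sets.1 hS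
  have hM' : ∀ w : ℂ, w.re ≤ M → 2 * ‖Ψ w - ξ‖ < ‖Ψ k - ξ‖ := by
    intro w hw
    have : Ψ w ∈ ball ξ (‖Ψ k - ξ‖ / 2) := hS' (hM _ hw)
    rw [mem_ball, dist_eq_norm] at this
    linarith
  set T := max 0 (max (p.1.re - M) (q.1.re - M)) with hT
  have hT0 : 0 ≤ T := le_max_left _ _
  have hTp : p.1.re - T ≤ M := by linarith [(le_max_left (p.1.re - M) (q.1.re - M)).trans (le_max_right 0 _)]
  have hTq : q.1.re - T ≤ M := by linarith [(le_max_right (p.1.re - M) (q.1.re - M)).trans (le_max_right 0 _)]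
  have hray : ∀ p ∈ GG Ψ ξ Ω, (fun t : ℝ => (p.1 - t, p.2)) '' Icc 0 T ⊆ GG Ψ ξ Ω ∧
      IsPreconnected ((fun t : ℝ => (p.1 - t, p.2)) '' Icc 0 T) ∧ p ∈ (fun t : ℝ => (p.1 - t, p.2)) '' Icc 0 T ∧
      (p.1 - T, p.2) ∈ (fun t : ℝ => (p.1 - t, p.2)) '' Icc 0 T := by
    intro p hp
    refine ⟨?_, isPreconnected_Icc.image _ (by fun_prop), ⟨0, ⟨le_rfl, hT0⟩, by simp⟩, ⟨T, ⟨hT0, le_rfl⟩, rfl⟩⟩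
    rintro _ ⟨t, ht, rfl⟩
    exact hdG p hp t ht.1
  obtain ⟨p1, p2, p3, p4⟩ := hray p hp
  obtain ⟨q1, q2, q3, q4⟩ := hray q hq
  set Sg := segment ℝ ((p.1 - T, p.2) : ℂ × ℂ) (q.1 - T, q.2) with hSg
  have hSgG : Sg ⊆ GG Ψ ξ Ω := by
    intro r hr
    refine ⟨hc.segment_subset (hd p hp.1 T hT0) (hd q hq.1 T hT0) hr, fun t ht => ?_⟩
    obtain ⟨a, c, ha, hc', hac, rfl⟩ := hr
    have hk2 : a • p.2 + c • q.2 ∈ K := ⟨a, c, ha, hc', hac, rfl⟩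
    refine (hM' _ ?_).trans_le (hkm hk2)
    simp
    have k1 := mul_le_mul_of_nonneg_left hTp ha
    have k2 := mul_le_mul_of_nonneg_left hTq hc'
    have k3 : a * M + c * M = M := by rw [← add_mul, hac, one_mul]
    linarith
  refine ⟨_, union_subset (union_subset p1 hSgG) q1, Or.inl (Or.inl p3), Or.inr q3, ?_⟩
  refine IsPreconnected.union (q.1 - T, q.2) (Or.inr (right_mem_segment ℝ _ _)) q4 ?_ q2
  exact IsPreconnected.union (p.1 - T, p.2) p4 (left_mem_segment ℝ _ _) p2 (convex_segment _ _).isPreconnected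

lemma gg_log (h : Lf N Pl ξ Ψ Z f b β s0 a0 lam) {Ω : Set (ℂ × ℂ)} (hc : Convex ℝ Ω)
    (hH : ∀ p ∈ Ω, p.1 ∈ HP ∧ p.2 ∈ HP) (hd : ∀ p ∈ Ω, ∀ t : ℝ, 0 ≤ t → (p.1 - t, p.2) ∈ Ω) {Y : ℂ × ℂ → ℂ} {k : ℂ}
    (hY : ContinuousOn Y Ω) (hYe : ∀ p ∈ Ω, exp (Y p) = exp k * (1 - (Ψ p.1 - ξ) / (Ψ p.2 - ξ))) :
    ∃ c, exp c = exp k ∧ ∀ p ∈ GG Ψ ξ Ω, ‖Y p - c‖ ≤ 3 / 4 := by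
  have he : ∀ p ∈ GG Ψ ξ Ω, ‖exp (Y p - k) - 1‖ ≤ 1 / 2 := by
    intro p hp
    rw [exp_sub, hYe p hp.1, mul_div_cancel_left₀ _ (exp_ne_zero k)]
    have h1 := hp.2 0 le_rfl
    have h2 : 0 < ‖Ψ p.2 - ξ‖ := norm_pos_iff.2 (h.ne_xi (hH p hp.1).2)
    rw [show (1 - (Ψ p.1 - ξ) / (Ψ p.2 - ξ) - 1 : ℂ) = -((Ψ p.1 - ξ) / (Ψ p.2 - ξ)) by ring, norm_neg, norm_div,
      div_le_iff₀ h2]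
    simp at h1
    linarith
  obtain ⟨n, hn⟩ := log_pre (h.gg_pre hc hH hd) (V := fun p => Y p - k)
    ((hY.mono fun p hp => hp.1).sub continuousOn_const) he
  refine ⟨k + n * (2 * Real.pi * I), ?_, fun p hp => ?_⟩
  · rw [exp_add, exp_int_mul_two_pi_mul_I, mul_one]
  · have := (hn p hp).trans (mul_le_mul_of_nonneg_left (he p hp) (by norm_num))
    rw [← sub_sub]
    linarith

/-- pairs in cyclic order -/
def OO : Set (ℂ × ℂ) := {p | p.1.re < 0 ∧ p.2.re < 0 ∧ p.1.im < p.2.im ∧ p.2.im < p.1.im + 2 * Real.pi}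

lemma oo_open : IsOpen OO := by
  have c1 : Continuous fun p : ℂ × ℂ => p.1.re := continuous_re.comp continuous_fst
  have c2 : Continuous fun p : ℂ × ℂ => p.2.re := continuous_re.comp continuous_snd
  have c3 : Continuous fun p : ℂ × ℂ => p.1.im := continuous_im.comp continuous_fst
  have c4 : Continuous fun p : ℂ × ℂ => p.2.im := continuous_im.comp continuous_snd
  exact (isOpen_lt c1 continuous_const).and ((isOpen_lt c2 continuous_const).and
    ((isOpen_lt c3 c4).and (isOpen_lt c4 (c3.add continuous_const))))

lemma oo_convex : Convex ℝ OO := by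
  rintro p ⟨p1, p2, p3, p4⟩ q ⟨q1, q2, q3, q4⟩ a c ha hc hac
  have key : ∀ x y : ℝ, x < 0 → y < 0 → a * x + c * y < 0 := by
    intro x y hx hy
    rcases ha.eq_or_lt with rfl | ha
    · have : c = 1 := by linarith
      subst this; linarith
    · nlinarith
  have k3 := key _ _ (sub_neg.2 p3) (sub_neg.2 q3)
  have k4 := key _ _ (sub_neg.2 p4) (sub_neg.2 q4)
  have hpi : (a + c) * (2 * Real.pi) = 2 * Real.pi := by rw [hac, one_mul]
  refine ⟨?_, ?_, ?_, ?_⟩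
  · simpa using key _ _ p1 q1
  · simpa using key _ _ p2 q2
  · simp; linarith
  · simp; linarith

lemma exists_Y (h : Lf N Pl ξ Ψ Z f b β s0 a0 lam) : ∃ Y : ℂ × ℂ → ℂ, ∃ c : ℂ, ContinuousOn Y OO ∧
    (∀ p ∈ OO, exp (Y p) = (Ψ p.2 - Ψ p.1) / (Ψ p.2 - ξ)) ∧
    (∀ p ∈ OO, (∀ t : ℝ, 0 ≤ t → 2 * ‖Ψ (p.1 - t) - ξ‖ < ‖Ψ p.2 - ξ‖) → ‖Y p‖ ≤ 3 / 4) ∧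
    (∀ p ∈ OO, (∀ t : ℝ, 0 ≤ t → 2 * ‖Ψ (p.2 - t) - ξ‖ < ‖Ψ p.1 - ξ‖) → ‖Y p - Z p.1 + Z p.2 - c‖ ≤ 3 / 4) := by
  have hc1 : ContinuousOn (fun p : ℂ × ℂ => Ψ p.1) OO := h.Ψd.continuousOn.comp continuousOn_fst fun p hp => hp.1
  have hc2 : ContinuousOn (fun p : ℂ × ℂ => Ψ p.2) OO := h.Ψd.continuousOn.comp continuousOn_snd fun p hp => hp.2.1
  have hne : ∀ p ∈ OO, Ψ p.2 ≠ Ψ p.1 := by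
    rintro p ⟨p1, p2, p3, p4⟩ he
    obtain ⟨n, hn⟩ := h.inj _ p2 _ p1 he
    have e3 : p.2.im - p.1.im = n * (2 * Real.pi) := by rw [hn]; simp
    have hpi := Real.pi_pos
    have k1 : (0:ℝ) < n := by by_contra hh; push Not at hh; nlinarith
    have k2 : (n:ℝ) < 1 := by by_contra hh; push Not at hh; nlinarith
    norm_cast at k1 k2
    omega
  have hcd : ContinuousOn (fun p : ℂ × ℂ => (Ψ p.2 - Ψ p.1) / (Ψ p.2 - ξ)) OO :=
    (hc2.sub hc1).div (hc2.sub continuousOn_const) fun p hp => h.ne_xi hp.2.1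
  have hpi := Real.pi_pos
  obtain ⟨Y0, hY0c, hY0⟩ := exists_continuousOn_eqOn_exp_comp (simply_of_convex oo_convex
    ⟨(-1, -1 + I), by simp, by simp, by simp, by simp; linarith [Real.pi_gt_three]⟩) oo_open hcd (by
      rintro ⟨p, hp, h0⟩
      exact div_ne_zero (sub_ne_zero.2 (hne p hp)) (h.ne_xi hp.2.1) h0)
  have hY0 : ∀ p ∈ OO, exp (Y0 p) = (Ψ p.2 - Ψ p.1) / (Ψ p.2 - ξ) := fun p hp => hY0 hp
  obtain ⟨c0, hc0, hc0'⟩ := h.gg_log (k := 0) oo_convex (fun p hp => ⟨hp.1, hp.2.1⟩)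
    (fun p hp t ht => ⟨by have := hp.1; simp; linarith, hp.2.1, by simpa using hp.2.2.1, by simpa using hp.2.2.2⟩) hY0c
    (fun p hp => by
      rw [hY0 p hp]
      have := h.ne_xi hp.2.1
      simp only [exp_zero]; field_simp; ring)
  set Oh : Set (ℂ × ℂ) := Prod.swap ⁻¹' OO with hOh
  have hOc : Convex ℝ Oh := by
    intro p hp q hq a c ha hc hac
    exact oo_convex hp hq ha hc hac
  have hsw : ContinuousOn Prod.swap Oh := continuous_swap.continuousOn
  have hYc : ContinuousOn (fun p => Y0 p - c0) OO := hY0c.sub continuousOn_const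
  have hYe : ∀ p ∈ OO, exp (Y0 p - c0) = (Ψ p.2 - Ψ p.1) / (Ψ p.2 - ξ) := fun p hp => by
    rw [exp_sub, hc0, exp_zero, div_one, hY0 p hp]
  have hZ1 : ContinuousOn (fun p : ℂ × ℂ => Z p.1) OO := h.Zc.comp continuousOn_fst fun p hp => hp.1
  have hZ2 : ContinuousOn (fun p : ℂ × ℂ => Z p.2) OO := h.Zc.comp continuousOn_snd fun p hp => hp.2.1
  obtain ⟨c1, -, hc1'⟩ := h.gg_log (Ω := Oh) (k := Real.pi * I)
    (Y := fun p => (fun p => Y0 p - c0 - Z p.1 + Z p.2) p.swap) hOc (fun p hp => ⟨hp.2.1, hp.1⟩)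
    (fun p hp t ht => ⟨hp.1, by have := hp.2.1; simp at this ⊢; linarith, by simpa using hp.2.2.1, by simpa using hp.2.2.2⟩)
    (((hYc.sub hZ1).add hZ2).comp hsw fun p hp => hp)
    (fun p hp => by
      have e1 := h.ne_xi hp.1
      have e2 := h.ne_xi hp.2.1
      have z1 := h.Zexp _ hp.1
      have z2 := h.Zexp _ hp.2.1
      have z3 := hYe _ hp
      simp only [Prod.fst_swap, Prod.snd_swap] at e1 e2 z1 z2 z3 ⊢
      rw [exp_add, exp_sub, z3, z1, z2, exp_pi_mul_I]
      field_simp; ring)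
  refine ⟨fun p => Y0 p - c0, c1, hYc, hYe, fun p hp hpt => hc0' p ⟨hp, hpt⟩, fun p hp hpt => ?_⟩
  exact hc1' p.swap ⟨by simpa [hOh] using hp, hpt⟩

end Lf
end NewtonPf
end

section
open Complex Metric Set Filter Topology

namespace NewtonPf
namespace Lf

variable {N : ℂ → ℂ} {Pl : Set ℂ} {ξ : ℂ} {Ψ Z f : ℂ → ℂ} {b β : ℝ → ℝ} {s0 : ℝ} {a0 lam : ℂ}

lemma hp_shift {w : ℂ} (hw : w ∈ HP) (n : ℤ) : w + n * (2 * Real.pi * I) ∈ HP := by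
  simpa [HP] using hw

lemma zperZ (h : Lf N Pl ξ Ψ Z f b β s0 a0 lam) {w : ℂ} (hw : w ∈ HP) (n : ℤ) :
    Z (w + n * (2 * Real.pi * I)) = Z w + n * (2 * Real.pi * I) := by
  induction n with
  | zero => simp
  | succ n ih =>
    have := h.Zper _ (hp_shift hw (n : ℤ))
    rw [ih] at this
    push_cast at this ⊢
    rw [show w + (n + 1) * (2 * Real.pi * I) = w + n * (2 * Real.pi * I) + 2 * Real.pi * I by ring, this]; ring
  | pred n ih =>
    have := h.Zper _ (hp_shift hw (-(n : ℤ) - 1))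
    rw [show w + ((-(n : ℤ) - 1 : ℤ) : ℂ) * (2 * Real.pi * I) + 2 * Real.pi * I = w + (-(n : ℤ) : ℤ) * (2 * Real.pi * I) by
      push_cast; ring, ih] at this
    have e := eq_sub_of_add_eq this.symm
    rw [e]; push_cast; ring

lemma fray_c (h : Lf N Pl ξ Ψ Z f b β s0 a0 lam) (x : ℝ) : ContinuousOn (fun s : ℝ => f (-s + x * I)) (Ioo 0 s0) :=
  h.fc.comp (f := fun s : ℝ => (-s + x * I : ℂ)) (by fun_prop) fun s hs => by simpa using ⟨hs.2, hs.1⟩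

lemma fray_hp (h : Lf N Pl ξ Ψ Z f b β s0 a0 lam) {x s : ℝ} (hs : s ∈ Ioo 0 s0) :
    f (-s + x * I) ∈ HP ∧ N (Ψ (-s + x * I)) = Ψ (f (-s + x * I)) :=
  h.fre _ (by simpa using hs.2) (by simpa using hs.1)

lemma fray_t (h : Lf N Pl ξ Ψ Z f b β s0 a0 lam) (x : ℝ) :
    Tendsto (fun s : ℝ => f (-s + x * I)) (𝓝[>] 0) (𝓝 (b x * I)) := by
  rw [← h.fb]
  exact (h.fd x).hasDerivAt.continuousAt.tendsto.comp (ray_tendsto x)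

lemma exists_e (h : Lf N Pl ξ Ψ Z f b β s0 a0 lam) (x : ℝ) : ∃ n : ℤ, Th Ψ x →
    Tendsto (fun s : ℝ => Z (f (-s + x * I)) - Z (-s + x * I) - n * (2 * Real.pi * I)) (𝓝[>] 0) (𝓝 (log lam)) := by
  by_cases hx : Th Ψ x
  · have h1 : ContinuousOn (fun s : ℝ => Z (f (-s + x * I)) - Z (-s + x * I)) (Ioo 0 s0) :=
      (h.Zc.comp (h.fray_c x) fun s hs => (h.fray_hp hs).1).sub
        (h.Zc.comp (f := fun s : ℝ => (-s + x * I : ℂ)) (by fun_prop) fun s hs => ray_hp hs.1)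
    obtain ⟨n, hn⟩ := log_conv h.s0pos h1 (l := log lam) (by
      rw [exp_log h.lam0]
      refine (h.infx.comp hx).congr' ?_
      filter_upwards [Ioo_mem_nhdsGT h.s0pos] with s hs
      have := h.fray_hp hs (x := x)
      rw [exp_sub, h.Zexp _ this.1, h.Zexp _ (ray_hp hs.1), ← this.2]; rfl)
    exact ⟨n, fun _ => hn⟩
  · exact ⟨0, fun hh => absurd hh hx⟩

lemma deepb (h : Lf N Pl ξ Ψ Z f b β s0 a0 lam) {w : ℂ} (hw : w ∈ HP) :
    ∃ C : ℝ, ∀ t : ℝ, 0 ≤ t → 2 * ‖Ψ (w - t) - ξ‖ < C := by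
  have hw : w.re < 0 := hw
  obtain ⟨K, -, hK, hK2⟩ := h.deep (neg_pos.2 hw)
  obtain ⟨C, hC⟩ := hK.isBounded.subset_ball ξ
  refine ⟨2 * C, fun t ht => ?_⟩
  have := hC (hK2 (w - t) (by simpa using ht))
  rw [mem_ball, dist_eq_norm] at this
  linarith

lemma cob_big {g : ℝ → ℂ} {l : Filter ℝ} (hg : Tendsto g l (Bornology.cobounded ℂ)) (c : ℂ) (C : ℝ) :
    ∀ᶠ s in l, C < ‖g s - c‖ := by
  have h1 : Tendsto (fun s => g s - c) l (Bornology.cobounded ℂ) := by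
    simpa [sub_eq_add_neg, Function.comp_def] using (tendsto_add_const_cobounded (-c)).comp hg
  exact (tendsto_norm_atTop_iff_cobounded.2 h1).eventually (eventually_gt_atTop C)

lemma order (h : Lf N Pl ξ Ψ Z f b β s0 a0 lam) : ∃ e : ℝ → ℤ, ∀ x y, Th Ψ x → Th Ψ y → x < y → y < x + 2 * Real.pi →
    b x - 2 * Real.pi * e x < b y - 2 * Real.pi * e y ∧
      b y - 2 * Real.pi * e y < b x - 2 * Real.pi * e x + 2 * Real.pi := by
  choose e he using h.exists_e
  refine ⟨e, fun x y hx hy hxy hyx => ?_⟩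
  have hpi := Real.pi_pos
  have ex := he x hx
  have ey := he y hy
  set n := e x
  set m := e y
  set j : ℤ := ⌊((b y - 2 * Real.pi * m) - (b x - 2 * Real.pi * n)) / (2 * Real.pi)⌋ with hj
  have j1 : (b x - 2 * Real.pi * n) + 2 * Real.pi * j ≤ b y - 2 * Real.pi * m := by
    have := Int.floor_le (((b y - 2 * Real.pi * m) - (b x - 2 * Real.pi * n)) / (2 * Real.pi))
    rw [← hj, le_div_iff₀ (by positivity)] at this
    linarith
  have j2 : b y - 2 * Real.pi * m < (b x - 2 * Real.pi * n) + 2 * Real.pi * j + 2 * Real.pi := by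
    have := Int.lt_floor_add_one (((b y - 2 * Real.pi * m) - (b x - 2 * Real.pi * n)) / (2 * Real.pi))
    rw [← hj, div_lt_iff₀ (by positivity)] at this
    linarith
  have j3 : (b x - 2 * Real.pi * n) + 2 * Real.pi * j < b y - 2 * Real.pi * m := by
    refine lt_of_le_of_ne j1 fun hh => h.th_inj hxy hyx hx hy (m - n + j) ?_
    push_cast; linarith
  suffices hj0 : j = 0 by
    rw [hj0] at j2 j3
    push_cast at j2 j3
    constructor <;> linarith
  clear_value j n m
  clear hj j1 he
  obtain ⟨Y, c, hYc, hYe, hF1, hF2⟩ := h.exists_Y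
  set w : ℝ → ℂ := fun s => -s + x * I with hw
  set w' : ℝ → ℂ := fun s => -s + y * I with hw'
  set W : ℝ → ℂ := fun s => f (w s) + ((j - n : ℤ) : ℂ) * (2 * Real.pi * I) with hW
  set W' : ℝ → ℂ := fun s => f (w' s) + ((-m : ℤ) : ℂ) * (2 * Real.pi * I) with hW'
  have hwh : ∀ s ∈ Ioo 0 s0, w s ∈ HP := fun s hs => ray_hp hs.1
  have hwh' : ∀ s ∈ Ioo 0 s0, w' s ∈ HP := fun s hs => ray_hp hs.1
  have hWh : ∀ s ∈ Ioo 0 s0, W s ∈ HP := fun s hs => hp_shift (h.fray_hp hs).1 _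
  have hWh' : ∀ s ∈ Ioo 0 s0, W' s ∈ HP := fun s hs => hp_shift (h.fray_hp hs).1 _
  have hΨW : ∀ s ∈ Ioo 0 s0, Ψ (W s) = N (Ψ (w s)) := fun s hs => by rw [hW, (h.fray_hp hs).2]; exact h.perZ _ _
  have hΨW' : ∀ s ∈ Ioo 0 s0, Ψ (W' s) = N (Ψ (w' s)) := fun s hs => by rw [hW', (h.fray_hp hs).2]; exact h.perZ _ _
  have hs0 : ∀ᶠ s in 𝓝[>] (0:ℝ), s ∈ Ioo 0 s0 := Ioo_mem_nhdsGT h.s0pos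
  have him : Tendsto (fun s => (W s).im) (𝓝[>] 0) (𝓝 ((b x - 2 * Real.pi * n) + 2 * Real.pi * j)) := by
    have := (continuous_im.tendsto _).comp ((h.fray_t x).add_const (((j - n : ℤ) : ℂ) * (2 * Real.pi * I)))
    refine (this.congr fun s => rfl).trans (le_of_eq ?_)
    congr 1; simp; ring
  have him' : Tendsto (fun s => (W' s).im) (𝓝[>] 0) (𝓝 (b y - 2 * Real.pi * m)) := by
    have := (continuous_im.tendsto _).comp ((h.fray_t y).add_const (((-m : ℤ) : ℂ) * (2 * Real.pi * I)))
    refine (this.congr fun s => rfl).trans (le_of_eq ?_)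
    congr 1; simp; ring
  have hO : ∀ s ∈ Ioo 0 s0, ∀ s' ∈ Ioo 0 s0, (w s, w' s') ∈ OO := fun s hs s' hs' =>
    ⟨hwh s hs, hwh' s' hs', by simpa [hw, hw'] using hxy, by simpa [hw, hw'] using hyx⟩
  set l := 𝓝[>] (0:ℝ)
  have hfs : Tendsto (Prod.fst : ℝ × ℝ → ℝ) (l ×ˢ l) l := tendsto_fst
  have hsn : Tendsto (Prod.snd : ℝ × ℝ → ℝ) (l ×ˢ l) l := tendsto_snd
  have hOW : ∀ᶠ p : ℝ × ℝ in l ×ˢ l, (W p.1, W' p.2) ∈ OO := by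
    have h1 := (him.comp hfs).eventually_lt (him'.comp hsn) j3
    have h2 := (him'.comp hsn).eventually_lt ((him.comp hfs).add_const (2 * Real.pi)) j2
    filter_upwards [h1, h2, hfs.eventually hs0, hsn.eventually hs0] with p h1 h2 h3 h4
    exact ⟨hWh _ h3, hWh' _ h4, h1, h2⟩
  set V : ℝ × ℝ → ℂ := fun p => Y (W p.1, W' p.2) - Y (w p.1, w' p.2) with hV
  have hne : ∀ p ∈ OO, Ψ p.2 ≠ Ψ p.1 := fun p hp hh => exp_ne_zero (Y p) (by rw [hYe p hp, hh]; simp)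
  have hVe : Tendsto (fun p => exp (V p)) (l ×ˢ l) (𝓝 1) := by
    have hA : Tendsto (fun p : ℝ × ℝ => (N (Ψ (w' p.2)) - N (Ψ (w p.1))) / (Ψ (w' p.2) - Ψ (w p.1))) (l ×ˢ l) (𝓝 lam) := by
      rw [Metric.tendsto_nhds]
      intro ε hε
      obtain ⟨R, hR⟩ := h.infl ε hε
      have k1 := cob_big hx 0 R
      have k2 := cob_big hy 0 R
      filter_upwards [hfs.eventually k1, hsn.eventually k2, hfs.eventually hs0, hsn.eventually hs0] with p h1 h2 h3 h4
      rw [sub_zero] at h1 h2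
      rw [dist_eq_norm]
      exact hR _ _ h2 h1 (hne _ (hO _ h3 _ h4))
    have hB : Tendsto (fun p : ℝ × ℝ => (N (Ψ (w' p.2)) - ξ) / (Ψ (w' p.2) - ξ)) (l ×ˢ l) (𝓝 lam) :=
      (h.infx.comp hy).comp hsn
    have hAB := hA.div hB h.lam0
    rw [div_self h.lam0] at hAB
    refine hAB.congr' ?_
    filter_upwards [hOW, hfs.eventually hs0, hsn.eventually hs0] with p h1 h3 h4
    have k1 := sub_ne_zero.2 (hne _ (hO _ h3 _ h4))
    have k2 := h.ne_xi (hwh' _ h4)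
    have k3 := h.ne_xi (hWh' _ h4)
    simp only [hV, Pi.div_apply]
    rw [exp_sub, hYe _ h1, hYe _ (hO _ h3 _ h4)]
    simp only at k1 ⊢
    rw [hΨW' _ h4] at k3 ⊢
    rw [hΨW _ h3]
    field_simp
  have hall : ∀ᶠ p : ℝ × ℝ in l ×ˢ l, (p.1 ∈ Ioo 0 s0 ∧ p.2 ∈ Ioo 0 s0) ∧ (W p.1, W' p.2) ∈ OO ∧ ‖exp (V p) - 1‖ ≤ 1 / 2 := by
    have := hVe.eventually (closedBall_mem_nhds 1 (show (0:ℝ) < 1 / 2 by norm_num))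
    filter_upwards [hOW, hfs.eventually hs0, hsn.eventually hs0, this] with p h1 h2 h3 h4
    exact ⟨⟨h2, h3⟩, h1, by rwa [dist_eq_norm] at h4⟩
  obtain ⟨t, ht, hall⟩ := eventually_prod_self_iff'.1 hall
  obtain ⟨δ, hδ, hδt⟩ := mem_nhdsGT_iff_exists_Ioo_subset.1 ht
  have hδ : 0 < δ := hδ
  have hA : ∀ p ∈ Ioo 0 δ ×ˢ Ioo 0 δ, (p.1 ∈ Ioo 0 s0 ∧ p.2 ∈ Ioo 0 s0) ∧ (W p.1, W' p.2) ∈ OO ∧ ‖exp (V p) - 1‖ ≤ 1 / 2 :=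
    fun p hp => hall p.1 (hδt hp.1) p.2 (hδt hp.2)
  have hWc : ContinuousOn W (Ioo 0 s0) := (h.fray_c x).add continuousOn_const
  have hWc' : ContinuousOn W' (Ioo 0 s0) := (h.fray_c y).add continuousOn_const
  have hVc : ContinuousOn V (Ioo 0 δ ×ˢ Ioo 0 δ) := by
    refine (hYc.comp ((hWc.comp continuousOn_fst fun p hp => (hA p hp).1.1).prodMk
      (hWc'.comp continuousOn_snd fun p hp => (hA p hp).1.2)) fun p hp => (hA p hp).2.1).sub
      (hYc.comp (f := fun p : ℝ × ℝ => (w p.1, w' p.2)) (by fun_prop) fun p hp => hO _ (hA p hp).1.1 _ (hA p hp).1.2)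
  obtain ⟨M, hM⟩ := log_pre (isPreconnected_Ioo.prod isPreconnected_Ioo) hVc fun p hp => (hA p hp).2.2
  have hM : ∀ p ∈ Ioo 0 δ ×ˢ Ioo 0 δ, ‖V p - M * (2 * Real.pi * I)‖ ≤ 3 / 4 := fun p hp =>
    (hM p hp).trans (by linarith [(hA p hp).2.2])
  have hδe : ∀ᶠ s in l, s ∈ Ioo 0 δ := Ioo_mem_nhdsGT hδ
  have tWx : Tendsto (fun s => Ψ (W s)) l (Bornology.cobounded ℂ) := by
    refine Tendsto.congr' ?_ ((tendsto_norm_atTop_iff_cobounded.1 h.inf).comp hx)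
    filter_upwards [hs0] with s hs using (hΨW s hs).symm
  have tWy : Tendsto (fun s => Ψ (W' s)) l (Bornology.cobounded ℂ) := by
    refine Tendsto.congr' ?_ ((tendsto_norm_atTop_iff_cobounded.1 h.inf).comp hy)
    filter_upwards [hs0] with s hs using (hΨW' s hs).symm
  have hM0 : M = 0 := by
    have hd2 : δ / 2 ∈ Ioo 0 δ := ⟨by linarith, by linarith⟩
    have hd3 := (hA (δ / 2, δ / 2) ⟨hd2, hd2⟩).1.1
    obtain ⟨C1, hC1⟩ := h.deepb (hwh _ hd3)
    obtain ⟨C2, hC2⟩ := h.deepb (hWh _ hd3)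
    obtain ⟨s', k1, k2, k3⟩ := (hδe.and ((cob_big hy ξ C1).and (cob_big tWy ξ C2))).exists
    have kA := hA (δ / 2, s') ⟨hd2, k1⟩
    have kM := hM (δ / 2, s') ⟨hd2, k1⟩
    have y1 := hF1 _ (hO _ kA.1.1 _ kA.1.2) fun t ht => (hC1 t ht).trans k2
    have y2 := hF1 _ kA.2.1 fun t ht => (hC2 t ht).trans k3
    refine int_zero (C := 9 / 4) (by norm_num) ?_
    calc _ = ‖(Y (W (δ / 2), W' s') - Y (w (δ / 2), w' s')) - (V (δ / 2, s') - M * (2 * Real.pi * I))‖ := by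
            congr 1; simp only [hV]; ring
      _ ≤ _ := by linarith [norm_sub_le (Y (W (δ / 2), W' s') - Y (w (δ / 2), w' s')) (V (δ / 2, s') - M * (2 * Real.pi * I)),
            norm_sub_le (Y (W (δ / 2), W' s')) (Y (w (δ / 2), w' s'))]
  have hb2 := closedBall_mem_nhds (log lam) (show (0:ℝ) < 1 / 2 by norm_num)
  obtain ⟨s', q1, q2⟩ := (hδe.and (ey.eventually hb2)).exists
  have hd3 := (hA (s', s') ⟨q1, q1⟩).1.1
  obtain ⟨C1, hC1⟩ := h.deepb (hwh' _ hd3)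
  obtain ⟨C2, hC2⟩ := h.deepb (hWh' _ hd3)
  obtain ⟨s, k0, k1, k2, k3⟩ := ((ex.eventually hb2).and (hδe.and ((cob_big hx ξ C1).and (cob_big tWx ξ C2)))).exists
  have kA := hA (s, s') ⟨k1, q1⟩
  have kM := hM (s, s') ⟨k1, q1⟩
  have y1 := hF2 _ (hO _ kA.1.1 _ kA.1.2) fun t ht => (hC1 t ht).trans k2
  have y2 := hF2 _ kA.2.1 fun t ht => (hC2 t ht).trans k3
  simp only [hM0, Int.cast_zero, zero_mul, sub_zero, hV] at kM
  rw [dist_eq_norm] at k0 q2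
  have z1 : Z (W s) = Z (f (w s)) + ((j - n : ℤ) : ℂ) * (2 * Real.pi * I) := h.zperZ (h.fray_hp kA.1.1).1 _
  have z2 : Z (W' s') = Z (f (w' s')) + ((-m : ℤ) : ℂ) * (2 * Real.pi * I) := h.zperZ (h.fray_hp kA.1.2).1 _
  simp only [z1, z2] at y1 y2
  push_cast at y1 y2
  refine int_zero (C := 13 / 4) (by norm_num) ?_
  set y3 := Y (W s, W' s')
  set y4 := Y (w s, w' s')
  have e : (j : ℂ) * (2 * Real.pi * I) = (y3 - y4) + (y4 - Z (w s) + Z (w' s') - c)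
    - (y3 - (Z (f (w s)) + (j - n) * (2 * Real.pi * I)) + (Z (f (w' s')) + -m * (2 * Real.pi * I)) - c)
    - (Z (f (w s)) - Z (w s) - n * (2 * Real.pi * I) - log lam)
    + (Z (f (w' s')) - Z (w' s') - m * (2 * Real.pi * I) - log lam) := by ring
  rw [e]
  refine (norm_add_le _ _).trans ?_
  refine (add_le_add ((norm_sub_le _ _).trans (add_le_add ((norm_sub_le _ _).trans
    (add_le_add ((norm_add_le _ _).trans (add_le_add kM y1)) y2)) k0)) q2).trans ?_
  norm_num

end Lf
end NewtonPf
end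

section
open Complex Metric Set Filter Topology

namespace NewtonPf

lemma seq_lem {c : ℕ → ℝ} {g : ℝ → ℝ} {e : ℕ → ℤ} (hg : Continuous g) (hm : StrictMono g) (hc : StrictMono c)
    (hb : BddAbove (range c)) (hr : ∀ n, c (n + 1) - c n = g (c n) - 2 * Real.pi * e n) : False := by
  have hpi := Real.pi_gt_three
  have h1 := tendsto_atTop_ciSup hc.monotone hb
  have h2 := h1.comp (tendsto_add_atTop_nat 1)
  have hd : Tendsto (fun n => c (n + 1) - c n) atTop (𝓝 0) := by simpa using h2.sub h1
  have hG : Tendsto (fun n => g (c (n + 1)) - g (c n)) atTop (𝓝 0) := by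
    simpa using ((hg.tendsto _).comp h2).sub ((hg.tendsto _).comp h1)
  have hE := hG.sub ((hd.comp (tendsto_add_atTop_nat 1)).sub hd)
  simp only [sub_zero] at hE
  obtain ⟨n0, hn0⟩ := eventually_atTop.1 (hE.eventually (ball_mem_nhds 0 one_pos))
  have hinc : ∀ n ≥ n0, c (n + 1) - c n ≤ c (n + 1 + 1) - c (n + 1) := by
    intro n hn
    have k := hn0 n hn
    simp only [Function.comp_def, dist_zero_right, Real.norm_eq_abs] at k
    have k2 : g (c (n + 1)) - g (c n) - (c (n + 1 + 1) - c (n + 1) - (c (n + 1) - c n)) =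
      2 * Real.pi * ((e (n + 1) - e n : ℤ) : ℝ) := by rw [hr, hr]; push_cast; ring
    rw [k2, abs_mul, abs_of_pos (by linarith)] at k
    have k3 : e (n + 1) - e n = 0 := by
      by_contra hne
      have : (1:ℝ) ≤ |((e (n + 1) - e n : ℤ) : ℝ)| := by exact_mod_cast Int.one_le_abs hne
      nlinarith
    rw [k3] at k2
    have := hm (hc (Nat.lt_succ_self n))
    push_cast at k2
    simp only [Nat.succ_eq_add_one] at this
    linarith
  have hge : ∀ n ≥ n0, c (n0 + 1) - c n0 ≤ c (n + 1) - c n := by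
    intro n hn
    induction n, hn using Nat.le_induction with
    | base => exact le_rfl
    | succ n hn ih => exact ih.trans (hinc n hn)
  have := ge_of_tendsto hd (eventually_atTop.2 ⟨n0, hge⟩)
  linarith [hc (Nat.lt_succ_self n0)]

lemma orbit_fix {Θ : ℝ → Prop} {b : ℝ → ℝ} {e : ℝ → ℤ} (hb : Continuous b) (hm : StrictMono fun x => b x - x)
    (hΘ : ∀ x, Θ x → Θ (b x - 2 * Real.pi * e x))
    (ho : ∀ x y, Θ x → Θ y → x < y → y < x + 2 * Real.pi → b x - 2 * Real.pi * e x < b y - 2 * Real.pi * e y ∧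
      b y - 2 * Real.pi * e y < b x - 2 * Real.pi * e x + 2 * Real.pi)
    {x0 c : ℝ} (h0 : Θ x0) (hf : b x0 - 2 * Real.pi * e x0 = x0) (hc : Θ c) (hc1 : x0 < c) (hc2 : c < x0 + 2 * Real.pi) :
    b c - 2 * Real.pi * e c = c := by
  set F : ℝ → ℝ := fun x => b x - 2 * Real.pi * e x with hF
  set u : ℕ → ℝ := fun n => F^[n] c with hu
  have hu1 : ∀ n, u (n + 1) = F (u n) := fun n => Function.iterate_succ_apply' F n c
  have hin : ∀ n, Θ (u n) ∧ x0 < u n ∧ u n < x0 + 2 * Real.pi := by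
    intro n
    induction n with
    | zero => exact ⟨hc, hc1, hc2⟩
    | succ n ih =>
      rw [hu1]
      have := ho x0 (u n) h0 ih.1 ih.2.1 ih.2.2
      rw [hf] at this
      exact ⟨hΘ _ ih.1, this⟩
  rcases lt_trichotomy (F c) c with hlt | heq | hgt
  · exfalso
    have hs : ∀ n, u (n + 1) < u n := by
      intro n
      induction n with
      | zero => exact hlt
      | succ n ih =>
        rw [hu1 (n + 1), hu1 n]
        rw [hu1 n] at ih
        have h1 := hin (n + 1)
        rw [hu1 n] at h1
        exact (ho _ _ h1.1 (hin n).1 ih (by linarith [(hin n).2.2, h1.2.1])).1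
    refine seq_lem (c := fun n => - u n) (g := fun x => -(b (-x) - (-x))) (e := fun n => -e (u n)) (by fun_prop)
      (fun x y hxy => neg_lt_neg (hm (neg_lt_neg hxy))) (strictMono_nat_of_lt_succ fun n => neg_lt_neg (hs n))
      ⟨-x0, by rintro _ ⟨n, rfl⟩; exact neg_le_neg (hin n).2.1.le⟩ fun n => ?_
    simp only [hu1, hF, neg_neg]; push_cast; ring
  · exact heq
  · exfalso
    have hs : ∀ n, u n < u (n + 1) := by
      intro n
      induction n with
      | zero => exact hgt
      | succ n ih =>
        rw [hu1 (n + 1)]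
        nth_rw 1 [hu1 n]
        exact (ho _ _ (hin n).1 (hin (n + 1)).1 ih (by linarith [(hin n).2.1, (hin (n + 1)).2.2])).1
    refine seq_lem (g := fun x => b x - x) (e := fun n => e (u n)) (by fun_prop) hm (strictMono_nat_of_lt_succ hs)
      ⟨x0 + 2 * Real.pi, by rintro _ ⟨n, rfl⟩; exact (hin n).2.2.le⟩ fun n => ?_
    simp only [hu1, hF]; ring

namespace Lf

variable {N : ℂ → ℂ} {Pl : Set ℂ} {ξ : ℂ} {Ψ Z f : ℂ → ℂ} {b β : ℝ → ℝ} {s0 : ℝ} {a0 lam : ℂ}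

lemma th_g (h : Lf N Pl ξ Ψ Z f b β s0 a0 lam) {x0 c : ℝ} {m : ℤ} (hb : b x0 = x0 + 2 * Real.pi * m)
    (h1 : x0 < c) (h2 : c < x0 + 2 * Real.pi) (hc : Th Ψ c) : ∃ k : ℤ, b c = c + 2 * Real.pi * k := by
  obtain ⟨e, he⟩ := h.order
  have := orbit_fix (Θ := Th Ψ) (e := fun x => e x + (m - e x0)) h.bcont h.gmono (fun x hx => by
      have := (h.th_shift (-(e x + (m - e x0)))).2 (h.th_b hx)
      push_cast at this ⊢
      convert this using 1; ring)
    (fun x y hx hy hxy hyx => by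
      have := he x y hx hy hxy hyx
      push_cast
      constructor <;> linarith) (h.th_fix hb) (by push_cast; linarith) hc h1 h2
  exact ⟨e c + (m - e x0), by linarith⟩

lemma g_surj (h : Lf N Pl ξ Ψ Z f b β s0 a0 lam) (y : ℝ) : ∃ x, b x - x = y := by
  obtain ⟨k, hk, hbk⟩ := h.bper
  have hpi := Real.pi_pos
  have hsh : ∀ n : ℕ, ∀ x, b (x + 2 * Real.pi * n) = b x + 2 * Real.pi * k * n := by
    intro n x
    induction n with
    | zero => simp
    | succ n ih =>
      rw [show x + 2 * Real.pi * (n + 1 : ℕ) = x + 2 * Real.pi * n + 2 * Real.pi by push_cast; ring, hbk, ih]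
      push_cast; ring
  obtain ⟨n, hn⟩ := exists_nat_ge (|y - b 0|)
  have hk' : (2:ℝ) ≤ k := by exact_mod_cast hk
  have ha := abs_le.1 hn
  have hp3 := Real.pi_gt_three
  have hn0 : (0:ℝ) ≤ n := Nat.cast_nonneg n
  have hkey : (n:ℝ) ≤ 2 * Real.pi * n * (k - 1) := by
    have : (1:ℝ) ≤ 2 * Real.pi * (k - 1) := by nlinarith
    nlinarith
  have hgc : Continuous fun x => b x - x := h.bcont.sub continuous_id
  refine mem_range_of_exists_le_of_exists_ge hgc ⟨-(2 * Real.pi * n), ?_⟩ ⟨2 * Real.pi * n, ?_⟩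
  · have := hsh n (-(2 * Real.pi * n))
    rw [neg_add_cancel] at this
    linarith
  · have := hsh n 0
    rw [zero_add] at this
    linarith

lemma not_th {S : Set ℂ} {x : ℝ} (h1 : Ld Ψ S x) (h2 : Th Ψ x) : False := by
  obtain ⟨z, -, hz⟩ := h1
  have := (tendsto_norm_atTop_iff_cobounded.2 h2)
  exact not_tendsto_nhds_of_tendsto_atTop this _ hz.norm

lemma contra (h : Lf N Pl ξ Ψ Z f b β s0 a0 lam) {E : Set ℂ} (hE : E ⊆ frontier (Imm N ξ)) (hEc : IsClosed E)
    (hEc' : IsClosed (frontier (Imm N ξ) \ E)) {a : ℂ} (ha : a ∈ E) (hP : ∀ q ∈ Pl, q ∉ E) : False := by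
  have hpi := Real.pi_pos
  obtain ⟨α, hα⟩ := h.exists_land hE hEc' ha
  set m : ℤ := ⌊(b α - α) / (2 * Real.pi)⌋ with hm
  have m1 : 2 * Real.pi * m ≤ b α - α := by
    have := Int.floor_le ((b α - α) / (2 * Real.pi))
    rw [← hm, le_div_iff₀ (by positivity)] at this
    linarith
  have m2 : b α - α < 2 * Real.pi * (m + 1) := by
    have := Int.lt_floor_add_one ((b α - α) / (2 * Real.pi))
    rw [← hm, div_lt_iff₀ (by positivity)] at this
    linarith
  clear_value m
  obtain ⟨u, hu⟩ := h.g_surj (2 * Real.pi * m)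
  obtain ⟨v, hv⟩ := h.g_surj (2 * Real.pi * (m + 1))
  have hub : b u = u + 2 * Real.pi * m := by linarith
  have hvb : b v = v + 2 * Real.pi * (m + 1 : ℤ) := by push_cast; linarith
  have hgm := h.gmono
  have hbm : StrictMono b := fun x y hxy => by have := hgm hxy; simp only at this; linarith
  have hlt : ∀ {x y}, b x - x < b y - y → x < y := fun {x y} hxy => hgm.lt_iff_lt.1 hxy
  have hαu : α ≠ u := by rintro rfl; exact not_th hα (h.th_fix hub)
  have u1 : u < α := by
    have : u ≤ α := hgm.le_iff_le.1 (show b u - u ≤ b α - α by linarith)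
    exact lt_of_le_of_ne this hαu.symm
  have v1 : α < v := hlt (by linarith)
  have vu : v ≤ u + 2 * Real.pi := by
    obtain ⟨k, hk, hbk⟩ := h.bper
    refine hgm.le_iff_le.1 (show b v - v ≤ b (u + 2 * Real.pi) - (u + 2 * Real.pi) from ?_)
    have hk' : (2:ℝ) ≤ k := by exact_mod_cast hk
    rw [hv, hbk]
    nlinarith
  obtain ⟨t, ht, htb⟩ := intermediate_value_Ioo (u1.trans v1).le h.bcont.continuousOn
    (show v + 2 * Real.pi * m ∈ Ioo (b u) (b v) from ⟨by linarith, by rw [hvb]; push_cast; linarith⟩)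
  have hvt := h.th_fix hvb
  have htθ : Th Ψ (b t) := by rw [htb]; exact (h.th_shift m).2 hvt
  obtain hh | ⟨q, hq, hqf, hqt⟩ := h.cut htθ
  · exact h.th_inj ht.2 (by linarith [ht.1]) hh hvt 1 (by rw [hvb, htb]; push_cast; ring)
  have hLt : Ld Ψ (frontier (Imm N ξ) \ E) t := ⟨q, ⟨hqf, hP q hq⟩, hqt⟩
  have hαt : α ≠ t := by
    rintro rfl
    obtain ⟨z, hz, hzt⟩ := hα
    have := tendsto_nhds_unique hzt hqt
    exact hP q hq (this ▸ hz)
  have hfin : ∃ c ∈ Ioo u v, Th Ψ c := by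
    rcases lt_or_gt_of_ne hαt with hlt | hgt
    · obtain ⟨c, hc, hcΘ⟩ := h.bisect hE sdiff_subset hEc hEc' (fun z hz => by
        by_cases hz' : z ∈ E
        · exact Or.inl hz'
        · exact Or.inr ⟨hz, hz'⟩) (fun z h1 h2 => h2.2 h1) hlt hα hLt
      exact ⟨c, ⟨u1.trans_le hc.1, hc.2.trans_lt ht.2⟩, hcΘ⟩
    · obtain ⟨c, hc, hcΘ⟩ := h.bisect sdiff_subset hE hEc' hEc (fun z hz => by
        by_cases hz' : z ∈ E
        · exact Or.inr hz'
        · exact Or.inl ⟨hz, hz'⟩) (fun z h1 h2 => h1.2 h2) hgt hLt hα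
      exact ⟨c, ⟨ht.1.trans_le hc.1, hc.2.trans_lt v1⟩, hcΘ⟩
  obtain ⟨c, hc, hcΘ⟩ := hfin
  obtain ⟨k, hk⟩ := h.th_g hub hc.1 (hc.2.trans_le vu) hcΘ
  have g1 := hgm hc.1
  have g2 := hgm hc.2
  simp only [hu, hv, hk] at g1 g2
  have k1 : (m:ℝ) < k := by by_contra hh; push Not at hh; nlinarith
  have k2 : (k:ℝ) < m + 1 := by by_contra hh; push Not at hh; nlinarith
  norm_cast at k1 k2
  omega

lemma concl (h : Lf N Pl ξ Ψ Z f b β s0 a0 lam) {w : ℂ} (hw : w ∈ frontier (Imm N ξ)) :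
    ∃ q ∈ Pl, q ∈ connectedComponentIn (frontier (Imm N ξ)) w := by
  classical
  set A := frontier (Imm N ξ) with hA
  have hAc : IsClosed A := isClosed_frontier
  set P : ℕ → Prop := fun n => ∃ E ⊆ A, IsClosed E ∧ IsClosed (A \ E) ∧ w ∈ E ∧ (E ∩ Pl).ncard = n with hP
  have hex : ∃ n, P n := ⟨_, A, Subset.rfl, hAc, by simp, hw, rfl⟩
  obtain ⟨E, hEA, hEc, hEc', hwE, hEn⟩ := Nat.find_spec hex
  have hmin : ∀ E' ⊆ E, IsClosed E' → IsClosed (A \ E') → w ∈ E' → (∃ q ∈ Pl, q ∈ E ∧ q ∉ E') → False := by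
    rintro E' hE' h1 h2 h3 ⟨q, hq, hqE, hqE'⟩
    refine Nat.find_min hex ?_ ⟨E', hE'.trans hEA, h1, h2, h3, rfl⟩
    rw [← hEn]
    refine ncard_lt_ncard ⟨inter_subset_inter_left _ hE', fun hh => hqE' (hh ⟨hqE, hq⟩).1⟩ (h.plfin.subset inter_subset_right)
  have hpol : ∀ E' ⊆ A, IsClosed E' → IsClosed (A \ E') → E'.Nonempty → ∃ q ∈ Pl, q ∈ E' := by
    rintro E' hE' h1 h2 ⟨a, ha⟩
    by_contra hcon
    push Not at hcon
    exact h.contra hE' h1 h2 ha hcon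
  have hpre : IsPreconnected E := by
    rw [isPreconnected_closed_iff]
    intro t t' ht ht' hs h1 h2
    by_contra hcon
    rw [not_nonempty_iff_eq_empty] at hcon
    have hd : ∀ z ∈ E, z ∈ t → z ∈ t' → False := fun z hz h1 h2 => by
      have : z ∈ E ∩ (t ∩ t') := ⟨hz, h1, h2⟩
      rw [hcon] at this; exact this
    have key : ∀ t t' : Set ℂ, IsClosed t → IsClosed t' → E ⊆ t ∪ t' → (∀ z ∈ E, z ∈ t → z ∈ t' → False) →
        IsClosed (A \ (E ∩ t)) := by
      intro t t' ht ht' hs hd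
      have : A \ (E ∩ t) = (A \ E) ∪ (E ∩ t') := by
        ext z
        constructor
        · rintro ⟨hz, hz'⟩
          by_cases hzE : z ∈ E
          · exact Or.inr ⟨hzE, (hs hzE).resolve_left fun hh => hz' ⟨hzE, hh⟩⟩
          · exact Or.inl ⟨hz, hzE⟩
        · rintro (⟨hz, hz'⟩ | ⟨hz, hz'⟩)
          · exact ⟨hz, fun hh => hz' hh.1⟩
          · exact ⟨hEA hz, fun hh => hd z hz hh.2 hz'⟩
      rw [this]
      exact hEc'.union (hEc.inter ht')
    have hs' : E ⊆ t' ∪ t := by rwa [union_comm]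
    have hd' : ∀ z ∈ E, z ∈ t' → z ∈ t → False := fun z hz h1 h2 => hd z hz h2 h1
    obtain ⟨q, hq, hqt⟩ := hpol _ (inter_subset_left.trans hEA) (hEc.inter ht) (key t t' ht ht' hs hd) h1
    obtain ⟨q', hq', hqt'⟩ := hpol _ (inter_subset_left.trans hEA) (hEc.inter ht') (key t' t ht' ht hs' hd') h2
    rcases hs hwE with hwt | hwt
    · exact hmin (E ∩ t) inter_subset_left (hEc.inter ht) (key t t' ht ht' hs hd) ⟨hwE, hwt⟩
        ⟨q', hq', hqt'.1, fun hh => hd _ hqt'.1 hh.2 hqt'.2⟩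
    · exact hmin (E ∩ t') inter_subset_left (hEc.inter ht') (key t' t ht' ht hs' hd') ⟨hwE, hwt⟩
        ⟨q, hq, hqt.1, fun hh => hd _ hqt.1 hqt.2 hh.2⟩
  obtain ⟨q, hq, hqE⟩ := hpol E hEA hEc hEc' ⟨w, hwE⟩
  exact ⟨q, hq, hpre.subset_connectedComponentIn hwE hEA hqE⟩

end Lf
end NewtonPf
end

section
open Complex Metric Set Filter Topology

namespace NewtonPf

lemma max_le {g : ℂ → ℂ} (hg : DifferentiableOn ℂ g (ball 0 1))
    (hb : ∀ ε > 0, ∃ r' < 1, ∀ z, r' ≤ ‖z‖ → ‖z‖ < 1 → ‖g z‖ ≤ 1 + ε) {z : ℂ} (hz : ‖z‖ < 1) : ‖g z‖ ≤ 1 := by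
  refine le_of_forall_pos_le_add fun ε hε => ?_
  obtain ⟨r', h1, h2⟩ := hb ε hε
  obtain ⟨ρ, h3, h4⟩ := exists_between (show max (max r' ‖z‖) 0 < 1 by simp [h1, hz])
  have h5 : r' < ρ ∧ ‖z‖ < ρ ∧ 0 < ρ := by
    rw [max_lt_iff, max_lt_iff] at h3; exact ⟨h3.1.1, h3.1.2, h3.2⟩
  refine norm_le_of_forall_mem_frontier_norm_le (U := ball 0 ρ) isBounded_ball ?_ ?_ (subset_closure (by simpa using h5.2.1))
  · refine DifferentiableOn.diffContOnCl (hg.mono ?_)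
    rw [closure_ball _ h5.2.2.ne']
    exact closedBall_subset_ball h4
  · intro w hw
    rw [frontier_ball _ h5.2.2.ne'] at hw
    have : ‖w‖ = ρ := by simpa using hw
    exact h2 w (by rw [this]; exact h5.1.le) (by rw [this]; exact h4)

/-- Blaschke product -/
noncomputable def Bl (S : Finset ℂ) (n : ℂ → ℕ) (z : ℂ) : ℂ := ∏ u ∈ S, ((z - u) / (1 - (starRingEnd ℂ) u * z)) ^ n u

lemma den_ne {u z : ℂ} (hu : ‖u‖ < 1) (hz : ‖z‖ ≤ 1) : 1 - (starRingEnd ℂ) u * z ≠ 0 := by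
  intro h
  have h1 : ‖(starRingEnd ℂ) u * z‖ = 1 := by rw [← sub_eq_zero.1 h]; simp
  rw [norm_mul, RCLike.norm_conj] at h1
  nlinarith [norm_nonneg u, norm_nonneg z]

lemma bl_fac_le {u z : ℂ} (hu : ‖u‖ < 1) (hz : ‖z‖ ≤ 1) : ‖(z - u) / (1 - (starRingEnd ℂ) u * z)‖ ≤ 1 := by
  rw [norm_div]
  refine div_le_one_of_le₀ ?_ (norm_nonneg _)
  have h := moebius_key u z
  refine abs_le_of_sq_le_sq' ?_ (norm_nonneg _) |>.2
  have h1 : 0 ≤ (1 - ‖u‖ ^ 2) * (1 - ‖z‖ ^ 2) := by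
    apply mul_nonneg <;> nlinarith [norm_nonneg u, norm_nonneg z]
  linarith

lemma bl_fac_eq {u z : ℂ} (hu : ‖u‖ < 1) (hz : ‖z‖ = 1) : ‖(z - u) / (1 - (starRingEnd ℂ) u * z)‖ = 1 := by
  rw [norm_div, div_eq_one_iff_eq (norm_ne_zero_iff.2 (den_ne hu hz.le))]
  have h := moebius_key u z
  rw [hz] at h
  rw [← sq_eq_sq₀ (norm_nonneg _) (norm_nonneg _)]; linarith

lemma bl_cont {S : Finset ℂ} {n : ℂ → ℕ} (hS : ∀ u ∈ S, ‖u‖ < 1) : ContinuousOn (Bl S n) (closedBall 0 1) := by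
  refine continuousOn_finsetProd _ fun u hu => ContinuousOn.pow (ContinuousOn.div (by fun_prop) (by fun_prop) ?_) _
  intro z hz
  exact den_ne (hS u hu) (by simpa using hz)

lemma blaschke {B : ℂ → ℂ} (hB : DifferentiableOn ℂ B (ball 0 1)) (hm : ∀ z, ‖z‖ < 1 → ‖B z‖ < 1)
    (hp : ∀ r < 1, ∃ r' < 1, ∀ z, r' ≤ ‖z‖ → ‖z‖ < 1 → r ≤ ‖B z‖) :
    ∃ (S : Finset ℂ) (n : ℂ → ℕ) (c : ℂ), ‖c‖ = 1 ∧ (∀ u ∈ S, ‖u‖ < 1) ∧ ∀ z, ‖z‖ < 1 → B z = c * Bl S n z := by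
  have han : AnalyticOnNhd ℂ B (ball 0 1) := hB.analyticOnNhd isOpen_ball
  obtain ⟨r1, hr1, hr1'⟩ := hp (1 / 2) (by norm_num)
  have hord : ∀ u : ball (0 : ℂ) 1, analyticOrderAt B u ≠ ⊤ := by
    intro u hu
    have h1 := han.eqOn_zero_of_preconnected_of_eventuallyEq_zero (convex_ball 0 1).isPreconnected u.2
      (analyticOrderAt_eq_top.1 hu)
    obtain ⟨ρ, h3, h4⟩ := exists_between (show max r1 0 < 1 by simp [hr1])
    have h5 : r1 < ρ ∧ 0 < ρ := by simpa using h3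
    have hn : ‖(ρ : ℂ)‖ = ρ := by simp [h5.2.le]
    have h6 := hr1' ρ (by rw [hn]; exact h5.1.le) (by rwa [hn])
    rw [h1 (by simpa [abs_of_pos h5.2] using h4)] at h6
    norm_num at h6
  have hmer : MeromorphicOn B (ball 0 1) := han.meromorphicOn
  set D := MeromorphicOn.divisor B (ball 0 1) with hD
  have hsup : ∀ u, D u ≠ 0 → ‖u‖ < 1 := fun u hu => by
    simpa using D.supportWithinDomain hu
  have hfin : D.support.Finite := by
    refine (MeromorphicOn.divisor_support_finite_of_subset (f := B) (U := closedBall 0 r1) (V := closedBall 0 r1)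
      (hmer.mono_set (closedBall_subset_ball hr1)) (isCompact_closedBall _ _) le_rfl).subset ?_
    intro u hu
    have hu1 := hsup u hu
    have hub : u ∈ ball (0 : ℂ) 1 := by simpa using hu1
    have hz : ‖u‖ ≤ r1 := by
      by_contra hc
      push Not at hc
      have h1 := hr1' u hc.le hu1
      have h2 : B u ≠ 0 := by intro h; rw [h] at h1; norm_num at h1
      apply hu
      rw [hD, MeromorphicOn.AnalyticOnNhd.divisor_apply han hub, (han u hub).analyticOrderAt_eq_zero.2 h2]
      rfl
    have hu' : D u ≠ 0 := hu
    rw [hD, MeromorphicOn.divisor_apply hmer hub] at hu'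
    change MeromorphicOn.divisor B (closedBall 0 r1) u ≠ 0
    rwa [MeromorphicOn.divisor_apply (hmer.mono_set (closedBall_subset_ball hr1)) (by simpa using hz)]
  obtain ⟨g, hg1, hg2, hg3⟩ := MeromorphicOn.extract_zeros_poles (f := B) hmer (by
    intro u
    rw [(han u u.2).meromorphicOrderAt_eq]
    simpa using hord u) hfin
  set S := hfin.toFinset with hS
  have hSn : ∀ u ∈ S, ‖u‖ < 1 := fun u hu => hsup u (by simpa [S] using hu)
  set n : ℂ → ℕ := fun u => (D u).toNat with hn
  have hDn : ∀ u, (n u : ℤ) = D u := fun u => Int.toNat_of_nonneg (MeromorphicOn.AnalyticOnNhd.divisor_nonneg han u)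
  have hprod : ∀ z, (∏ᶠ u, ((· - u) ^ D u : ℂ → ℂ)) z = ∏ u ∈ S, (z - u) ^ n u := by
    intro z
    rw [Function.FactorizedRational.finprod_eq_fun hfin]
    change ∏ᶠ u, (z - u) ^ D u = _
    rw [finprod_eq_prod_of_mulSupport_subset (s := S)]
    · refine Finset.prod_congr rfl fun u _ => ?_
      rw [← hDn]; simp
    · intro u hu
      rw [Function.mem_mulSupport] at hu
      simp only [hS, Finite.coe_toFinset, Function.mem_support]
      intro h; apply hu; simp [h]
  have hBg : ∀ z, ‖z‖ < 1 → B z = (∏ u ∈ S, (z - u) ^ n u) * g z := by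
    intro z hz
    have hzb : z ∈ ball (0 : ℂ) 1 := by simpa using hz
    have h1 : ∀ᶠ y in 𝓝[≠] z, B y = (∏ u ∈ S, (y - u) ^ n u) * g y := by
      have h2 := mem_codiscreteWithin_iff_forall_mem_nhdsNE.1 hg3 z hzb
      have h3 : ∀ᶠ y in 𝓝[≠] z, y ∈ ball (0 : ℂ) 1 := nhdsWithin_le_nhds (isOpen_ball.mem_nhds hzb)
      filter_upwards [h2, h3] with y hy hy2
      rcases hy with hy | hy
      · have hy' : B y = ((∏ᶠ u, ((· - u) ^ D u : ℂ → ℂ)) • g) y := hy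
        rw [hy', Pi.smul_apply', hprod, smul_eq_mul]
      · exact absurd hy2 hy
    have h4 : ContinuousAt B z := (han z hzb).continuousAt
    have h5 : ContinuousAt (fun y => (∏ u ∈ S, (y - u) ^ n u) * g y) z :=
      ContinuousAt.mul (by fun_prop) (hg1 z hzb).continuousAt
    exact tendsto_nhds_unique (h4.tendsto.mono_left nhdsWithin_le_nhds)
      ((h5.tendsto.mono_left nhdsWithin_le_nhds).congr' (h1.mono fun y hy => hy.symm))
  set Q : ℂ → ℂ := fun z => g z * ∏ u ∈ S, (1 - (starRingEnd ℂ) u * z) ^ n u with hQ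
  have hden : ∀ z, ‖z‖ < 1 → ∏ u ∈ S, (1 - (starRingEnd ℂ) u * z) ^ n u ≠ 0 := fun z hz =>
    Finset.prod_ne_zero_iff.2 fun u hu => pow_ne_zero _ (den_ne (hSn u hu) hz.le)
  have hQ0 : ∀ z, ‖z‖ < 1 → Q z ≠ 0 := fun z hz => mul_ne_zero (hg2 ⟨z, by simpa using hz⟩) (hden z hz)
  have hQd : DifferentiableOn ℂ Q (ball 0 1) := hg1.differentiableOn.mul (by fun_prop)
  have hBQ : ∀ z, ‖z‖ < 1 → B z = Q z * Bl S n z := by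
    intro z hz
    rw [hBg z hz]
    simp only [hQ, Bl, div_pow, Finset.prod_div_distrib]
    have := hden z hz
    rw [mul_comm (∏ u ∈ S, (z - u) ^ n u), mul_assoc, mul_div_cancel₀ _ this]
  have hBl1 : ∀ z, ‖z‖ ≤ 1 → ‖Bl S n z‖ ≤ 1 := by
    intro z hz
    rw [Bl, norm_prod]
    refine Finset.prod_le_one (fun _ _ => norm_nonneg _) fun u hu => ?_
    rw [norm_pow]
    exact pow_le_one₀ (norm_nonneg _) (bl_fac_le (hSn u hu) hz)
  have hBl2 : ∀ z, ‖z‖ = 1 → ‖Bl S n z‖ = 1 := by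
    intro z hz
    rw [Bl, norm_prod]
    refine Finset.prod_eq_one fun u hu => ?_
    rw [norm_pow, bl_fac_eq (hSn u hu) hz, one_pow]
  have hlow : ∀ r < 1, ∃ r' < 1, ∀ z, r' ≤ ‖z‖ → ‖z‖ < 1 → r ≤ ‖Bl S n z‖ := by
    intro r hr
    have hK : IsCompact {z ∈ closedBall (0 : ℂ) 1 | ‖Bl S n z‖ ≤ r} := by
      refine (isCompact_closedBall _ _).of_isClosed_subset ?_ (fun z hz => hz.1)
      exact (bl_cont hSn).norm.preimage_isClosed_of_isClosed isClosed_closedBall isClosed_Iic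
    rcases Set.eq_empty_or_nonempty {z ∈ closedBall (0 : ℂ) 1 | ‖Bl S n z‖ ≤ r} with he | hne
    · refine ⟨0, one_pos, fun z _ hz => ?_⟩
      by_contra hc
      push Not at hc
      exact (Set.eq_empty_iff_forall_notMem.1 he z) ⟨by simpa using hz.le, hc.le⟩
    · obtain ⟨z0, hz0, hmax⟩ := hK.exists_isMaxOn hne continuous_norm.continuousOn
      have h1 : ‖z0‖ < 1 := by
        refine lt_of_le_of_ne (by simpa using hz0.1) fun h => ?_
        have := hz0.2
        rw [hBl2 z0 h] at this; linarith
      obtain ⟨r', h2, h3⟩ := exists_between h1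
      refine ⟨r', h3, fun z hz1 hz2 => ?_⟩
      by_contra hc
      push Not at hc
      have h4 : ‖z‖ ≤ ‖z0‖ := hmax (show z ∈ {z ∈ closedBall (0 : ℂ) 1 | ‖Bl S n z‖ ≤ r} from ⟨by simpa using hz2.le, hc.le⟩)
      linarith
  have hinv : ∀ ε : ℝ, 0 < ε → ∃ r < 1, 0 < r ∧ r⁻¹ ≤ 1 + ε := by
    intro ε hε
    exact ⟨(1 + ε)⁻¹, inv_lt_one_of_one_lt₀ (by linarith), by positivity, by simp⟩
  have hle : ∀ z, ‖z‖ < 1 → ‖Q z‖ ≤ 1 := by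
    intro z hz
    refine max_le hQd (fun ε hε => ?_) hz
    obtain ⟨r, h1, h2, h3⟩ := hinv ε hε
    obtain ⟨r', h4, h5⟩ := hlow r h1
    refine ⟨r', h4, fun w hw1 hw2 => ?_⟩
    have h6 := h5 w hw1 hw2
    have h7 := hm w hw2
    rw [hBQ w hw2, norm_mul] at h7
    refine le_trans ?_ h3
    rw [← one_div, le_div_iff₀ h2]
    nlinarith [norm_nonneg (Q w)]
  have hge : ∀ z, ‖z‖ < 1 → ‖(Q z)⁻¹‖ ≤ 1 := by
    intro z hz
    refine max_le (g := fun z => (Q z)⁻¹) (hQd.inv fun w hw => hQ0 w (by simpa using hw)) (fun ε hε => ?_) hz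
    obtain ⟨r, h1, h2, h3⟩ := hinv ε hε
    obtain ⟨r', h4, h5⟩ := hp r h1
    refine ⟨r', h4, fun w hw1 hw2 => ?_⟩
    have h6 := h5 w hw1 hw2
    rw [hBQ w hw2, norm_mul] at h6
    have h7 := hBl1 w hw2.le
    refine le_trans ?_ h3
    rw [norm_inv]
    refine inv_anti₀ h2 ?_
    nlinarith [norm_nonneg (Q w)]
  have heq : ∀ z, ‖z‖ < 1 → ‖Q z‖ = 1 := by
    intro z hz
    refine le_antisymm (hle z hz) ?_
    have h1 := hge z hz
    rw [norm_inv] at h1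
    exact (inv_le_one₀ (norm_pos_iff.2 (hQ0 z hz))).1 h1
  have hc := eqOn_of_isPreconnected_of_isMaxOn_norm (convex_ball 0 1).isPreconnected isOpen_ball hQd
    (mem_ball_self one_pos) (fun z hz => by
      have hz' : ‖z‖ < 1 := by simpa using hz
      simp [heq z hz', heq 0 (by simp)])
  refine ⟨S, n, Q 0, heq 0 (by simp), hSn, fun z hz => ?_⟩
  rw [hBQ z hz, hc (show z ∈ ball (0 : ℂ) 1 by simpa using hz)]
  rfl

end NewtonPf
end

section
open Complex Metric Set Filter Topology

namespace NewtonPf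

/-- lifted Blaschke factor -/
noncomputable def au (u w : ℂ) : ℂ := w + log (1 - u * exp (-w)) - log (1 - (starRingEnd ℂ) u * exp w)

lemma au_aux {u w : ℂ} {s : ℝ} (hu : ‖u‖ < Real.exp (-s)) (h1 : -s < w.re) (h2 : w.re < s) :
    ‖-(u * exp (-w))‖ < 1 ∧ ‖-((starRingEnd ℂ) u * exp w)‖ < 1 := by
  have h0 : Real.exp (-s) * Real.exp s = 1 := by rw [← Real.exp_add]; simp
  rw [norm_neg, norm_neg, norm_mul, norm_mul, norm_exp, norm_exp, RCLike.norm_conj, ← h0]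
  have h3 : Real.exp (-w).re < Real.exp s := Real.exp_lt_exp.2 (by rw [neg_re]; linarith)
  have h4 : Real.exp w.re < Real.exp s := Real.exp_lt_exp.2 h2
  have := Real.exp_pos (-s)
  constructor <;> nlinarith [norm_nonneg u, Real.exp_pos s]

lemma au_slit {u w : ℂ} {s : ℝ} (hu : ‖u‖ < Real.exp (-s)) (h1 : -s < w.re) (h2 : w.re < s) :
    1 - u * exp (-w) ∈ slitPlane ∧ 1 - (starRingEnd ℂ) u * exp w ∈ slitPlane := by
  obtain ⟨h3, h4⟩ := au_aux hu h1 h2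
  rw [sub_eq_add_neg, sub_eq_add_neg]
  exact ⟨mem_slitPlane_of_norm_lt_one h3, mem_slitPlane_of_norm_lt_one h4⟩

lemma au_exp {u w : ℂ} {s : ℝ} (hu : ‖u‖ < Real.exp (-s)) (h1 : -s < w.re) (h2 : w.re < s) :
    exp (au u w) = (exp w - u) / (1 - (starRingEnd ℂ) u * exp w) := by
  obtain ⟨h3, h4⟩ := au_slit hu h1 h2
  rw [au, exp_sub, exp_add, exp_log (slitPlane_ne_zero h3), exp_log (slitPlane_ne_zero h4), mul_sub, mul_left_comm,
    ← exp_add]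
  simp

lemma au_deriv {u w : ℂ} {s : ℝ} (hu : ‖u‖ < Real.exp (-s)) (h1 : -s < w.re) (h2 : w.re < s) :
    HasStrictDerivAt (au u) (1 + u * exp (-w) / (1 - u * exp (-w)) +
      (starRingEnd ℂ) u * exp w / (1 - (starRingEnd ℂ) u * exp w)) w := by
  obtain ⟨h3, h4⟩ := au_slit hu h1 h2
  have d1 : HasStrictDerivAt (fun w => 1 - u * exp (-w)) (u * exp (-w)) w := by
    have := (((hasStrictDerivAt_id w).fun_neg.cexp).const_mul u).const_sub 1
    exact this.congr_deriv (by simp)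
  have d2 : HasStrictDerivAt (fun w => 1 - (starRingEnd ℂ) u * exp w) (-((starRingEnd ℂ) u * exp w)) w := by
    have := (((hasStrictDerivAt_id w).cexp).const_mul ((starRingEnd ℂ) u)).const_sub 1
    exact this.congr_deriv (by simp)
  have := ((hasStrictDerivAt_id w).add (d1.clog h3)).sub (d2.clog h4)
  exact this.congr_deriv (by ring)

lemma au_per (u w : ℂ) : au u (w + 2 * Real.pi * I) = au u w + 2 * Real.pi * I := by
  have h1 : exp (-(w + 2 * Real.pi * I)) = exp (-w) := by
    rw [neg_add, ← sub_eq_add_neg]; exact exp_periodic.sub_eq _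
  rw [au, au, h1, exp_periodic w]; ring

/-- boundary derivative -/
noncomputable def bu (u : ℂ) (x : ℝ) : ℝ := 1 + 2 * (u * exp (-(x * I)) / (1 - u * exp (-(x * I)))).re

lemma bu_pos {u : ℂ} (hu : ‖u‖ < 1) (x : ℝ) : 0 < bu u x := by
  have ht : ‖u * exp (-(x * I))‖ < 1 := by
    rw [norm_mul, norm_exp]; simpa using hu
  unfold bu
  generalize u * exp (-(x * I)) = t at ht
  have hne : 1 - t ≠ 0 := sub_ne_zero.2 (by rintro rfl; simp at ht)
  have h1 : t / (1 - t) = 1 / (1 - t) - 1 := by field_simp; ring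
  have h2 : 0 < normSq (1 - t) := normSq_pos.2 hne
  have h3 : normSq t < 1 := by rw [normSq_eq_norm_sq]; nlinarith [norm_nonneg t]
  rw [h1, sub_re, one_div, inv_re, one_re]
  have h4 : (1 - t).re / normSq (1 - t) > 1 / 2 := by
    rw [gt_iff_lt, lt_div_iff₀ h2]
    simp only [normSq_apply, sub_re, sub_im, one_re, one_im] at h3 ⊢
    nlinarith
  linarith

lemma bu_eq (u : ℂ) (x : ℝ) : (bu u x : ℂ) = 1 + u * exp (-(x * I)) / (1 - u * exp (-(x * I))) +
      (starRingEnd ℂ) u * exp (x * I) / (1 - (starRingEnd ℂ) u * exp (x * I)) := by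
  have h : (starRingEnd ℂ) u * exp (x * I) = (starRingEnd ℂ) (u * exp (-(x * I))) := by
    rw [map_mul, ← exp_conj]; simp
  have h2 : (starRingEnd ℂ) u * exp (x * I) / (1 - (starRingEnd ℂ) u * exp (x * I)) =
      (starRingEnd ℂ) (u * exp (-(x * I)) / (1 - u * exp (-(x * I)))) := by
    rw [h, map_div₀, map_sub, map_one]
  rw [h2, add_assoc, add_conj, bu]; push_cast; ring

lemma bl_lift {S : Finset ℂ} {n : ℂ → ℕ} {c : ℂ} (hS : ∀ u ∈ S, ‖u‖ < 1) (hc : ‖c‖ = 1) (h0 : 0 ∈ S) (hn0 : 1 ≤ n 0)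
    (hk : 2 ≤ ∑ u ∈ S, n u) : ∃ (f : ℂ → ℂ) (b β : ℝ → ℝ) (s0 : ℝ), 0 < s0 ∧
    (∀ w : ℂ, -s0 < w.re → w.re < 0 → exp (f w) = c * Bl S n (exp w)) ∧ (∀ x : ℝ, f (x * I) = b x * I) ∧
    (∀ x : ℝ, HasStrictDerivAt f (β x : ℂ) (x * I)) ∧ ContinuousOn f {w | -s0 < w.re ∧ w.re < 0} ∧
    (∀ x, 1 < β x) ∧ StrictMono (fun x => b x - x) ∧ Continuous b ∧
    ∃ k : ℕ, 2 ≤ k ∧ ∀ x, b (x + 2 * Real.pi) = b x + 2 * Real.pi * k := by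
  obtain ⟨s0, hs0, hs⟩ : ∃ s0 > 0, ∀ u ∈ S, ‖u‖ < Real.exp (-s0) := by
    have h1 : ∀ᶠ s in 𝓝[>] (0 : ℝ), ∀ u ∈ S, ‖u‖ < Real.exp (-s) := by
      rw [Filter.eventually_all_finset]
      intro u hu
      have : Tendsto (fun s => Real.exp (-s)) (𝓝[>] (0 : ℝ)) (𝓝 1) := by
        have : ContinuousAt (fun s => Real.exp (-s)) 0 := by fun_prop
        simpa using this.tendsto.mono_left nhdsWithin_le_nhds
      exact this.eventually (lt_mem_nhds (hS u hu))
    obtain ⟨s, hs, hs'⟩ := (h1.and self_mem_nhdsWithin).exists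
    exact ⟨s, hs', hs⟩
  obtain ⟨γ, rfl⟩ : ∃ γ : ℝ, c = exp (γ * I) := by
    refine ⟨arg c, ?_⟩
    have := norm_mul_exp_arg_mul_I c
    rw [hc] at this; simpa using this.symm
  set f : ℂ → ℂ := fun w => γ * I + ∑ u ∈ S, n u * au u w with hf
  set β : ℝ → ℝ := fun x => ∑ u ∈ S, n u * bu u x with hβ
  have hexp : ∀ w : ℂ, -s0 < w.re → w.re < s0 → exp (f w) = exp (γ * I) * Bl S n (exp w) := by
    intro w h1 h2
    rw [hf, exp_add, exp_sum]
    congr 1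
    refine Finset.prod_congr rfl fun u hu => ?_
    rw [exp_nat_mul, au_exp (hs u hu) h1 h2]
  have hder : ∀ w : ℂ, -s0 < w.re → w.re < s0 → HasStrictDerivAt f (∑ u ∈ S, n u *
      (1 + u * exp (-w) / (1 - u * exp (-w)) + (starRingEnd ℂ) u * exp w / (1 - (starRingEnd ℂ) u * exp w))) w :=
    fun w h1 h2 => (HasStrictDerivAt.fun_sum fun u hu => (au_deriv (hs u hu) h1 h2).const_mul _).const_add _
  have hre : ∀ x : ℝ, ((x : ℂ) * I).re = 0 := by intro x; simp
  have hfd : ∀ x : ℝ, HasStrictDerivAt f (β x : ℂ) (x * I) := by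
    intro x
    convert hder (x * I) (by rw [hre]; linarith) (by rw [hre]; exact hs0) using 1
    rw [hβ]; push_cast
    exact Finset.sum_congr rfl fun u _ => by rw [bu_eq]
  have hf0 : ∀ x : ℝ, (f (x * I)).re = 0 := by
    intro x
    have h1 := congrArg norm (hexp (x * I) (by rw [hre]; linarith) (by rw [hre]; exact hs0))
    have h2 : ‖Bl S n (exp (x * I))‖ = 1 := by
      rw [Bl, norm_prod]
      refine Finset.prod_eq_one fun u hu => ?_
      rw [norm_pow, bl_fac_eq (hS u hu) (norm_exp_ofReal_mul_I x), one_pow]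
    rw [norm_mul, h2, norm_exp, norm_exp_ofReal_mul_I] at h1
    simpa using h1
  have hβ1 : ∀ x, 1 < β x := by
    intro x
    have hb0 : bu 0 x = 1 := by simp [bu]
    have h1 : β x = n 0 + ∑ u ∈ S.erase 0, n u * bu u x := by
      rw [hβ]; simp only; rw [← Finset.add_sum_erase _ _ h0, hb0, mul_one]
    have h2 : ∑ u ∈ S, n u = n 0 + ∑ u ∈ S.erase 0, n u := (Finset.add_sum_erase _ _ h0).symm
    have h3 : ∀ u ∈ S.erase 0, 0 ≤ n u * bu u x := fun u hu =>
      mul_nonneg (by positivity) (bu_pos (hS u (Finset.mem_of_mem_erase hu)) x).le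
    rw [h1]
    by_cases h4 : 2 ≤ n 0
    · have : (2 : ℝ) ≤ n 0 := by exact_mod_cast h4
      linarith [Finset.sum_nonneg h3]
    · have h5 : ∑ u ∈ S.erase 0, n u ≠ 0 := by omega
      obtain ⟨u, hu, hu'⟩ := Finset.exists_ne_zero_of_sum_ne_zero h5
      have h6 : 0 < ∑ u ∈ S.erase 0, n u * bu u x := Finset.sum_pos' h3 ⟨u, hu,
        mul_pos (by positivity) (bu_pos (hS u (Finset.mem_of_mem_erase hu)) x)⟩
      have : (1 : ℝ) ≤ n 0 := by exact_mod_cast hn0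
      linarith
  have hbd : ∀ x : ℝ, HasDerivAt (fun x : ℝ => (f (x * I)).im) (β x) x := by
    intro x
    have h1 : HasDerivAt (fun z : ℂ => -I * f (z * I)) (β x : ℂ) (x : ℂ) := by
      have h2 : HasDerivAt (fun z : ℂ => z * I) I (x : ℂ) := by simpa using (hasDerivAt_id (x : ℂ)).mul_const I
      have := (((hfd x).hasDerivAt.comp (x : ℂ) h2)).const_mul (-I)
      exact this.congr_deriv (by rw [mul_comm (β x : ℂ), ← mul_assoc]; simp)
    have := h1.real_of_complex
    simpa using this
  refine ⟨f, fun x => (f (x * I)).im, β, s0, hs0, fun w h1 h2 => hexp w h1 (h2.trans hs0), fun x => ?_, hfd, ?_, hβ1, ?_,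
    continuous_iff_continuousAt.2 fun x => (hbd x).continuousAt, ∑ u ∈ S, n u, hk, fun x => ?_⟩
  · apply Complex.ext <;> simp [hf0 x]
  · intro w hw
    exact (hder w hw.1 (hw.2.trans hs0)).hasDerivAt.continuousAt.continuousWithinAt
  · refine strictMono_of_deriv_pos fun x => ?_
    rw [((hbd x).fun_sub (hasDerivAt_id' x)).deriv]
    linarith [hβ1 x]
  · have h1 : f (((x + 2 * Real.pi : ℝ) : ℂ) * I) = f (x * I) + 2 * Real.pi * I * (∑ u ∈ S, n u : ℕ) := by
      have : (((x + 2 * Real.pi : ℝ) : ℂ) * I) = x * I + 2 * Real.pi * I := by push_cast; ring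
      rw [this, hf]
      simp only [au_per]
      push_cast
      rw [Finset.mul_sum, add_assoc, ← Finset.sum_add_distrib]
      congr 1
      exact Finset.sum_congr rfl fun u _ => by ring
    simp only
    rw [h1, add_im]
    congr 1
    simp [mul_im]

end NewtonPf
end

section
open Complex Metric Set Filter Topology

namespace NewtonPf

variable {N : ℂ → ℂ} {Pl : Set ℂ} {ξ : ℂ}

lemma cpt_ball {K : Set ℂ} (hK : IsCompact K) (hs : K ⊆ ball 0 1) : ∃ ρ, 0 < ρ ∧ ρ < 1 ∧ ∀ z ∈ K, ‖z‖ ≤ ρ := by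
  rcases K.eq_empty_or_nonempty with rfl | hne
  · exact ⟨1 / 2, by norm_num, by norm_num, by simp⟩
  · obtain ⟨z0, hz0, hmax⟩ := hK.exists_isMaxOn hne continuous_norm.continuousOn
    have h1 : ‖z0‖ < 1 := by simpa using hs hz0
    obtain ⟨ρ, h2, h3⟩ := exists_between h1
    exact ⟨ρ, (norm_nonneg _).trans_lt h2, h3, fun z hz => (show ‖z‖ ≤ ‖z0‖ from hmax hz).trans h2.le⟩

lemma Dyn.pre_cpt (h : Dyn N Pl ξ) {K : Set ℂ} (hK : IsCompact K) (hKU : K ⊆ Imm N ξ) :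
    IsCompact {z ∈ Imm N ξ | N z ∈ K} := by
  refine isCompact_of_isClosed_isBounded ?_ ?_
  · refine isClosed_of_closure_subset fun z hz => ?_
    have hcl : z ∈ closure (Imm N ξ) := closure_mono (fun y hy => hy.1) hz
    obtain ⟨M, hM⟩ := hK.isBounded.exists_norm_le
    have hpl : z ∉ Pl := by
      intro hp
      by_cases hzU : z ∈ {z ∈ Imm N ξ | N z ∈ K}
      · exact h.imm_pl hzU.1 hp
      · have h1 : ∃ᶠ y in 𝓝 z, y ∈ {z ∈ Imm N ξ | N z ∈ K} := mem_closure_iff_frequently.1 hz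
        have h2 : ∃ᶠ y in 𝓝[≠] z, y ∈ {z ∈ Imm N ξ | N z ∈ K} := by
          rw [frequently_nhdsWithin_iff]
          exact h1.mono fun y hy => ⟨hy, fun he => hzU (by rw [mem_singleton_iff] at he; rwa [← he])⟩
        obtain ⟨y, hy, hy2⟩ := (h2.and_eventually ((h.pole z hp).eventually (eventually_gt_atTop M))).exists
        exact absurd (hM _ hy.2) (not_le.2 hy2)
    have hN : N z ∈ K := by
      have := (h.toNMap.cont hpl).continuousWithinAt (s := {z ∈ Imm N ξ | N z ∈ K})
      have h3 := this.mem_closure_image hz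
      refine hK.isClosed.closure_subset_iff.2 ?_ h3
      rintro _ ⟨y, hy, rfl⟩
      exact hy.2
    exact ⟨h.mem_of_closure hcl (bas_iff.1 (h.imm_bas (hKU hN))), hN⟩
  · obtain ⟨M, hM⟩ := hK.isBounded.exists_norm_le
    have h1 := h.inf.eventually (eventually_gt_atTop M)
    refine (Bornology.isBounded_compl_iff.2 h1 : Bornology.IsBounded {z | M < ‖N z‖}ᶜ).subset fun z hz => ?_
    simpa using hM _ hz.2

lemma mkLf (h : Dyn N Pl ξ) {a0 lam : ℂ} (lam0 : lam ≠ 0)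
    (infl : ∀ ε > 0, ∃ R, ∀ z z', R < ‖z‖ → R < ‖z'‖ → z ≠ z' → ‖(N z - N z') / (z - z') - lam‖ < ε)
    (infx : Tendsto (fun z => (N z - ξ) / (z - ξ)) (Bornology.cobounded ℂ) (𝓝 lam))
    (away : ∃ δ > 0, ∀ z ∈ Imm N ξ, δ < ‖z - a0‖) :
    ∃ Ψ Z f b β s0, Lf N Pl ξ Ψ Z f b β s0 a0 lam := by
  obtain ⟨φ, hφ, him⟩ : ∃ f, Univ (Imm N ξ) ξ f ∧ f '' Imm N ξ = ball 0 1 := by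
    obtain ⟨δ, hδ, hδU⟩ := away
    exact h.riemann hδ hδU
  set U := Imm N ξ with hU
  have hUo : IsOpen U := h.isOpen_imm
  obtain ⟨ψ, hψ⟩ : ∃ ψ : ℂ → ℂ, ∀ z, ‖z‖ < 1 → ψ z ∈ U ∧ φ (ψ z) = z := by
    have : ∀ z : ℂ, ∃ y, ‖z‖ < 1 → y ∈ U ∧ φ y = z := by
      intro z
      by_cases hz : ‖z‖ < 1
      · have : z ∈ φ '' U := by rw [him]; simpa using hz
        obtain ⟨y, h1, h2⟩ := this
        exact ⟨y, fun _ => ⟨h1, h2⟩⟩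
      · exact ⟨0, fun h => absurd h hz⟩
    choose ψ hψ using this
    exact ⟨ψ, hψ⟩
  have hψφ : ∀ z ∈ U, ψ (φ z) = z := fun z hz =>
    hφ.inj (hψ _ (hφ.maps z hz)).1 hz (hψ _ (hφ.maps z hz)).2
  have hψc : ∀ z, ‖z‖ < 1 → ContinuousAt ψ z := by
    intro z hz
    rw [ContinuousAt, _root_.tendsto_nhds]
    intro V hV hzV
    have h1 : IsOpen (φ '' (V ∩ U)) := isOpen_image_of_injOn (hV.inter hUo) (hφ.diff.mono inter_subset_right)
      (hφ.inj.mono inter_subset_right)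
    refine mem_of_superset (h1.mem_nhds ⟨ψ z, ⟨hzV, (hψ z hz).1⟩, (hψ z hz).2⟩) ?_
    rintro _ ⟨y, hy, rfl⟩
    rw [mem_preimage, hψφ y hy.2]; exact hy.1
  have hnb : ∀ z : ℂ, ‖z‖ < 1 → ∀ᶠ y in 𝓝 z, ‖y‖ < 1 := fun z hz => continuous_norm.continuousAt.eventually_lt_const hz
  have hψd : ∀ z, ‖z‖ < 1 → HasDerivAt ψ (deriv φ (ψ z))⁻¹ z := by
    intro z hz
    refine HasDerivAt.of_local_left_inverse (hψc z hz)
      (hφ.diff.differentiableAt (hUo.mem_nhds (hψ z hz).1)).hasDerivAt (hφ.der _ (hψ z hz).1) ?_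
    exact (hnb z hz).mono fun y hy => (hψ y hy).2
  have hψ0 : ψ 0 = ξ := by rw [← hφ.zero]; exact hψφ ξ h.mem_imm
  have hψi : ∀ z z', ‖z‖ < 1 → ‖z'‖ < 1 → ψ z = ψ z' → z = z' := fun z z' hz hz' he => by
    rw [← (hψ z hz).2, he, (hψ z' hz').2]
  set B : ℂ → ℂ := fun z => φ (N (ψ z)) with hB
  have hBm : ∀ z, ‖z‖ < 1 → ‖B z‖ < 1 := fun z hz => hφ.maps _ (h.imm_maps (hψ z hz).1)
  have hNψ : ∀ z, ‖z‖ < 1 → N (ψ z) = ψ (B z) := fun z hz => (hψφ _ (h.imm_maps (hψ z hz).1)).symm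
  have hBd : DifferentiableOn ℂ B (ball 0 1) := by
    intro z hz
    have hz' : ‖z‖ < 1 := by simpa using hz
    have h1 := (hφ.diff.differentiableAt (hUo.mem_nhds (h.imm_maps (hψ z hz').1)))
    have h2 := h.diff _ (h.imm_pl (hψ z hz').1)
    exact (h1.comp z (h2.comp z (hψd z hz').differentiableAt)).differentiableWithinAt
  have hp : ∀ r < 1, ∃ r' < 1, ∀ z, r' ≤ ‖z‖ → ‖z‖ < 1 → r ≤ ‖B z‖ := by
    intro r hr
    have hlt : ∀ z ∈ closedBall (0 : ℂ) r, ‖z‖ < 1 := fun z hz => lt_of_le_of_lt (by simpa using hz) hr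
    have hC := h.pre_cpt (K := ψ '' closedBall 0 r) ((isCompact_closedBall _ _).image_of_continuousOn
      fun z hz => (hψc z (hlt z hz)).continuousWithinAt) (by
        rintro _ ⟨z, hz, rfl⟩; exact (hψ z (hlt z hz)).1)
    obtain ⟨ρ, h1, h2, h3⟩ := cpt_ball (hC.image_of_continuousOn (hφ.diff.continuousOn.mono fun z hz => hz.1)) (by
      rintro _ ⟨z, hz, rfl⟩; simpa using hφ.maps z hz.1)
    obtain ⟨r', h4, h5⟩ := exists_between h2
    refine ⟨r', h5, fun z hz1 hz2 => ?_⟩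
    by_contra hc
    push Not at hc
    have := h3 z ⟨ψ z, ⟨(hψ z hz2).1, B z, by simpa using hc.le, (hNψ z hz2).symm⟩, (hψ z hz2).2⟩
    linarith
  obtain ⟨S, n, c, hc, hS, hBl⟩ := blaschke hBd hBm hp
  have hc0 : c ≠ 0 := by rintro rfl; simp at hc
  obtain ⟨h0S, hn0⟩ : 0 ∈ S ∧ n 0 ≠ 0 := by
    have h1 := hBl 0 (by simp)
    have h2 : B 0 = 0 := by simp only [hB]; rw [hψ0, h.ξfix, hφ.zero]
    rw [h2, eq_comm, mul_eq_zero, or_iff_right hc0, Bl, Finset.prod_eq_zero_iff] at h1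
    obtain ⟨u, hu, h3⟩ := h1
    have h5 : n u ≠ 0 := by intro h; rw [h] at h3; simp at h3
    have h6 := eq_zero_of_pow_eq_zero h3
    have : u = 0 := by simpa using h6
    subst this
    exact ⟨hu, h5⟩
  have hk : 2 ≤ ∑ u ∈ S, n u := by
    by_contra hlt
    have h2 : ∑ u ∈ S, n u = n 0 + ∑ u ∈ S.erase 0, n u := (Finset.add_sum_erase _ _ h0S).symm
    have h3 : n 0 = 1 := by omega
    have h4 : ∑ u ∈ S.erase 0, n u = 0 := by omega
    rw [Finset.sum_eq_zero_iff] at h4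
    have h5 : ∀ z, ‖z‖ < 1 → ‖B z‖ = ‖z‖ := by
      intro z hz
      have : Bl S n z = z := by
        rw [Bl, ← Finset.mul_prod_erase _ _ h0S, h3, Finset.prod_eq_one (fun u hu => by rw [h4 u hu, pow_zero])]
        simp
      rw [hBl z hz, this, norm_mul, hc, one_mul]
    have h6 : ∀ z ∈ U, ∀ m : ℕ, ‖φ (N^[m] z)‖ = ‖φ z‖ := by
      intro z hz m
      induction m with
      | zero => rfl
      | succ m ih =>
        rw [Function.iterate_succ_apply', ← ih]
        have h7 := h.imm_iter hz m
        have := h5 _ (hφ.maps _ h7)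
        simp only [hB] at this
        rwa [hψφ _ h7] at this
    have hh : ‖(1 / 2 : ℂ)‖ < 1 := by norm_num
    have h8 : Tendsto (fun m => N^[m] (ψ (1 / 2))) atTop (𝓝 ξ) := h.imm_bas (hψ _ hh).1
    have h9 := ((hφ.diff.differentiableAt (hUo.mem_nhds h.mem_imm)).continuousAt.norm.tendsto.comp h8)
    rw [hφ.zero] at h9
    have h10 : Tendsto (fun _ : ℕ => ‖(1 / 2 : ℂ)‖) atTop (𝓝 ‖(0 : ℂ)‖) := by
      refine h9.congr fun m => ?_
      simp only [Function.comp]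
      rw [h6 _ (hψ _ hh).1 m, (hψ _ hh).2]
    have := tendsto_nhds_unique h10 tendsto_const_nhds
    norm_num at this
  obtain ⟨f, b, β, s0, hs0, hfe, hfb, hfd, hfc, hβ1, hgm, hbc, hbp⟩ := bl_lift hS hc h0S (Nat.one_le_iff_ne_zero.2 hn0) hk
  have hHP : ∀ w ∈ HP, ‖exp w‖ < 1 := by
    intro w hw
    rw [norm_exp]
    rw [← Real.exp_zero]; exact Real.exp_lt_exp.2 hw
  have hds : ContinuousOn (dslope ψ 0) (ball 0 1) := by
    refine (continuousOn_dslope (isOpen_ball.mem_nhds (mem_ball_self one_pos))).2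
      ⟨fun z hz => (hψc z (by simpa using hz)).continuousWithinAt, (hψd 0 (by simp)).differentiableAt⟩
  have hds0 : 0 ∉ dslope ψ 0 '' ball 0 1 := by
    rintro ⟨z, hz, he⟩
    have hz' : ‖z‖ < 1 := by simpa using hz
    by_cases h0 : z = 0
    · rw [h0, dslope_same, (hψd 0 (by simp)).deriv] at he
      exact inv_ne_zero (hφ.der _ (hψ 0 (by simp)).1) he
    · have := sub_smul_dslope ψ 0 z
      rw [he, smul_zero, eq_comm, sub_eq_zero] at this
      exact h0 (hψi _ _ hz' (by simp) this)
  obtain ⟨κ, hκ1, hκ2⟩ := exists_continuousOn_eqOn_exp_comp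
    (simply_of_convex (convex_ball (0 : ℂ) 1) ⟨0, by simp⟩) isOpen_ball hds hds0
  refine ⟨fun w => ψ (exp w), fun w => w + κ (exp w), f, b, β, s0, { h with
    lam0 := lam0, infl := infl, infx := infx, away := away, s0pos := hs0, fb := hfb, fd := hfd, fc := hfc, β1 := hβ1,
    gmono := hgm, bcont := hbc, bper := hbp, Ψd := ?_, mem := ?_, per := ?_, inj := ?_, surj := ?_, bd := ?_, Zc := ?_, Zexp := ?_,
    Zper := ?_, lim := ?_, fre := ?_ }⟩
  · intro w hw
    exact ((hψd _ (hHP w hw)).differentiableAt.comp w differentiableAt_exp).differentiableWithinAt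
  · intro w hw; exact (hψ _ (hHP w hw)).1
  · intro w; rw [exp_periodic w]
  · intro w hw w' hw' he
    exact exp_eq_exp_iff_exists_int.1 (hψi _ _ (hHP w hw) (hHP w' hw') he)
  · intro z hz hne
    have h1 : φ z ≠ 0 := fun h0 => hne (by rw [← hψφ z hz, h0, hψ0])
    refine ⟨log (φ z), ?_, ?_⟩
    · change (log (φ z)).re < 0
      rw [log_re]; exact Real.log_neg (norm_pos_iff.2 h1) (hφ.maps z hz)
    · rw [exp_log h1, hψφ z hz]
  · intro K hK hKc
    obtain ⟨ρ, h1, h2, h3⟩ := cpt_ball (hKc.image_of_continuousOn (hφ.diff.continuousOn.mono hK)) (by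
      rintro _ ⟨z, hz, rfl⟩; simpa using hφ.maps z (hK hz))
    refine ⟨-Real.log ρ, by linarith [Real.log_neg h1 h2], fun w hw hr hm => ?_⟩
    have h4 := h3 _ ⟨_, hm, rfl⟩
    rw [(hψ _ (hHP w hw)).2, norm_exp, ← Real.le_log_iff_exp_le h1] at h4
    linarith
  · exact continuousOn_id.add (hκ1.comp continuous_exp.continuousOn fun w hw => by simpa using hHP w hw)
  · intro w hw
    have h1 : exp (κ (exp w)) = dslope ψ 0 (exp w) := hκ2 (by simpa using hHP w hw)
    have h2 := sub_smul_dslope ψ 0 (exp w)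
    rw [exp_add, h1, ← hψ0, ← h2]; simp
  · intro w hw; rw [exp_periodic w]; ring
  · have h1 : Tendsto ψ (𝓝 0) (𝓝 ξ) := by have := hψc 0 (by simp); rwa [ContinuousAt, hψ0] at this
    exact h1.comp tendsto_exp_comap_re_atBot
  · intro w h1 h2
    have h3 := hfe w h1 h2
    have h4 : ‖exp w‖ < 1 := hHP w h2
    rw [← hBl _ h4] at h3
    refine ⟨?_, ?_⟩
    · have := hBm _ h4
      rw [← h3, norm_exp] at this
      simpa using this
    · rw [h3]; exact hNψ _ h4

end NewtonPf
end

section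
open Complex Metric Set Filter Topology

namespace NewtonPf
open Polynomial

lemma pq_ex {p : ℂ[X]} (hd : derivative p ≠ 0) :
    ∃ g P Q : ℂ[X], Q ≠ 0 ∧ IsCoprime P Q ∧ p = g * P ∧ derivative p = g * Q := by
  have h := isCoprime_div_gcd_div_gcd (p := p) hd
  have h1 := EuclideanDomain.mul_div_cancel' (gcd_ne_zero_of_right (a := p) hd) (gcd_dvd_left p (derivative p))
  have h2 := EuclideanDomain.mul_div_cancel' (gcd_ne_zero_of_right (a := p) hd) (gcd_dvd_right p (derivative p))
  refine ⟨_, _, _, ?_, h, h1.symm, h2.symm⟩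
  intro h0
  rw [h0, mul_zero] at h2
  exact hd h2.symm

/-- Newton data -/
structure ND (p g P Q : ℂ[X]) : Prop where
  p0 : p ≠ 0
  d0 : derivative p ≠ 0
  Q0 : Q ≠ 0
  cop : IsCoprime P Q
  pP : p = g * P
  dQ : derivative p = g * Q
  rt : 3 ≤ p.roots.toFinset.card

variable {p g P Q : ℂ[X]}

lemma ND.nz (h : ND p g P Q) {z : ℂ} (hQ : Q.eval z = 0) : P.eval z ≠ 0 := by
  obtain ⟨a, b, hab⟩ := h.cop
  intro hP
  have := congrArg (eval z) hab
  simp [hQ, hP] at this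

lemma ND.root (h : ND p g P Q) {z : ℂ} (hz : p.eval z = 0) :
    P.eval z = 0 ∧ Q.eval z ≠ 0 ∧ ∃ m : ℕ, 1 ≤ m ∧ Q.eval z = m * (derivative P).eval z := by
  obtain ⟨r, hr, hr2⟩ := exists_eq_pow_rootMultiplicity_mul_and_not_dvd p h.p0 z
  have hm : 0 < p.rootMultiplicity z := (rootMultiplicity_pos h.p0).2 hz
  obtain ⟨m, hm'⟩ : ∃ m, p.rootMultiplicity z = m + 1 := ⟨_, (Nat.succ_pred_eq_of_pos hm).symm⟩
  rw [hm'] at hr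
  have hrz : r.eval z ≠ 0 := fun h0 => hr2 (dvd_iff_isRoot.2 h0)
  have hd : derivative p = (X - C z) ^ m * (C ((m : ℂ) + 1) * r + (X - C z) * derivative r) := by
    rw [hr, derivative_mul, derivative_X_sub_C_pow]; simp; ring
  have h1 : p * Q = derivative p * P := by rw [h.dQ, h.pP]; ring
  have h2 : (X - C z) * r * Q = (C ((m : ℂ) + 1) * r + (X - C z) * derivative r) * P := by
    rw [hd] at h1
    nth_rewrite 1 [hr] at h1
    refine mul_left_cancel₀ (pow_ne_zero m (X_sub_C_ne_zero z)) ?_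
    linear_combination h1
  have hm0 : (m : ℂ) + 1 ≠ 0 := by exact_mod_cast Nat.succ_ne_zero m
  have hP : P.eval z = 0 := by
    have := congrArg (eval z) h2
    simpa [hm0, hrz] using this
  obtain ⟨P1, hP1⟩ := dvd_iff_isRoot.2 (show P.IsRoot z from hP)
  have h3 : r * Q = (C ((m : ℂ) + 1) * r + (X - C z) * derivative r) * P1 := by
    refine mul_left_cancel₀ (X_sub_C_ne_zero z) ?_
    rw [← mul_assoc, h2, hP1]; ring
  have h4 := congrArg (eval z) h3
  have h5 : (derivative P).eval z = P1.eval z := by rw [hP1]; simp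
  refine ⟨hP, fun h0 => h.nz h0 hP, m + 1, by omega, ?_⟩
  rw [h5]
  refine mul_left_cancel₀ hrz ?_
  simp at h4
  rw [h4]; push_cast; ring

lemma ND.eq (h : ND p g P Q) (z : ℂ) : NewtonMap p z = z - P.eval z / Q.eval z := by
  rw [NewtonMap]
  by_cases hg : g.eval z = 0
  · have : p.eval z = 0 := by rw [h.pP]; simp [hg]
    rw [this, (h.root this).1]; simp
  · rw [h.dQ]; nth_rewrite 1 [h.pP]
    rw [eval_mul, eval_mul, mul_div_mul_left _ _ hg]

lemma ND.pole_iff (h : ND p g P Q) (z : ℂ) : Q.eval z = 0 ↔ ((derivative p).eval z = 0 ∧ p.eval z ≠ 0) := by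
  constructor
  · intro h0
    exact ⟨by rw [h.dQ]; simp [h0], fun h1 => (h.root h1).2.1 h0⟩
  · rintro ⟨h1, h2⟩
    rw [h.dQ, eval_mul, mul_eq_zero] at h1
    refine h1.resolve_left fun h3 => h2 ?_
    rw [h.pP]; simp [h3]

lemma ND.der (h : ND p g P Q) {z : ℂ} (hz : Q.eval z ≠ 0) : HasDerivAt (NewtonMap p)
    (1 - ((derivative P).eval z * Q.eval z - P.eval z * (derivative Q).eval z) / Q.eval z ^ 2) z := by
  rw [show NewtonMap p = fun z => z - P.eval z / Q.eval z from funext h.eq]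
  exact (hasDerivAt_id z).fun_sub ((P.hasDerivAt z).fun_div (Q.hasDerivAt z) hz)

lemma ND.P0 (h : ND p g P Q) : P ≠ 0 := by rintro h0; apply h.p0; rw [h.pP, h0, mul_zero]

lemma ND.W0 (h : ND p g P Q) : Q ^ 2 - (derivative P * Q - P * derivative Q) ≠ 0 := by
  intro hW
  have h1 : Q ∣ P * derivative Q := ⟨derivative P - Q, by linear_combination hW⟩
  have h2 : Q ∣ derivative Q := h.cop.symm.dvd_of_dvd_mul_left h1
  have h3 : derivative Q = 0 := eq_zero_of_dvd_of_degree_lt h2 (degree_derivative_lt h.Q0)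
  have h4 : derivative P = Q := by
    refine mul_right_cancel₀ h.Q0 ?_
    rw [h3] at hW
    linear_combination -hW
  have h5 : Q.natDegree = 0 := derivative_eq_zero.1 h3
  have h6 : P.natDegree ≤ 1 := by
    rw [← h4, natDegree_derivative] at h5
    omega
  have h7 : p.roots.toFinset ⊆ P.roots.toFinset := by
    intro z hz
    rw [Multiset.mem_toFinset, mem_roots h.p0] at hz
    rw [Multiset.mem_toFinset, mem_roots h.P0]
    exact (h.root hz).1
  have h8 := Finset.card_le_card h7
  have h9 := Multiset.toFinset_card_le P.roots
  have h10 := P.card_roots'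
  have := h.rt
  omega

/-- sum of z/(z-a) -/
noncomputable def sg (p : ℂ[X]) (z : ℂ) : ℂ := (p.roots.map fun a => z / (z - a)).sum

lemma ev_cob {s : Set ℂ} (hs : s.Finite) : ∀ᶠ z in Bornology.cobounded ℂ, z ∉ s :=
  Bornology.isBounded_def.1 hs.isBounded

lemma tend_one (a : ℂ) : Tendsto (fun z : ℂ => z / (z - a)) (Bornology.cobounded ℂ) (𝓝 1) := by
  have h1 : Tendsto (fun z : ℂ => z - a) (Bornology.cobounded ℂ) (Bornology.cobounded ℂ) := by
    simp [sub_eq_add_neg]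
  have h2 : Tendsto (fun z : ℂ => 1 + a * (z - a)⁻¹) (Bornology.cobounded ℂ) (𝓝 1) := by
    simpa using ((tendsto_inv₀_cobounded.comp h1).const_mul a).const_add 1
  refine h2.congr' ?_
  have h3 : ∀ᶠ z in Bornology.cobounded ℂ, z ≠ a := by
    simpa using ev_cob (Set.finite_singleton a)
  filter_upwards [h3] with z hz
  have := sub_ne_zero.2 hz
  field_simp; ring

lemma sg_tend (p : ℂ[X]) : Tendsto (sg p) (Bornology.cobounded ℂ) (𝓝 (Multiset.card p.roots : ℂ)) := by
  have := tendsto_multiset_sum (f := fun a z : ℂ => z / (z - a)) (x := Bornology.cobounded ℂ) (a := fun _ => (1 : ℂ)) p.roots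
    (fun a _ => tend_one a)
  simp only [Multiset.map_const', Multiset.sum_replicate, nsmul_eq_mul, mul_one] at this
  exact this

lemma ND.card3 (h : ND p g P Q) : 3 ≤ Multiset.card p.roots := h.rt.trans (Multiset.toFinset_card_le _)

lemma ND.good (h : ND p g P Q) : ∀ᶠ z in Bornology.cobounded ℂ, z ≠ 0 ∧ p.eval z ≠ 0 ∧ sg p z ≠ 0 := by
  have hc := h.card3
  have h1 : ∀ᶠ z in Bornology.cobounded ℂ, sg p z ≠ 0 :=
    (sg_tend p).eventually_ne (by simp only [ne_eq, Nat.cast_eq_zero]; omega)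
  have h2 : ∀ᶠ z in Bornology.cobounded ℂ, p.eval z ≠ 0 :=
    ev_cob (finite_setOfPred_isRoot h.p0)
  have h3 : ∀ᶠ z : ℂ in Bornology.cobounded ℂ, z ≠ 0 := by
    simpa using ev_cob (Set.finite_singleton (0 : ℂ))
  filter_upwards [h1, h2, h3] with z a b c using ⟨c, b, a⟩

lemma newt_sg {z : ℂ} (h0 : z ≠ 0) (hp : p.eval z ≠ 0) : NewtonMap p z = z - z / sg p z := by
  have h1 := (IsAlgClosed.splits p).eval_derivative_div_eval_of_ne_zero hp
  have h2 : sg p z = z * ((derivative p).eval z / p.eval z) := by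
    rw [h1, sg, ← Multiset.sum_map_mul_left]
    congr 1; refine Multiset.map_congr rfl fun a _ => by ring
  rw [NewtonMap, h2, div_mul_eq_div_div, div_self h0, one_div_div]

lemma ND.infx (h : ND p g P Q) (ξ : ℂ) : Tendsto (fun z => (NewtonMap p z - ξ) / (z - ξ)) (Bornology.cobounded ℂ)
    (𝓝 (1 - 1 / (Multiset.card p.roots : ℂ))) := by
  have hc := h.card3
  have h1 := ((tend_one ξ).div (sg_tend p) (by simp only [ne_eq, Nat.cast_eq_zero]; omega)).const_sub 1
  refine h1.congr' ?_
  have h3 : ∀ᶠ z : ℂ in Bornology.cobounded ℂ, z ≠ ξ := by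
    simpa using ev_cob (Set.finite_singleton ξ)
  filter_upwards [h.good, h3] with z ⟨a, b, c⟩ d
  have := sub_ne_zero.2 d
  rw [newt_sg a b]
  simp only [Pi.div_apply]
  field_simp
  ring

lemma ND.infl (h : ND p g P Q) : ∀ ε > 0, ∃ R, ∀ z z', R < ‖z‖ → R < ‖z'‖ → z ≠ z' →
    ‖(NewtonMap p z - NewtonMap p z') / (z - z') - (1 - 1 / (Multiset.card p.roots : ℂ))‖ < ε := by
  intro ε hε
  have hc := h.card3
  have hc0 : (Multiset.card p.roots : ℂ) ≠ 0 := by simp only [ne_eq, Nat.cast_eq_zero]; omega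
  set L := Bornology.cobounded ℂ
  set τ : ℂ × ℂ → ℂ := fun x => (p.roots.map fun a => x.1 / (x.1 - a) * (x.2 / (x.2 - a))).sum with hτ
  have h1 : Tendsto τ (L ×ˢ L) (𝓝 (Multiset.card p.roots : ℂ)) := by
    have := tendsto_multiset_sum (f := fun (a : ℂ) (x : ℂ × ℂ) => x.1 / (x.1 - a) * (x.2 / (x.2 - a))) (x := L ×ˢ L)
      (a := fun _ => (1 : ℂ)) p.roots (fun a _ => by
        simpa using ((tend_one a).comp tendsto_fst).mul ((tend_one a).comp tendsto_snd))
    simpa using this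
  have h2 : Tendsto (fun x : ℂ × ℂ => 1 - τ x / (sg p x.1 * sg p x.2)) (L ×ˢ L)
      (𝓝 (1 - 1 / (Multiset.card p.roots : ℂ))) := by
    have := (h1.div (((sg_tend p).comp tendsto_fst).mul ((sg_tend p).comp tendsto_snd)) (mul_ne_zero hc0 hc0)).const_sub 1
    rw [div_mul_cancel_left₀ hc0, ← one_div] at this
    exact this
  have h3 := h2.eventually (ball_mem_nhds _ hε)
  have h4 := h3.and ((tendsto_fst.eventually h.good).and (tendsto_snd.eventually h.good))
  rw [eventually_prod_self_iff'] at h4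
  obtain ⟨t, ht, ht'⟩ := h4
  obtain ⟨R, -, hR⟩ := (hasBasis_cobounded_compl_closedBall (0 : ℂ)).mem_iff.1 ht
  refine ⟨R, fun z z' hz hz' hne => ?_⟩
  obtain ⟨h5, ⟨a, b, c⟩, a', b', c'⟩ := ht' z (hR (by simpa using hz)) z' (hR (by simpa using hz'))
  have h5' : ‖1 - τ (z, z') / (sg p z * sg p z') - (1 - 1 / (Multiset.card p.roots : ℂ))‖ < ε := by
    simpa [dist_eq_norm] using h5
  convert h5' using 3
  have hz0 := sub_ne_zero.2 hne
  have h6 : z * sg p z' - z' * sg p z = (z - z') * τ (z, z') := by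
    rw [hτ, sg, sg, ← Multiset.sum_map_mul_left, ← Multiset.sum_map_mul_left, ← Multiset.sum_map_mul_left,
      ← Multiset.sum_map_sub]
    congr 1
    refine Multiset.map_congr rfl fun r hr => ?_
    have e1 : z - r ≠ 0 := sub_ne_zero.2 (by rintro rfl; exact b (isRoot_of_mem_roots hr))
    have e2 : z' - r ≠ 0 := sub_ne_zero.2 (by rintro rfl; exact b' (isRoot_of_mem_roots hr))
    simp only
    field_simp; ring
  rw [newt_sg a b, newt_sg a' b', div_eq_iff hz0]
  field_simp
  linear_combination -h6

lemma ND.lam0 (h : ND p g P Q) : (1 - 1 / (Multiset.card p.roots : ℂ)) ≠ 0 := by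
  have hc := h.card3
  intro h0
  have h1 : (Multiset.card p.roots : ℂ) ≠ 0 := by simp only [ne_eq, Nat.cast_eq_zero]; omega
  field_simp at h0
  have : (Multiset.card p.roots : ℂ) = 1 := by linear_combination h0
  have : Multiset.card p.roots = 1 := by exact_mod_cast this
  omega

lemma ND.nmap (h : ND p g P Q) : NMap (NewtonMap p) {z | Q.eval z = 0} where
  plfin := finite_setOfPred_isRoot h.Q0
  diff z hz := (h.der hz).differentiableAt
  pole q hq := by
    have hq' : Q.eval q = 0 := hq
    have h1 : ∀ᶠ z in 𝓝[≠] q, Q.eval z ≠ 0 := by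
      have := (finite_setOfPred_isRoot h.Q0).subset (sdiff_subset (t := {q}))
      have h2 : ({z | Q.IsRoot z} \ {q})ᶜ ∈ 𝓝 q := this.isClosed.isOpen_compl.mem_nhds (by simp)
      filter_upwards [nhdsWithin_le_nhds h2, self_mem_nhdsWithin] with z hz hz2 h0
      exact hz ⟨h0, hz2⟩
    have h2 : Tendsto (fun z => ‖z * Q.eval z - P.eval z‖) (𝓝[≠] q) (𝓝 ‖P.eval q‖) := by
      have : Continuous fun z => ‖z * Q.eval z - P.eval z‖ := by fun_prop
      have := (this.tendsto q).mono_left (nhdsWithin_le_nhds (s := {q}ᶜ))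
      simpa [hq'] using this
    have h3 : Tendsto (fun z => ‖Q.eval z‖) (𝓝[≠] q) (𝓝[>] 0) := by
      refine tendsto_nhdsWithin_iff.2 ⟨?_, h1.mono fun z hz => norm_pos_iff.2 hz⟩
      have : Continuous fun z => ‖Q.eval z‖ := by fun_prop
      have := (this.tendsto q).mono_left (nhdsWithin_le_nhds (s := {q}ᶜ))
      simpa [hq'] using this
    refine (h2.pos_mul_atTop (norm_pos_iff.2 (h.nz hq)) (tendsto_inv_nhdsGT_zero.comp h3)).congr' ?_
    filter_upwards [h1] with z hz
    rw [h.eq, Function.comp, ← div_eq_mul_inv, ← norm_div]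
    congr 1; field_simp
  plfix q hq := by
    have hq' : Q.eval q = 0 := hq
    rw [h.eq, hq']; simp
  inf := by
    have h1 := (h.infx 0).norm
    have h2 : Tendsto (fun z : ℂ => ‖z‖) (Bornology.cobounded ℂ) atTop := tendsto_norm_cobounded_atTop
    refine (h1.pos_mul_atTop (norm_pos_iff.2 h.lam0) h2).congr' ?_
    filter_upwards [h.good] with z hz
    rw [← norm_mul, sub_zero, sub_zero, div_mul_cancel₀ _ hz.1]
  fix z hz hf := by
    have hz' : Q.eval z ≠ 0 := hz
    have hP : P.eval z = 0 := by
      rw [h.eq, sub_eq_self, div_eq_zero_iff, or_iff_left hz'] at hf; exact hf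
    have hp : p.eval z = 0 := by rw [h.pP]; simp [hP]
    obtain ⟨-, -, m, hm, hm'⟩ := h.root hp
    have hd0 : (derivative P).eval z ≠ 0 := by intro h0; apply hz'; rw [hm', h0, mul_zero]
    have hm0 : (m : ℂ) ≠ 0 := by simp only [ne_eq, Nat.cast_eq_zero]; omega
    have : (1 - ((derivative P).eval z * Q.eval z - P.eval z * (derivative Q).eval z) / Q.eval z ^ 2) =
      ((1 - 1 / (m : ℝ) : ℝ) : ℂ) := by
      rw [hP, hm']; push_cast; field_simp; ring
    rw [(h.der hz').deriv, this, norm_real, Real.norm_eq_abs, abs_lt]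
    have h1 : (1 : ℝ) ≤ m := by exact_mod_cast hm
    have h2 : 0 < 1 / (m : ℝ) := by positivity
    have h3 : 1 / (m : ℝ) ≤ 1 := by rw [div_le_one (by positivity)]; exact h1
    constructor <;> linarith
  crit := by
    refine (finite_setOfPred_isRoot h.W0).subset fun z hz => ?_
    have hz' : Q.eval z ≠ 0 := hz.1
    have h1 := hz.2
    rw [(h.der hz').deriv] at h1
    field_simp at h1
    simp only [mem_ofPred_eq, IsRoot.def, eval_sub, eval_mul, eval_pow]
    linear_combination h1

lemma ND.dyn (h : ND p g P Q) {ξ : ℂ} (hξ : p.eval ξ = 0) : Dyn (NewtonMap p) {z | Q.eval z = 0} ξ :=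
  { h.nmap with
    ξpl := (h.root hξ).2.1
    ξfix := by rw [h.eq, (h.root hξ).1]; simp }

lemma ND.concl (h : ND p g P Q) {ξ : ℂ} (hξ : p.eval ξ = 0) {w : ℂ} (hw : w ∈ frontier (Imm (NewtonMap p) ξ)) :
    ∃ z ∈ connectedComponentIn (frontier (Imm (NewtonMap p) ξ)) w,
      (derivative p).eval z = 0 ∧ p.eval z ≠ 0 := by
  obtain ⟨a0, ha0, hne⟩ := Finset.exists_mem_ne (lt_of_lt_of_le (by norm_num) h.rt : 1 < p.roots.toFinset.card) ξ
  rw [Multiset.mem_toFinset, mem_roots h.p0] at ha0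
  have hD := h.dyn hξ
  have hA := h.dyn ha0
  obtain ⟨δ, hδ, hb⟩ := Metric.isOpen_iff.1 hA.isOpen_bas a0 hA.root_mem
  have away : ∃ δ > 0, ∀ z ∈ Imm (NewtonMap p) ξ, δ < ‖z - a0‖ := by
    refine ⟨δ / 2, by positivity, fun z hz => ?_⟩
    by_contra hc
    push Not at hc
    have h1 : z ∈ Bas (NewtonMap p) a0 := hb (by rw [mem_ball, dist_eq_norm]; linarith)
    exact hne (tendsto_nhds_unique h1 (hD.imm_bas hz))
  obtain ⟨Ψ, Z, f, b, β, s0, hL⟩ := mkLf hD h.lam0 h.infl (h.infx ξ) away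
  obtain ⟨q, hq, hq2⟩ := hL.concl hw
  exact ⟨q, hq2, (h.pole_iff q).1 hq⟩

end NewtonPf
end

/-- Every connected component of the boundary (in `ℂ`) of an immediate basin `U_ξ` of a
Newton map contains at least one pole of the Newton map (key claim in the proof of
Corollary 2.7, Existence of Shared Poles). -/
theorem newton_boundary_component_contains_pole
    (p : Polynomial ℂ) (hroots : 3 ≤ p.roots.toFinset.card)
    (ξ : ℂ) (hroot : Polynomial.eval ξ p = 0) :
    ∀ w ∈ frontier (NewtonImmediateBasin p ξ),
      ∃ z ∈ connectedComponentIn (frontier (NewtonImmediateBasin p ξ)) w,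
        Polynomial.eval z (Polynomial.derivative p) = 0 ∧ Polynomial.eval z p ≠ 0 := by

  intro w hw
  have hp0 : p ≠ 0 := by rintro rfl; simp at hroots
  have hd0 : Polynomial.derivative p ≠ 0 := by
    intro h0
    have h1 := Polynomial.derivative_eq_zero.1 h0
    have h2 := p.card_roots'
    have h3 := Multiset.toFinset_card_le p.roots
    omega
  obtain ⟨g, P, Q, h1, h2, h3, h4⟩ := NewtonPf.pq_ex hd0
  exact (NewtonPf.ND.mk hp0 hd0 h1 h2 h3 h4 hroots : NewtonPf.ND p g P Q).concl hroot hw
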